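/- arXiv:2510.23735 — 2 statements merged into one kernel-verified Lean document; each statement's English description precedes it below -/
import Mathlib

section
/- Let r ≤ min(n,m). A rook placement R on the n × m board is the extended shadow set ES(R') of some rook placement R' of size at least r if and only if: for the sequences x_i and y_j from the Viennot shadow construction on R (x_i = 1 if a shadow line has a vertical ray at column i, −1 if column i contains no rook of R, 0 otherwise; y_j analogous for rows), all prefix sums x_1+...+x_i are ≤ m−r and all prefix sums y_1+...+y_j are ≤ n−r. -/
/-- The length of the longest increasing subsequence of `w ∈ S_N` (viewed via
its diagram `{(i, w(i))}`). -/
noncomputable def lis {N : ℕ} (w : Equiv.Perm (Fin N)) : ℕ :=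
  sSup {k | ∃ s : Finset (Fin N), s.card = k ∧
    ∀ a ∈ s, ∀ b ∈ s, a < b → w a < w b}

/-- The index of the Viennot shadow line through the point `(i, w(i))`:
the length of the longest increasing subsequence of `w` ending at position `i`.
(The first shadow line consists of the left-to-right minima, i.e. the points of
level 1; removing them, the second shadow line consists of the left-to-right
minima of the rest, i.e. the points of level 2; and so on.) -/
noncomputable def shadowLevel {N : ℕ} (w : Equiv.Perm (Fin N)) (i : Fin N) : ℕ :=
  sSup {k | ∃ s : Finset (Fin N), s.card = k ∧ i ∈ s ∧ (∀ a ∈ s, a ≤ i) ∧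
    ∀ a ∈ s, ∀ b ∈ s, a < b → w a < w b}

/-- The Viennot shadow set `S(w)`: the set of northeast corners of the shadow
lines of `w`.  A northeast corner arises from each pair of consecutive points
`(i, w(i))`, `(i', w(i'))` on a common shadow line, and is the point
`(i', w(i))`. -/
noncomputable def shadowSet {N : ℕ} (w : Equiv.Perm (Fin N)) :
    Set (Fin N × Fin N) :=
  {q | ∃ i i' : Fin N, i < i' ∧ shadowLevel w i = shadowLevel w i' ∧
    (∀ i'', i < i'' → i'' < i' → shadowLevel w i'' ≠ shadowLevel w i) ∧
    q = (i', w i)}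

/-- A rook placement on the `n × m` board. -/
def IsRookPlacement {n m : ℕ} (R : Finset (Fin n × Fin m)) : Prop :=
  ∀ p ∈ R, ∀ q ∈ R, p ≠ q → p.1 ≠ q.1 ∧ p.2 ≠ q.2

/-- The index, in the extended `(n+m−r) × (n+m−r)` board, of the `i`-th column
of the original board (the `m−r` new columns are added on the left). -/
def colIdx (n m r : ℕ) (hr : r ≤ m) (i : Fin n) : Fin (n + m - r) :=
  ⟨m - r + i.val, by have := i.isLt; omega⟩

/-- The index, in the extended `(n+m−r) × (n+m−r)` board, of the `j`-th row of
the original board (the `n−r` new rows are added at the bottom). -/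
def rowIdx (n m r : ℕ) (hr : r ≤ n) (j : Fin m) : Fin (n + m - r) :=
  ⟨n - r + j.val, by have := j.isLt; omega⟩

/-- `w ∈ S_{n+m−r}` is the extended permutation `EX(R)` of the rook placement
`R`: its diagram restricted to the original board is exactly `R`, the values on
the `m−r` new columns form an increasing pattern, and the positions of the
values in the `n−r` new rows form an increasing pattern. -/
def IsExtension {n m r : ℕ} (hr1 : r ≤ n) (hr2 : r ≤ m)
    (R : Finset (Fin n × Fin m)) (w : Equiv.Perm (Fin (n + m - r))) : Prop :=
  (∀ (i : Fin n) (j : Fin m),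
      (i, j) ∈ R ↔ w (colIdx n m r hr2 i) = rowIdx n m r hr1 j) ∧
  (∀ a b : Fin (n + m - r), a.val < m - r → b.val < m - r → a < b → w a < w b) ∧
  (∀ a b : Fin (n + m - r), (w a).val < n - r → (w b).val < n - r → a < b →
      w a < w b)

/-- The index of the Viennot shadow line (for the shadow construction applied
to the point set `R`) through the point `p ∈ R`: the length of the longest
chain of points of `R`, increasing in both coordinates, ending at `p`. -/
noncomputable def pointLevel {n m : ℕ} (R : Finset (Fin n × Fin m))
    (p : Fin n × Fin m) : ℕ :=
  sSup {k | ∃ s ⊆ R, s.card = k ∧ p ∈ s ∧ (∀ q ∈ s, q.1 ≤ p.1 ∧ q.2 ≤ p.2) ∧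
    ∀ a ∈ s, ∀ b ∈ s, a.1 < b.1 → a.2 < b.2}

open scoped Classical in
/-- The sequence `x_i ∈ {−1,0,1}` of the Viennot shadow construction on `R`:
`1` if some shadow line has its vertical ray at column `i` (i.e. column `i`
contains the westmost point of its shadow line), `−1` if column `i` contains no
point of `R`, and `0` otherwise. -/
noncomputable def xSeq {n m : ℕ} (R : Finset (Fin n × Fin m)) (i : Fin n) : ℤ :=
  if ∃ p ∈ R, p.1 = i ∧ ∀ q ∈ R, pointLevel R q = pointLevel R p → p.1 ≤ q.1
    then 1
  else if ∀ p ∈ R, p.1 ≠ i then -1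
  else 0

open scoped Classical in
/-- The sequence `y_j ∈ {−1,0,1}`: `1` if some shadow line has its horizontal
ray at row `j` (i.e. row `j` contains the southmost point of its shadow line),
`−1` if row `j` contains no point of `R`, and `0` otherwise. -/
noncomputable def ySeq {n m : ℕ} (R : Finset (Fin n × Fin m)) (j : Fin m) : ℤ :=
  if ∃ p ∈ R, p.2 = j ∧ ∀ q ∈ R, pointLevel R q = pointLevel R p → p.2 ≤ q.2
    then 1
  else if ∀ p ∈ R, p.2 ≠ j then -1
  else 0


/-! ### Levels of a permutation -/

section Levels

variable {N : ℕ} (w : Equiv.Perm (Fin N))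

theorem sl_bdd (i : Fin N) : BddAbove {k | ∃ s : Finset (Fin N), s.card = k ∧ i ∈ s ∧
    (∀ a ∈ s, a ≤ i) ∧ ∀ a ∈ s, ∀ b ∈ s, a < b → w a < w b} := by
  refine ⟨N, ?_⟩
  rintro k ⟨s, rfl, -⟩
  simpa using s.card_le_univ

theorem sl_mem (i : Fin N) : ∃ s : Finset (Fin N), s.card = shadowLevel w i ∧ i ∈ s ∧
    (∀ a ∈ s, a ≤ i) ∧ ∀ a ∈ s, ∀ b ∈ s, a < b → w a < w b := by
  have := Nat.sSup_mem (s := {k | ∃ s : Finset (Fin N), s.card = k ∧ i ∈ s ∧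
    (∀ a ∈ s, a ≤ i) ∧ ∀ a ∈ s, ∀ b ∈ s, a < b → w a < w b})
    ⟨1, {i}, by simp, by simp, by simp, by simp⟩ (sl_bdd w i)
  exact this

theorem le_sl (i : Fin N) (s : Finset (Fin N)) (h1 : i ∈ s) (h2 : ∀ a ∈ s, a ≤ i)
    (h3 : ∀ a ∈ s, ∀ b ∈ s, a < b → w a < w b) : s.card ≤ shadowLevel w i :=
  le_csSup (sl_bdd w i) ⟨s, rfl, h1, h2, h3⟩

theorem one_le_sl (i : Fin N) : 1 ≤ shadowLevel w i :=
  le_sl w i {i} (by simp) (by simp) (by simp)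

theorem sl_lt {a b : Fin N} (h : a < b) (hw : w a < w b) :
    shadowLevel w a < shadowLevel w b := by
  obtain ⟨s, hs, ha, hle, hs3⟩ := sl_mem w a
  have hb : b ∉ s := fun hb => absurd (hle b hb) (not_le.mpr h)
  rw [← hs, Nat.lt_iff_add_one_le, ← Finset.card_insert_of_notMem hb]
  have key : ∀ c ∈ s, w c ≤ w a := by
    intro c hc
    rcases (hle c hc).lt_or_eq with h1 | h1
    · exact (hs3 c hc a ha h1).le
    · rw [h1]
  apply le_sl
  · simp
  · intro c hc
    rcases Finset.mem_insert.mp hc with rfl | hc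
    · exact le_rfl
    · exact (hle c hc).trans h.le
  · intro c hc d hd hcd
    rcases Finset.mem_insert.mp hc with hc1 | hc1 <;> rcases Finset.mem_insert.mp hd with hd1 | hd1
    · exact absurd hcd (by rw [hc1, hd1]; exact lt_irrefl _)
    · rw [hc1] at hcd
      exact absurd (hle d hd1) (not_le.mpr (h.trans hcd))
    · rw [hd1]
      exact (key c hc1).trans_lt hw
    · exact hs3 c hc1 d hd1 hcd

theorem sl_pred {c : Fin N} {k : ℕ} (hk : 1 ≤ k) (h : shadowLevel w c = k + 1) :
    ∃ d, d < c ∧ w d < w c ∧ shadowLevel w d = k := by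
  obtain ⟨s, hs, hc, hle, hs3⟩ := sl_mem w c
  have hcard : (s.erase c).card = k := by rw [Finset.card_erase_of_mem hc]; omega
  have hne : (s.erase c).Nonempty := by rw [← Finset.card_pos]; omega
  have hd := (s.erase c).max'_mem hne
  set d := (s.erase c).max' hne with hdd
  obtain ⟨hdc, hds⟩ := Finset.mem_erase.mp hd
  have hlt : d < c := lt_of_le_of_ne (hle d hds) hdc
  have hw := hs3 d hds c hc hlt
  refine ⟨d, hlt, hw, ?_⟩
  have h1 := sl_lt w hlt hw
  have h2 := le_sl w d (s.erase c) hd (fun a ha => Finset.le_max' _ _ ha)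
    (fun a ha b hb => hs3 a (Finset.mem_of_mem_erase ha) b (Finset.mem_of_mem_erase hb))
  omega

/-- a point of level `k` below any point of level at least `k` -/
theorem sl_down {c : Fin N} {k : ℕ} (hk : 1 ≤ k) (h : k ≤ shadowLevel w c) :
    ∃ d, d ≤ c ∧ w d ≤ w c ∧ shadowLevel w d = k := by
  obtain ⟨t, ht⟩ := Nat.exists_eq_add_of_le h
  induction t generalizing c with
  | zero => exact ⟨c, le_rfl, le_rfl, ht⟩
  | succ t ih =>
    obtain ⟨d, h1, h2, h3⟩ := sl_pred w (c := c) (k := k + t) (by omega) (by omega)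
    obtain ⟨e, h4, h5, h6⟩ := ih (c := d) (by omega) h3
    exact ⟨e, h4.trans h1.le, h5.trans h2.le, h6⟩

theorem sl_anti {a b : Fin N} (h : a < b) (he : shadowLevel w a = shadowLevel w b) :
    w b < w a := by
  rcases lt_trichotomy (w a) (w b) with h1 | h1 | h1
  · have := sl_lt w h h1; omega
  · exact absurd (w.injective h1) h.ne
  · exact h1

theorem sl_le (c : Fin N) : shadowLevel w c ≤ c.val + 1 ∧ shadowLevel w c ≤ (w c).val + 1 := by
  induction hk : shadowLevel w c generalizing c with
  | zero => simp
  | succ k ih =>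
    rcases Nat.eq_zero_or_pos k with rfl | hk0
    · constructor <;> omega
    · obtain ⟨d, h1, h2, h3⟩ := sl_pred w hk0 hk
      have := ih d h3
      rw [Fin.lt_def] at h1 h2
      constructor <;> omega

/-- a repeated level yields a corner in the column of the later point -/
theorem corner_col {a b : Fin N} (h : a < b) (he : shadowLevel w a = shadowLevel w b) :
    ∃ i, (b, w i) ∈ shadowSet w := by
  classical
  let S := Finset.univ.filter (fun c : Fin N => c < b ∧ shadowLevel w c = shadowLevel w b)
  have hne : S.Nonempty := ⟨a, by simp [S, h, he]⟩
  have hm := S.max'_mem hne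
  have hm' : S.max' hne < b ∧ shadowLevel w (S.max' hne) = shadowLevel w b := by
    simpa [S] using hm
  refine ⟨S.max' hne, S.max' hne, b, hm'.1, hm'.2, ?_, rfl⟩
  intro c h1 h2 h3
  have : c ∈ S := by simp [S, h2, h3, hm'.2]
  exact absurd (S.le_max' c this) (not_le.mpr h1)

/-- a repeated level yields a corner in the row of the earlier point -/
theorem corner_row {a b : Fin N} (h : a < b) (he : shadowLevel w a = shadowLevel w b) :
    ∃ i, (i, w a) ∈ shadowSet w := by
  classical
  let S := Finset.univ.filter (fun c : Fin N => a < c ∧ shadowLevel w c = shadowLevel w a)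
  have hne : S.Nonempty := ⟨b, by simp [S, h, he]⟩
  have hm := S.min'_mem hne
  have hm' : a < S.min' hne ∧ shadowLevel w (S.min' hne) = shadowLevel w a := by
    simpa [S] using hm
  refine ⟨S.min' hne, a, S.min' hne, hm'.1, hm'.2.symm, ?_, rfl⟩
  intro c h1 h2 h3
  have : c ∈ S := by simp [S, h1, h3]
  exact absurd (S.min'_le c this) (not_le.mpr h2)

theorem nat_level (K : ℕ) (l : ℕ → ℕ) (h1 : ∀ c < K, 1 ≤ l c) (h2 : ∀ c < K, l c ≤ c + 1)
    (hi : ∀ c < K, ∀ d < c, l d ≠ l c) : ∀ c < K, l c = c + 1 := by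
  intro c
  induction c using Nat.strong_induction_on with
  | _ c ih =>
    intro hc
    by_contra hne
    have h3 := h1 c hc
    have h4 := h2 c hc
    have h5 := ih (l c - 1) (by omega) (by omega)
    exact hi c hc (l c - 1) (by omega) (by omega)

theorem incr_cols (K : ℕ) (h : ∀ a b : Fin N, a.val < K → (a, b) ∉ shadowSet w) :
    ∀ a b : Fin N, a.val < K → b.val < K → a < b → w a < w b := by
  have hl : ∀ c : Fin N, c.val < K → shadowLevel w c = c.val + 1 := by
    intro c hc
    have := nat_level (min K N) (fun c => if h : c < N then shadowLevel w ⟨c, h⟩ else 0)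
      (fun c hc => by
        have : c < N := by omega
        simpa [this] using one_le_sl w _)
      (fun c hc => by
        have : c < N := by omega
        simpa [this] using (sl_le w ⟨c, this⟩).1)
      (fun c hc d hd => by
        have h1 : c < N := by omega
        have h2 : d < N := by omega
        simp only [h1, h2, dif_pos]
        intro he
        obtain ⟨i, hi⟩ := corner_col w (a := ⟨d, h2⟩) (b := ⟨c, h1⟩) hd he
        exact h _ _ (show c < K by omega) hi) c.val (by have := c.isLt; omega)
    simpa using this
  have main : ∀ t : ℕ, ∀ b : Fin N, b.val = t → b.val < K → ∀ a : Fin N, a < b → w a < w b := by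
    intro t
    induction t with
    | zero => intro b hb _ a hab; rw [Fin.lt_def] at hab; omega
    | succ t ih =>
      intro b hb hK a hab
      rw [Fin.lt_def] at hab
      obtain ⟨d, h1, h2, h3⟩ := sl_pred w (c := b) (k := t + 1) (by omega) (by rw [hl b hK, hb])
      rw [Fin.lt_def] at h1
      have h4 := hl d (by omega)
      rcases Nat.lt_or_ge a.val d.val with h5 | h5
      · exact (ih d (by omega) (by omega) a h5).trans h2
      · have : a = d := Fin.ext (by omega)
        rw [this]; exact h2
  intro a b _ hb hab
  exact main b.val b rfl hb a hab

theorem incr_rows (K : ℕ) (h : ∀ a b : Fin N, b.val < K → (a, b) ∉ shadowSet w) :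
    ∀ a b : Fin N, (w a).val < K → (w b).val < K → a < b → w a < w b := by
  have hl : ∀ c : Fin N, (w c).val < K → shadowLevel w c = (w c).val + 1 := by
    intro c hc
    have := nat_level (min K N) (fun c => if h : c < N then shadowLevel w (w.symm ⟨c, h⟩) else 0)
      (fun c hc => by
        have : c < N := by omega
        simpa [this] using one_le_sl w _)
      (fun c hc => by
        have : c < N := by omega
        simpa [this] using (sl_le w (w.symm ⟨c, this⟩)).2)
      (fun c hc d hd => by
        have h1 : c < N := by omega
        have h2 : d < N := by omega
        simp only [h1, h2, dif_pos]
        intro he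
        rcases lt_trichotomy (w.symm ⟨d, h2⟩) (w.symm ⟨c, h1⟩) with h3 | h3 | h3
        · obtain ⟨i, hi⟩ := corner_row w h3 he
          exact h _ _ (show (w (w.symm ⟨d, h2⟩)).val < K by simp; omega) hi
        · have := w.symm.injective h3
          simp at this; omega
        · obtain ⟨i, hi⟩ := corner_row w h3 he.symm
          exact h _ _ (show (w (w.symm ⟨c, h1⟩)).val < K by simp; omega) hi)
      (w c).val (by have := (w c).isLt; omega)
    simpa using this
  have main : ∀ t : ℕ, ∀ b : Fin N, (w b).val = t → (w b).val < K →
      ∀ a : Fin N, w a < w b → a < b := by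
    intro t
    induction t with
    | zero => intro b hb _ a hab; rw [Fin.lt_def] at hab; omega
    | succ t ih =>
      intro b hb hK a hab
      rw [Fin.lt_def] at hab
      obtain ⟨d, h1, h2, h3⟩ := sl_pred w (c := b) (k := t + 1) (by omega) (by rw [hl b hK, hb])
      rw [Fin.lt_def] at h2
      have h4 := hl d (by omega)
      rcases Nat.lt_or_ge (w a).val (w d).val with h5 | h5
      · exact (ih d (by omega) (by omega) a h5).trans h1
      · have : a = d := w.injective (Fin.ext (by omega))
        rw [this]; exact h1
  intro a b ha hb hab
  rcases lt_trichotomy (w a) (w b) with h1 | h1 | h1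
  · exact h1
  · exact absurd (w.injective h1) hab.ne
  · exact absurd (main _ a rfl ha b h1) (not_lt.mpr hab.le)

/-- corners of the same level form an antichain -/
theorem corner_levels {i i' s s' : Fin N}
    (h1 : i < i') (h2 : shadowLevel w i = shadowLevel w i')
    (h5 : shadowLevel w s = shadowLevel w s')
    (h6 : ∀ t, s < t → t < s' → shadowLevel w t ≠ shadowLevel w s)
    (h7 : i' < s') (h8 : w i < w s) : shadowLevel w i' ≠ shadowLevel w s' := by
  intro he
  have h9 : i' ≤ s := by
    by_contra hc
    exact h6 i' (not_le.mp hc) h7 (by omega)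
  have h10 := sl_anti w h1 h2
  rcases h9.lt_or_eq with h11 | h11
  · have := sl_anti w h11 (by omega)
    exact absurd (h8.trans (this.trans h10)) (lt_irrefl _)
  · rw [h11] at h10
    exact absurd (h8.trans h10) (lt_irrefl _)

/-- Corners are read off locally from the height function. -/
theorem corner_iff (f : ℕ → ℕ → ℤ)
    (H : ∀ i ≤ N, ∀ j ≤ N, ∀ k : ℕ, 1 ≤ k → ((k : ℤ) ≤ f i j ↔
      ∃ d : Fin N, d.val < i ∧ (w d).val < j ∧ shadowLevel w d = k))
    (h0 : ∀ i ≤ N, ∀ j ≤ N, 0 ≤ f i j)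
    (m1 : ∀ i < N, ∀ j ≤ N, f i j ≤ f (i + 1) j) (m2 : ∀ i ≤ N, ∀ j < N, f i j ≤ f i (j + 1))
    (l1 : ∀ i < N, ∀ j ≤ N, f (i + 1) j ≤ f i j + 1)
    (a b : Fin N) : (a, b) ∈ shadowSet w ↔
      f (a + 1) b = f (a + 1) (b + 1) ∧ f a (b + 1) = f (a + 1) (b + 1) ∧
        f a b + 1 = f (a + 1) (b + 1) := by
  have ha := a.isLt
  have hb := b.isLt
  constructor
  · rintro ⟨i, i', h1, h2, h3, h4⟩
    obtain ⟨rfl, rfl⟩ := Prod.mk.inj h4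
    have hk := one_le_sl w a
    have e1 := (H (a + 1) (by omega) (w i) (by omega) _ hk).2
      ⟨a, by omega, sl_anti w h1 h2, rfl⟩
    have e2 := (H a (by omega) (w i + 1) (by omega) _ hk).2
      ⟨i, h1, by omega, h2⟩
    have e3 : ¬ (((shadowLevel w a + 1 : ℕ) : ℤ) ≤ f (a + 1) (w i + 1)) := by
      rw [H (a + 1) (by omega) (w i + 1) (by omega) _ (by omega)]
      rintro ⟨c, hc1, hc2, hc3⟩
      obtain ⟨d, hd1, hd2, hd3⟩ := sl_pred w hk hc3
      rw [Fin.lt_def] at hd1 hd2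
      rcases lt_trichotomy d i with h | h | h
      · have := sl_anti w h (by omega)
        rw [Fin.lt_def] at this; omega
      · subst h; omega
      · exact h3 d h (by rw [Fin.lt_def]; omega) (by omega)
    have e4 : ¬ (((shadowLevel w a : ℕ) : ℤ) ≤ f a (w i)) := by
      rw [H a (by omega) (w i) (by omega) _ hk]
      rintro ⟨d, hd1, hd2, hd3⟩
      rcases lt_trichotomy d i with h | h | h
      · have := sl_anti w h (by omega)
        rw [Fin.lt_def] at this; omega
      · subst h; omega
      · exact h3 d h hd1 (by omega)
    have := m1 a ha (w i + 1) (by omega)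
    have := m2 (a + 1) (by omega) (w i) hb
    have := l1 a ha (w i) (by omega)
    push_cast at e3
    omega
  · rintro ⟨h1, h2, h3⟩
    have hn := h0 a (by omega) b (by omega)
    obtain ⟨k, hk⟩ := Int.eq_ofNat_of_zero_le hn
    have hno : ¬ ∃ d : Fin N, d.val < a ∧ (w d).val < b ∧ shadowLevel w d = k + 1 := by
      rw [← H a (by omega) b (by omega) (k + 1) (by omega)]; push_cast; omega
    obtain ⟨d, hd1, hd2, hd3⟩ := (H (a + 1) (by omega) b (by omega) (k + 1) (by omega)).1
      (by push_cast; omega)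
    obtain ⟨e, he1, he2, he3⟩ := (H a (by omega) (b + 1) (by omega) (k + 1) (by omega)).1
      (by push_cast; omega)
    have hda : d = a := by
      by_contra hne
      have : d.val ≠ a.val := fun h => hne (Fin.ext h)
      exact hno ⟨d, by omega, hd2, hd3⟩
    have heb : w e = b := by
      by_contra hne
      have : (w e).val ≠ b.val := fun h => hne (Fin.ext h)
      exact hno ⟨e, he1, by omega, he3⟩
    refine ⟨e, a, he1, by rw [he3, ← hda, hd3], ?_, by rw [heb]⟩
    intro t ht1 ht2 ht3
    have := sl_anti w ht1 ht3.symm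
    rw [heb] at this
    exact hno ⟨t, ht2, this, by omega⟩

end Levels

/-! ### The backward growth diagram -/

section Growth

open scoped Classical in
/-- the first-row height function, computed backwards from the outer boundary -/
noncomputable def gf (N : ℕ) (R : ℕ → ℕ → Prop) (A B : ℕ → ℤ) (i j : ℕ) : ℤ :=
  if i ≥ N then B j else if j ≥ N then A i else
    min (gf N R A B (i + 1) j) (gf N R A B i (j + 1)) - if R i j then 1 else 0
termination_by (N - i) + (N - j)

/-- boundary data for the growth diagram -/
structure GData (N : ℕ) (R : ℕ → ℕ → Prop) (A B : ℕ → ℤ) : Prop where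
  hb : ∀ i j, R i j → i < N ∧ j < N
  hcol : ∀ i j j', R i j → R i j' → j = j'
  hrow : ∀ i i' j, R i j → R i' j → i = i'
  A0 : A 0 = 0
  B0 : B 0 = 0
  hA : ∀ i < N, (∃ j, R i j) → A (i + 1) = A i
  hA' : ∀ i < N, (¬ ∃ j, R i j) → A (i + 1) = A i + 1
  hB : ∀ j < N, (∃ i, R i j) → B (j + 1) = B j
  hB' : ∀ j < N, (¬ ∃ i, R i j) → B (j + 1) = B j + 1
  hAB : A N = B N
  chA : ∀ (C : Finset (ℕ × ℕ)) (i : ℕ), i ≤ N → (∀ p ∈ C, R p.1 p.2 ∧ p.1 < i) →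
    (∀ p ∈ C, ∀ q ∈ C, p.1 < q.1 → p.2 < q.2) → (C.card : ℤ) ≤ A i
  chB : ∀ (C : Finset (ℕ × ℕ)) (j : ℕ), j ≤ N → (∀ p ∈ C, R p.1 p.2 ∧ p.2 < j) →
    (∀ p ∈ C, ∀ q ∈ C, p.1 < q.1 → p.2 < q.2) → (C.card : ℤ) ≤ B j

variable {N : ℕ} {R : ℕ → ℕ → Prop} {A B : ℕ → ℤ}

/-- downward induction from `N` -/
theorem down_ind {P : ℕ → Prop} (N : ℕ) (h0 : P N) (hs : ∀ j < N, P (j + 1) → P j) :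
    ∀ j ≤ N, P j := by
  intro j hj
  obtain ⟨t, ht⟩ := Nat.exists_eq_add_of_le hj
  induction t generalizing j with
  | zero => have : j = N := by omega
            rw [this]; exact h0
  | succ t ih => exact hs j (by omega) (ih (j + 1) (by omega) (by omega))

theorem gf_right (j : ℕ) : gf N R A B N j = B j := by
  rw [gf]; simp

theorem gf_top (h : GData N R A B) {i : ℕ} (hi : i ≤ N) : gf N R A B i N = A i := by
  rw [gf]
  by_cases h1 : i ≥ N
  · have : i = N := by omega
    subst this
    simp [h.hAB]
  · simp [h1]

theorem gf_R {i j : ℕ} (hi : i < N) (hj : j < N) (hR : R i j) :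
    gf N R A B i j = min (gf N R A B (i + 1) j) (gf N R A B i (j + 1)) - 1 := by
  rw [gf]
  simp [not_le.mpr hi, not_le.mpr hj, hR]

theorem gf_nR {i j : ℕ} (hi : i < N) (hj : j < N) (hR : ¬ R i j) :
    gf N R A B i j = min (gf N R A B (i + 1) j) (gf N R A B i (j + 1)) := by
  rw [gf]
  simp [not_le.mpr hi, not_le.mpr hj, hR]

theorem gf_m1 (h : GData N R A B) : ∀ i < N, ∀ j ≤ N,
    gf N R A B i j ≤ gf N R A B (i + 1) j := by
  intro i hi j hj
  rcases hj.lt_or_eq with hj | rfl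
  · by_cases hR : R i j
    · rw [gf_R hi hj hR]; omega
    · rw [gf_nR hi hj hR]; omega
  · rw [gf_top h hi.le, gf_top h hi]
    by_cases hR : ∃ k, R i k
    · rw [h.hA i hi hR]
    · rw [h.hA' i hi hR]; omega

theorem gf_m2 (h : GData N R A B) : ∀ i ≤ N, ∀ j < N,
    gf N R A B i j ≤ gf N R A B i (j + 1) := by
  intro i hi j hj
  rcases hi.lt_or_eq with hi | rfl
  · by_cases hR : R i j
    · rw [gf_R hi hj hR]; omega
    · rw [gf_nR hi hj hR]; omega
  · rw [gf_right, gf_right]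
    by_cases hR : ∃ k, R k j
    · rw [h.hB j hj hR]
    · rw [h.hB' j hj hR]; omega

theorem gf_dcol (h : GData N R A B) {i j0 : ℕ} (hR : R i j0) : ∀ j ≤ N, j0 < j →
    gf N R A B (i + 1) j = gf N R A B i j := by
  have hi := (h.hb i j0 hR).1
  apply down_ind
  · intro _
    rw [gf_top h hi.le, gf_top h hi, h.hA i hi ⟨_, hR⟩]
  · intro j hj ih hlt
    have h1 : ¬ R i j := fun hc => by have := h.hcol _ _ _ hR hc; omega
    have h2 := gf_nR (A := A) (B := B) hi hj h1
    have h3 := ih (by omega)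
    have h4 := gf_m2 h (i + 1) hi j hj
    omega

theorem gf_drow (h : GData N R A B) {i0 j : ℕ} (hR : R i0 j) : ∀ i ≤ N, i0 < i →
    gf N R A B i (j + 1) = gf N R A B i j := by
  have hj := (h.hb i0 j hR).2
  apply down_ind
  · intro _
    rw [gf_right, gf_right, h.hB j hj ⟨_, hR⟩]
  · intro i hi ih hlt
    have h1 : ¬ R i j := fun hc => by have := h.hrow _ _ _ hR hc; omega
    have h2 := gf_nR (A := A) (B := B) hi hj h1
    have h3 := ih (by omega)
    have h4 := gf_m1 h i hi (j + 1) hj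
    omega

theorem gf_rook (h : GData N R A B) {i j : ℕ} (hR : R i j) :
    gf N R A B (i + 1) j = gf N R A B (i + 1) (j + 1) ∧
    gf N R A B i (j + 1) = gf N R A B (i + 1) (j + 1) ∧
    gf N R A B i j + 1 = gf N R A B (i + 1) (j + 1) := by
  obtain ⟨hi, hj⟩ := h.hb i j hR
  have h1 := gf_dcol h hR (j + 1) hj (by omega)
  have h2 := gf_drow h hR (i + 1) hi (by omega)
  have h3 := gf_R (A := A) (B := B) hi hj hR
  omega

theorem gf_l1 (h : GData N R A B) : ∀ i < N, ∀ j ≤ N,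
    gf N R A B (i + 1) j ≤ gf N R A B i j + 1 := by
  intro i hi
  apply down_ind
  · rw [gf_top h hi.le, gf_top h hi]
    by_cases hR : ∃ k, R i k
    · rw [h.hA i hi hR]; omega
    · rw [h.hA' i hi hR]
  · intro j hj ih
    by_cases hR : R i j
    · have := gf_rook h hR
      omega
    · have h2 := gf_nR (A := A) (B := B) hi hj hR
      have h4 := gf_m2 h (i + 1) hi j hj
      omega

theorem gf_l2 (h : GData N R A B) : ∀ j < N, ∀ i ≤ N,
    gf N R A B i (j + 1) ≤ gf N R A B i j + 1 := by
  intro j hj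
  apply down_ind
  · rw [gf_right, gf_right]
    by_cases hR : ∃ k, R k j
    · rw [h.hB j hj hR]; omega
    · rw [h.hB' j hj hR]
  · intro i hi ih
    by_cases hR : R i j
    · have := gf_rook h hR
      omega
    · have h2 := gf_nR (A := A) (B := B) hi hj hR
      have h4 := gf_m1 h i hi (j + 1) hj
      omega

/-- the value is realised by a chain -/
theorem gf_wit (h : GData N R A B) : ∀ i ≤ N, ∀ j ≤ N,
    ∃ C : Finset (ℕ × ℕ), (∀ p ∈ C, R p.1 p.2 ∧ i ≤ p.1 ∧ j ≤ p.2) ∧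
      (∀ p ∈ C, ∀ q ∈ C, p.1 < q.1 → p.2 < q.2) ∧
      ((∃ i', i ≤ i' ∧ i' ≤ N ∧ (∀ p ∈ C, p.1 < i') ∧ gf N R A B i j = A i' - C.card) ∨
       (∃ j', j ≤ j' ∧ j' ≤ N ∧ (∀ p ∈ C, p.2 < j') ∧ gf N R A B i j = B j' - C.card)) := by
  apply down_ind
  · intro j hj
    exact ⟨∅, by simp, by simp, Or.inr ⟨j, le_rfl, hj, by simp, by simp [gf_right]⟩⟩
  · intro i hi ihi
    apply down_ind
    · exact ⟨∅, by simp, by simp, Or.inl ⟨i, le_rfl, hi.le, by simp, by simp [gf_top h hi.le]⟩⟩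
    · intro j hj ihj
      by_cases hR : R i j
      · obtain ⟨C, h1, h2, h3⟩ := ihi (j + 1) hj
        have hg := gf_rook h hR
        have hn : (i, j) ∉ C := fun hc => by have := (h1 _ hc).2.1; simp at this
        refine ⟨insert (i, j) C, ?_, ?_, ?_⟩
        · intro p hp
          rcases Finset.mem_insert.mp hp with rfl | hp
          · exact ⟨hR, le_rfl, le_rfl⟩
          · have := h1 p hp
            exact ⟨this.1, by omega, by omega⟩
        · intro p hp q hq hpq
          rcases Finset.mem_insert.mp hp with hp1 | hp1 <;>
            rcases Finset.mem_insert.mp hq with hq1 | hq1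
          · rw [hp1, hq1] at hpq; simp at hpq
          · have := h1 q hq1
            rw [hp1]; show j < q.2; omega
          · have := h1 p hp1
            rw [hq1] at hpq
            have : p.1 < i := hpq
            omega
          · exact h2 p hp1 q hq1 hpq
        · rw [Finset.card_insert_of_notMem hn]
          rcases h3 with ⟨i', h4, h5, h6, h7⟩ | ⟨j', h4, h5, h6, h7⟩
          · left
            refine ⟨i', by omega, h5, ?_, by push_cast; omega⟩
            intro p hp
            rcases Finset.mem_insert.mp hp with rfl | hp
            · show i < i'; omega
            · exact h6 p hp
          · right
            refine ⟨j', by omega, h5, ?_, by push_cast; omega⟩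
            intro p hp
            rcases Finset.mem_insert.mp hp with rfl | hp
            · show j < j'; omega
            · exact h6 p hp
      · have hg := gf_nR (A := A) (B := B) hi hj hR
        rcases le_total (gf N R A B (i + 1) j) (gf N R A B i (j + 1)) with hle | hle
        · obtain ⟨C, h1, h2, h3⟩ := ihi j hj.le
          refine ⟨C, fun p hp => ?_, h2, ?_⟩
          · have := h1 p hp
            exact ⟨this.1, by omega, by omega⟩
          · rw [hg, min_eq_left hle]
            rcases h3 with ⟨i', h4, h5⟩ | h3
            · exact Or.inl ⟨i', by omega, h5⟩
            · exact Or.inr h3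
        · obtain ⟨C, h1, h2, h3⟩ := ihj
          refine ⟨C, fun p hp => ?_, h2, ?_⟩
          · have := h1 p hp
            exact ⟨this.1, by omega, by omega⟩
          · rw [hg, min_eq_right hle]
            rcases h3 with h3 | ⟨i', h4, h5⟩
            · exact Or.inl h3
            · exact Or.inr ⟨i', by omega, h5⟩

theorem gf_nonneg (h : GData N R A B) : ∀ i ≤ N, ∀ j ≤ N, 0 ≤ gf N R A B i j := by
  have h00 : 0 ≤ gf N R A B 0 0 := by
    obtain ⟨C, h1, h2, h3⟩ := gf_wit h 0 (Nat.zero_le _) 0 (Nat.zero_le _)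
    rcases h3 with ⟨i', -, h5, h6, h7⟩ | ⟨j', -, h5, h6, h7⟩
    · have := h.chA C i' h5 (fun p hp => ⟨(h1 p hp).1, h6 p hp⟩) h2
      omega
    · have := h.chB C j' h5 (fun p hp => ⟨(h1 p hp).1, h6 p hp⟩) h2
      omega
  intro i
  induction i with
  | zero =>
    intro _ j
    induction j with
    | zero => intro _; exact h00
    | succ j ih => intro hj; exact (ih (by omega)).trans (gf_m2 h 0 (by omega) j hj)
  | succ i ih => intro hi j hj; exact (ih (by omega) j hj).trans (gf_m1 h i hi j hj)

theorem gf_mono (h : GData N R A B) {i i' j j' : ℕ} (hi : i ≤ i') (hi' : i' ≤ N) (hj : j ≤ j')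
    (hj' : j' ≤ N) : gf N R A B i j ≤ gf N R A B i' j' := by
  have h1 : gf N R A B i j ≤ gf N R A B i' j := by
    induction i', hi using Nat.le_induction with
    | base => exact le_rfl
    | succ k hk ih => exact (ih (by omega)).trans (gf_m1 h k (by omega) j (by omega))
  have h2 : gf N R A B i' j ≤ gf N R A B i' j' := by
    induction j', hj using Nat.le_induction with
    | base => exact le_rfl
    | succ k hk ih => exact (ih (by omega)).trans (gf_m2 h i' hi' k (by omega))
  exact h1.trans h2

theorem gf_zero_left (h : GData N R A B) {j : ℕ} (hj : j ≤ N) : gf N R A B 0 j = 0 := by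
  have h1 := gf_nonneg h 0 (by omega) j hj
  have h2 := gf_mono h (le_refl 0) (by omega) hj le_rfl
  rw [gf_top h (by omega), h.A0] at h2
  omega

theorem gf_zero_bot (h : GData N R A B) {i : ℕ} (hi : i ≤ N) : gf N R A B i 0 = 0 := by
  have h1 := gf_nonneg h i hi 0 (by omega)
  have h2 := gf_mono h hi le_rfl (le_refl 0) (by omega)
  rw [gf_right, h.B0] at h2
  omega

/-- cells that carry a point of the permutation -/
def gX (N : ℕ) (R : ℕ → ℕ → Prop) (A B : ℕ → ℤ) (i j : ℕ) : Prop :=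
  gf N R A B (i + 1) j = gf N R A B i j ∧ gf N R A B i (j + 1) = gf N R A B i j ∧
    gf N R A B (i + 1) (j + 1) = gf N R A B i j + 1

theorem nat_ivt (d : ℕ → ℤ) (K : ℕ) (h0 : d 0 = 0) (hK : d K = 1)
    (hd : ∀ j ≤ K, d j = 0 ∨ d j = 1) : ∃ j < K, d j = 0 ∧ d (j + 1) = 1 := by
  induction K with
  | zero => omega
  | succ K ih =>
    rcases hd K (by omega) with h | h
    · exact ⟨K, by omega, h, hK⟩
    · obtain ⟨j, h1, h2⟩ := ih h (fun j hj => hd j (by omega))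
      exact ⟨j, by omega, h2⟩

theorem gX_col (h : GData N R A B) {i : ℕ} (hi : i < N) : ∃ j < N, gX N R A B i j := by
  have key : ∃ K ≤ N, gf N R A B (i + 1) K - gf N R A B i K = 1 := by
    by_cases hR : ∃ k, R i k
    · obtain ⟨k, hk⟩ := hR
      have := gf_rook h hk
      exact ⟨k, (h.hb _ _ hk).2.le, by omega⟩
    · refine ⟨N, le_rfl, ?_⟩
      rw [gf_top h hi.le, gf_top h hi, h.hA' i hi hR]; omega
  obtain ⟨K, hKN, hK⟩ := key
  obtain ⟨j, hj, h1, h2⟩ := nat_ivt (fun j => gf N R A B (i + 1) j - gf N R A B i j) K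
    (by simp [gf_zero_bot h hi.le, gf_zero_bot h (show i + 1 ≤ N from hi)]) hK
    (fun j hj => by
      have := gf_m1 h i hi j (by omega)
      have := gf_l1 h i hi j (by omega)
      omega)
  have hjN : j < N := by omega
  refine ⟨j, hjN, ?_⟩
  have hnR : ¬ R i j := fun hc => by
    have := gf_rook h hc
    omega
  have h3 := gf_nR (A := A) (B := B) hi hjN hnR
  have h4 := gf_m1 h i hi (j + 1) hjN
  have h5 := gf_m2 h i hi.le j hjN
  have h6 := gf_m2 h (i + 1) hi j hjN
  have h7 := gf_l2 h j hjN (i + 1) hi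
  refine ⟨?_, ?_, ?_⟩ <;> omega

theorem gX_row_aux (h : GData N R A B) {i i' j : ℕ} (hj : j < N) (hii : i < i') (hi' : i' < N)
    (hX : gX N R A B i j) (hX' : gX N R A B i' j) : False := by
  obtain ⟨x1, x2, x3⟩ := hX
  obtain ⟨y1, y2, y3⟩ := hX'
  have main : ∀ t, i + 1 ≤ t → t ≤ i' → gf N R A B t (j + 1) = gf N R A B t j + 1 := by
    intro t ht
    induction t, ht using Nat.le_induction with
    | base => intro _; omega
    | succ t ht ih =>
      intro htt
      have h1 := ih (by omega)
      have htN : t < N := by omega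
      by_cases hR : R t j
      · have h2 := gf_drow h hR (i' + 1) hi' (by omega)
        omega
      · have h2 := gf_nR (A := A) (B := B) htN hj hR
        have h3 := gf_m1 h t htN (j + 1) hj
        have h4 := gf_l2 h j hj (t + 1) htN
        omega
  have := main i' hii le_rfl
  omega

theorem gX_row (h : GData N R A B) {i i' j : ℕ} (hj : j < N) (hi : i < N) (hi' : i' < N)
    (hX : gX N R A B i j) (hX' : gX N R A B i' j) : i = i' := by
  rcases lt_trichotomy i i' with h1 | h1 | h1
  · exact (gX_row_aux h hj h1 hi' hX hX').elim
  · exact h1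
  · exact (gX_row_aux h hj h1 hi hX' hX).elim

theorem exists_perm (h : GData N R A B) : ∃ w : Equiv.Perm (Fin N),
    ∀ a b : Fin N, gX N R A B a b ↔ w a = b := by
  have hc : ∀ a : Fin N, ∃ b : Fin N, gX N R A B a b := by
    intro a
    obtain ⟨j, hj, hx⟩ := gX_col h a.isLt
    exact ⟨⟨j, hj⟩, hx⟩
  choose w hw using hc
  have hinj : Function.Injective w := by
    intro a b hab
    have h1 := hw a
    rw [hab] at h1
    exact Fin.ext (gX_row h (w b).isLt a.isLt b.isLt h1 (hw b))
  have hbij := Finite.injective_iff_bijective.mp hinj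
  refine ⟨Equiv.ofBijective w hbij, fun a b => ⟨fun hx => ?_, fun hx => ?_⟩⟩
  · obtain ⟨c, hcb⟩ := hbij.2 b
    have h1 := hw c
    rw [hcb] at h1
    have : a = c := Fin.ext (gX_row h b.isLt a.isLt c.isLt hx h1)
    rw [this]; exact hcb
  · have : w a = b := hx
    rw [← this]; exact hw a

/-- descent to a point of the permutation -/
theorem gf_desc (h : GData N R A B) (w : Equiv.Perm (Fin N))
    (hw : ∀ a b : Fin N, gX N R A B a b ↔ w a = b) (k : ℤ) (hk : 1 ≤ k) :
    ∀ t i j, i + j = t → i ≤ N → j ≤ N → k ≤ gf N R A B i j →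
      ∃ d : Fin N, d.val < i ∧ (w d).val < j ∧ gf N R A B (d + 1) (w d + 1) = k := by
  intro t
  induction t with
  | zero =>
    intro i j ht hi hj hle
    have : i = 0 := by omega
    subst this
    rw [gf_zero_left h hj] at hle; omega
  | succ t ih =>
    intro i j ht hi hj hle
    rcases i with _ | i
    · rw [gf_zero_left h hj] at hle; omega
    rcases j with _ | j
    · rw [gf_zero_bot h hi] at hle; omega
    by_cases h1 : k ≤ gf N R A B i (j + 1)
    · obtain ⟨d, h2, h3, h4⟩ := ih i (j + 1) (by omega) (by omega) hj h1
      exact ⟨d, by omega, h3, h4⟩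
    by_cases h5 : k ≤ gf N R A B (i + 1) j
    · obtain ⟨d, h2, h3, h4⟩ := ih (i + 1) j (by omega) hi (by omega) h5
      exact ⟨d, h2, by omega, h4⟩
    have hnR : ¬ R i j := fun hc => by
      have := gf_rook h hc
      omega
    have h6 := gf_nR (A := A) (B := B) hi hj hnR
    have h7 := gf_l1 h i hi (j + 1) hj
    have h8 := gf_l2 h j hj (i + 1) hi
    have hX : gX N R A B i j := by
      refine ⟨?_, ?_, ?_⟩ <;> omega
    have hd : w ⟨i, hi⟩ = ⟨j, hj⟩ := (hw ⟨i, hi⟩ ⟨j, hj⟩).1 hX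
    refine ⟨⟨i, hi⟩, by simp, by simp [hd], ?_⟩
    rw [hd]
    show gf N R A B (i + 1) (j + 1) = k
    omega

theorem gf_level (h : GData N R A B) (w : Equiv.Perm (Fin N))
    (hw : ∀ a b : Fin N, gX N R A B a b ↔ w a = b) (d : Fin N) :
    (shadowLevel w d : ℤ) = gf N R A B (d + 1) (w d + 1) := by
  have hX : ∀ d : Fin N, gX N R A B d (w d) := fun d => (hw d _).2 rfl
  have hnn : ∀ d : Fin N, 0 ≤ gf N R A B d (w d) := fun d =>
    gf_nonneg h _ d.isLt.le _ (w d).isLt.le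
  induction ht : d.val using Nat.strong_induction_on generalizing d with
  | _ t ih =>
    subst ht
    obtain ⟨x1, x2, x3⟩ := hX d
    have hd := hnn d
    have hl := one_le_sl w d
    apply le_antisymm
    · rcases Nat.lt_or_ge 1 (shadowLevel w d) with h1 | h1
      · obtain ⟨e, he1, he2, he3⟩ := sl_pred w (c := d) (k := shadowLevel w d - 1)
          (by omega) (by omega)
        have h2 := ih e he1 e rfl
        have h3 := gf_mono h (show e.val + 1 ≤ d.val from he1) d.isLt.le
          (show (w e).val + 1 ≤ (w d).val from he2) (w d).isLt.le
        omega
      · omega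
    · rcases hd.lt_or_eq with h1 | h1
      · obtain ⟨e, he1, he2, he3⟩ := gf_desc h w hw (gf N R A B d (w d)) (by omega) _ d (w d) rfl
          d.isLt.le (w d).isLt.le le_rfl
        have h2 := ih e he1 e rfl
        have h3 := sl_lt w (a := e) (b := d) he1 he2
        omega
      · omega

theorem backward (h : GData N R A B) : ∃ w : Equiv.Perm (Fin N),
    ∀ a b : Fin N, (a, b) ∈ shadowSet w ↔ R a b := by
  obtain ⟨w, hw⟩ := exists_perm h
  refine ⟨w, fun a b => ?_⟩
  rw [corner_iff w (gf N R A B) ?_ (gf_nonneg h) (gf_m1 h) (gf_m2 h) (gf_l1 h)]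
  · constructor
    · rintro ⟨h1, h2, h3⟩
      by_contra hR
      have := gf_nR (A := A) (B := B) a.isLt b.isLt hR
      omega
    · exact fun hR => gf_rook h hR
  · intro i hi j hj k hk
    constructor
    · intro hle
      obtain ⟨d, h1, h2, h3⟩ := gf_desc h w hw k (by omega) _ i j rfl hi hj hle
      rw [← gf_level h w hw d] at h3
      exact ⟨d, h1, h2, by omega⟩
    · rintro ⟨d, h1, h2, h3⟩
      rw [← h3, gf_level h w hw d]
      exact gf_mono h h1 hi h2 hj

end Growth

/-! ### Levels of points and prefix sums -/

section Points

variable {n m k : ℕ} (R : Finset (Fin n × Fin m))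

theorem pl_bdd (p : Fin n × Fin m) : BddAbove {k | ∃ s ⊆ R, s.card = k ∧ p ∈ s ∧
    (∀ q ∈ s, q.1 ≤ p.1 ∧ q.2 ≤ p.2) ∧ ∀ a ∈ s, ∀ b ∈ s, a.1 < b.1 → a.2 < b.2} := by
  refine ⟨R.card, ?_⟩
  rintro k ⟨s, hs, rfl, -⟩
  exact Finset.card_le_card hs

theorem pl_mem {p : Fin n × Fin m} (hp : p ∈ R) : ∃ s ⊆ R, s.card = pointLevel R p ∧ p ∈ s ∧
    (∀ q ∈ s, q.1 ≤ p.1 ∧ q.2 ≤ p.2) ∧ ∀ a ∈ s, ∀ b ∈ s, a.1 < b.1 → a.2 < b.2 := by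
  have := Nat.sSup_mem (s := {k | ∃ s ⊆ R, s.card = k ∧ p ∈ s ∧
    (∀ q ∈ s, q.1 ≤ p.1 ∧ q.2 ≤ p.2) ∧ ∀ a ∈ s, ∀ b ∈ s, a.1 < b.1 → a.2 < b.2})
    ⟨1, {p}, by simpa using hp, by simp, by simp, by simp, by simp⟩ (pl_bdd R p)
  exact this

theorem le_pl (p : Fin n × Fin m) (s : Finset (Fin n × Fin m)) (h0 : s ⊆ R) (h1 : p ∈ s)
    (h2 : ∀ q ∈ s, q.1 ≤ p.1 ∧ q.2 ≤ p.2)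
    (h3 : ∀ a ∈ s, ∀ b ∈ s, a.1 < b.1 → a.2 < b.2) : s.card ≤ pointLevel R p :=
  le_csSup (pl_bdd R p) ⟨s, h0, rfl, h1, h2, h3⟩

theorem one_le_pl {p : Fin n × Fin m} (hp : p ∈ R) : 1 ≤ pointLevel R p :=
  le_pl R p {p} (by simpa using hp) (by simp) (by simp) (by simp)

theorem pl_lt {p q : Fin n × Fin m} (hp : p ∈ R) (hq : q ∈ R) (h1 : p.1 < q.1) (h2 : p.2 < q.2) :
    pointLevel R p < pointLevel R q := by
  obtain ⟨s, hs, hc, hps, hle, hch⟩ := pl_mem R hp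
  have hn : q ∉ s := fun hc => absurd (hle q hc).1 (not_le.mpr h1)
  rw [← hc, Nat.lt_iff_add_one_le, ← Finset.card_insert_of_notMem hn]
  apply le_pl
  · exact Finset.insert_subset hq hs
  · simp
  · intro a ha
    rcases Finset.mem_insert.mp ha with ha | ha
    · rw [ha]; exact ⟨le_rfl, le_rfl⟩
    · exact ⟨(hle a ha).1.trans h1.le, (hle a ha).2.trans h2.le⟩
  · intro a ha b hb hab
    rcases Finset.mem_insert.mp ha with ha | ha <;> rcases Finset.mem_insert.mp hb with hb | hb
    · rw [ha, hb] at hab; exact absurd hab (lt_irrefl _)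
    · rw [ha] at hab
      exact absurd (hle b hb).1 (not_le.mpr (h1.trans hab))
    · rw [hb]; exact (hle a ha).2.trans_lt h2
    · exact hch a ha b hb hab

open scoped Classical in
theorem prefix_sum (π : Fin n × Fin m → Fin k) (l : Fin n × Fin m → ℕ)
    (hinj : ∀ p ∈ R, ∀ q ∈ R, π p = π q → p = q) (i : Fin k) :
    (∑ i' ∈ Finset.univ.filter (· ≤ i),
      (if ∃ p ∈ R, π p = i' ∧ ∀ q ∈ R, l q = l p → π p ≤ π q then (1 : ℤ)
        else if ∀ p ∈ R, π p ≠ i' then -1 else 0)) =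
    (((R.filter (fun p => π p ≤ i)).image l).card : ℤ) -
      ((Finset.univ.filter (fun i' => i' ≤ i ∧ ∀ p ∈ R, π p ≠ i')).card : ℤ) := by
  let F := R.filter (fun p => π p ≤ i ∧ ∀ q ∈ R, l q = l p → π p ≤ π q)
  have hF : ∀ p, p ∈ F ↔ p ∈ R ∧ π p ≤ i ∧ ∀ q ∈ R, l q = l p → π p ≤ π q := by
    intro p; simp [F]
  have h1 : (R.filter (fun p => π p ≤ i)).image l = F.image l := by
    ext t
    simp only [Finset.mem_image, Finset.mem_filter, hF]
    constructor
    · rintro ⟨p, ⟨hp, hpi⟩, rfl⟩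
      obtain ⟨q, hq, hmin⟩ := Finset.exists_min_image (R.filter (fun q => l q = l p)) π
        ⟨p, by simp [hp]⟩
      simp only [Finset.mem_filter, and_imp] at hq hmin
      exact ⟨q, ⟨hq.1, (hmin p hp rfl).trans hpi, fun a ha hla => hmin a ha (hla.trans hq.2)⟩, hq.2⟩
    · rintro ⟨p, ⟨hp, hpi, -⟩, rfl⟩
      exact ⟨p, ⟨hp, hpi⟩, rfl⟩
  have h2 : (F.image l).card = F.card := by
    apply Finset.card_image_of_injOn
    intro p hp q hq hpq
    have hp := (hF p).1 hp
    have hq := (hF q).1 hq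
    exact hinj p hp.1 q hq.1 (le_antisymm (hp.2.2 q hq.1 hpq.symm) (hq.2.2 p hp.1 hpq))
  have h3 : (F.image π).card = F.card := by
    apply Finset.card_image_of_injOn
    intro p hp q hq hpq
    exact hinj p ((hF p).1 hp).1 q ((hF q).1 hq).1 hpq
  have h4 : F.image π = Finset.univ.filter (fun i' => i' ≤ i ∧
      ∃ p ∈ R, π p = i' ∧ ∀ q ∈ R, l q = l p → π p ≤ π q) := by
    ext t
    simp only [Finset.mem_image, Finset.mem_filter, hF, Finset.mem_univ, true_and]
    constructor
    · rintro ⟨p, ⟨hp, hpi, hh⟩, rfl⟩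
      exact ⟨hpi, p, hp, rfl, hh⟩
    · rintro ⟨hti, p, hp, rfl, hh⟩
      exact ⟨p, ⟨hp, hti, hh⟩, rfl⟩
  rw [h1, h2, ← h3, h4, Finset.card_filter, Finset.card_filter, Finset.sum_filter]
  push_cast
  rw [← Finset.sum_sub_distrib]
  apply Finset.sum_congr rfl
  intro t _
  by_cases hti : t ≤ i
  · by_cases ha : ∃ p ∈ R, π p = t ∧ ∀ q ∈ R, l q = l p → π p ≤ π q
    · have hb : ¬ ∀ p ∈ R, π p ≠ t := by
        obtain ⟨p, hp, hpt, -⟩ := ha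
        exact fun h => h p hp hpt
      rw [if_pos hti, if_pos ha, if_pos ⟨hti, ha⟩, if_neg (fun h => hb h.2)]
      simp
    · by_cases hb : ∀ p ∈ R, π p ≠ t
      · rw [if_pos hti, if_neg ha, if_pos hb, if_neg (fun h => ha h.2), if_pos ⟨hti, hb⟩]
        simp
      · rw [if_pos hti, if_neg ha, if_neg hb, if_neg (fun h => ha h.2), if_neg (fun h => hb h.2)]
        simp
  · rw [if_neg hti, if_neg (fun h => hti h.1), if_neg (fun h => hti h.1)]
    simp

theorem exists_chain (π : Fin n × Fin m → Fin k)
    (hmono : ∀ p q : Fin n × Fin m, p.1 ≤ q.1 → p.2 ≤ q.2 → π p ≤ π q) (i : Fin k) :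
    ∃ C ⊆ R, (∀ p ∈ C, π p ≤ i) ∧ (∀ a ∈ C, ∀ b ∈ C, a.1 < b.1 → a.2 < b.2) ∧
      ((R.filter (fun p => π p ≤ i)).image (pointLevel R)).card ≤ C.card := by
  rcases (R.filter (fun p => π p ≤ i)).eq_empty_or_nonempty with he | hne
  · exact ⟨∅, by simp, by simp, by simp, by simp [he]⟩
  · obtain ⟨p, hp, hmax⟩ := Finset.exists_max_image _ (pointLevel R) hne
    obtain ⟨hpR, hpi⟩ := Finset.mem_filter.mp hp
    obtain ⟨s, hs, hc, hps, hle, hch⟩ := pl_mem R hpR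
    refine ⟨s, hs, fun q hq => (hmono q p (hle q hq).1 (hle q hq).2).trans hpi, hch, ?_⟩
    rw [hc]
    have : (R.filter (fun p => π p ≤ i)).image (pointLevel R) ⊆
        Finset.Icc 1 (pointLevel R p) := by
      intro t ht
      obtain ⟨q, hq, rfl⟩ := Finset.mem_image.mp ht
      exact Finset.mem_Icc.mpr ⟨one_le_pl R (Finset.mem_filter.mp hq).1, hmax q hq⟩
    simpa using Finset.card_le_card this

theorem chain_card (hR : IsRookPlacement R) (π : Fin n × Fin m → Fin k) (i : Fin k)
    (C : Finset (Fin n × Fin m)) (hC : C ⊆ R) (hCi : ∀ p ∈ C, π p ≤ i)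
    (hch : ∀ a ∈ C, ∀ b ∈ C, a.1 < b.1 → a.2 < b.2) :
    C.card ≤ ((R.filter (fun p => π p ≤ i)).image (pointLevel R)).card := by
  apply Finset.card_le_card_of_injOn (pointLevel R)
  · intro p hp
    simp only [Finset.coe_image, Set.mem_image, Finset.mem_coe, Finset.mem_filter]
    exact ⟨p, ⟨hC hp, hCi p hp⟩, rfl⟩
  · intro p hp q hq hpq
    by_contra hne
    rcases lt_trichotomy p.1 q.1 with h | h | h
    · have := pl_lt R (hC hp) (hC hq) h (hch p hp q hq h)
      omega
    · exact (hR p (hC hp) q (hC hq) hne).1 h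
    · have := pl_lt R (hC hq) (hC hp) h (hch q hq p hp h)
      omega

open scoped Classical in
theorem forward_count {N K k : ℕ} {α : Type*} (w π : Equiv.Perm (Fin N)) (C : Finset α)
    (lev : α → ℕ) (hinj : ∀ p ∈ C, ∀ q ∈ C, lev p = lev q → p = q) (i : Fin k)
    (hex : ∀ p ∈ C, ∃ d, shadowLevel w d = lev p ∧ (π d).val ≤ K + i.val)
    (P : Fin k → Prop)
    (hfree : ∀ (d : Fin N) (i' : Fin k), (∀ e, shadowLevel w e = shadowLevel w d → π d ≤ π e) →
      (π d).val = K + i'.val → P i') :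
    C.card ≤ K + (Finset.univ.filter (fun i' => i' ≤ i ∧ P i')).card := by
  have hmin : ∀ p : α, ∃ d : ℕ, p ∈ C → ∃ e : Fin N, (π e).val = d ∧ shadowLevel w e = lev p ∧
      d ≤ K + i.val ∧ ∀ e', shadowLevel w e' = lev p → π e ≤ π e' := by
    intro p
    by_cases hp : p ∈ C
    · obtain ⟨d, hd1, hd2⟩ := hex p hp
      obtain ⟨e, he, hm⟩ := Finset.exists_min_image
        (Finset.univ.filter (fun e => shadowLevel w e = lev p)) π ⟨d, by simp [hd1]⟩
      simp only [Finset.mem_filter, Finset.mem_univ, true_and] at he hm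
      have h1 : (π e).val ≤ (π d).val := hm d hd1
      exact ⟨(π e).val, fun _ => ⟨e, rfl, he, by omega, hm⟩⟩
    · exact ⟨0, fun h => absurd h hp⟩
  choose g hg using hmin
  have h1 : C.card ≤ (Finset.range K ∪ (Finset.univ.filter
      (fun i' : Fin k => i' ≤ i ∧ P i')).image (fun i' => K + i'.val)).card := by
    apply Finset.card_le_card_of_injOn g
    · intro p hp
      obtain ⟨e, h1, h2, h3, h4⟩ := hg p hp
      simp only [Finset.coe_union, Set.mem_union, Finset.mem_coe, Finset.mem_range,
        Finset.mem_image, Finset.mem_filter, Finset.mem_univ, true_and]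
      rcases Nat.lt_or_ge (g p) K with h5 | h5
      · exact Or.inl h5
      · right
        have hi := i.isLt
        refine ⟨⟨g p - K, by omega⟩, ⟨?_, ?_⟩, ?_⟩
        · rw [Fin.le_def]; show g p - K ≤ i.val; omega
        · apply hfree e
          · intro e' he'; exact h4 e' (he'.trans h2)
          · show (π e).val = K + (g p - K); omega
        · show K + (g p - K) = g p; omega
    · intro p hp q hq hpq
      obtain ⟨e, h1, h2, -⟩ := hg p hp
      obtain ⟨e', h1', h2', -⟩ := hg q hq
      have : e = e' := π.injective (Fin.ext (by omega))
      subst this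
      exact hinj p hp q hq (by omega)
  refine h1.trans ((Finset.card_union_le _ _).trans ?_)
  have := Finset.card_image_le (s := Finset.univ.filter (fun i' : Fin k => i' ≤ i ∧ P i'))
    (f := fun i' => K + i'.val)
  simp only [Finset.card_range]
  omega

open scoped Classical in
/-- the number of free lines among the first `i`, after adding `K` new ones -/
noncomputable def freeCnt (π : Fin n × Fin m → Fin k) (K i : ℕ) : ℕ :=
  ((Finset.range i).filter (fun c => ¬ ∃ p ∈ R, c = K + (π p).val)).card

theorem freeCnt_zero (π : Fin n × Fin m → Fin k) (K : ℕ) : freeCnt R π K 0 = 0 := by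
  simp [freeCnt]

theorem freeCnt_pos (π : Fin n × Fin m → Fin k) (K i : ℕ) (h : ∃ p ∈ R, i = K + (π p).val) :
    freeCnt R π K (i + 1) = freeCnt R π K i := by
  classical
  unfold freeCnt
  rw [Finset.range_add_one, Finset.filter_insert, if_neg (not_not.mpr h)]

theorem freeCnt_neg (π : Fin n × Fin m → Fin k) (K i : ℕ) (h : ¬ ∃ p ∈ R, i = K + (π p).val) :
    freeCnt R π K (i + 1) = freeCnt R π K i + 1 := by
  classical
  unfold freeCnt
  rw [Finset.range_add_one, Finset.filter_insert, if_pos h, Finset.card_insert_of_notMem]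
  simp

theorem freeCnt_total (π : Fin n × Fin m → Fin k) (K : ℕ)
    (hinj : ∀ p ∈ R, ∀ q ∈ R, π p = π q → p = q) :
    freeCnt R π K (K + k) + R.card = K + k := by
  classical
  have h1 : ((Finset.range (K + k)).filter (fun c => ∃ p ∈ R, c = K + (π p).val)).card
      = R.card := by
    rw [← Finset.card_image_of_injOn (s := R) (f := fun p => K + (π p).val)]
    · congr 1
      ext c
      simp only [Finset.mem_filter, Finset.mem_range, Finset.mem_image]
      constructor
      · rintro ⟨-, p, hp, rfl⟩; exact ⟨p, hp, rfl⟩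
      · rintro ⟨p, hp, rfl⟩
        exact ⟨by have := (π p).isLt; omega, p, hp, rfl⟩
    · intro p hp q hq hpq
      exact hinj p hp q hq (Fin.ext (by simpa using hpq))
  have h2 := Finset.card_filter_add_card_filter_not (s := Finset.range (K + k))
    (fun c => ∃ p ∈ R, c = K + (π p).val)
  rw [h1, Finset.card_range] at h2
  unfold freeCnt
  omega

open scoped Classical in
theorem le_freeCnt (π : Fin n × Fin m → Fin k) (K : ℕ) (i : Fin k) :
    K + (Finset.univ.filter (fun i' => i' ≤ i ∧ ∀ p ∈ R, π p ≠ i')).card ≤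
      freeCnt R π K (K + i.val + 1) := by
  have hd : Disjoint (Finset.range K) ((Finset.univ.filter
      (fun i' => i' ≤ i ∧ ∀ p ∈ R, π p ≠ i')).image (fun i' : Fin k => K + i'.val)) := by
    rw [Finset.disjoint_left]
    intro c hc hc'
    simp only [Finset.mem_range, Finset.mem_image] at hc hc'
    obtain ⟨i', -, h⟩ := hc'
    omega
  have h2 := Finset.card_union_of_disjoint hd
  rw [Finset.card_image_of_injective _ (fun a b hab => Fin.ext (by simpa using hab)),
    Finset.card_range] at h2
  rw [← h2]
  unfold freeCnt
  apply Finset.card_le_card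
  intro c hc
  simp only [Finset.mem_union, Finset.mem_range, Finset.mem_image, Finset.mem_filter,
    Finset.mem_univ, true_and] at hc ⊢
  rcases hc with hc | ⟨i', ⟨h3, h4⟩, rfl⟩
  · exact ⟨by omega, by rintro ⟨p, -, h⟩; omega⟩
  · rw [Fin.le_def] at h3
    refine ⟨by omega, ?_⟩
    rintro ⟨p, hp, h⟩
    exact h4 p hp (Fin.ext (by omega))

open scoped Classical in
theorem chain_free (hR : IsRookPlacement R) (π : Fin n × Fin m → Fin k) (K : ℕ)
    (hpre : ∀ i : Fin k, (((R.filter (fun p => π p ≤ i)).image (pointLevel R)).card : ℤ) -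
      ((Finset.univ.filter (fun i' => i' ≤ i ∧ ∀ p ∈ R, π p ≠ i')).card : ℤ) ≤ K)
    (C : Finset (Fin n × Fin m)) (hC : C ⊆ R)
    (hch : ∀ a ∈ C, ∀ b ∈ C, a.1 < b.1 → a.2 < b.2)
    (i : ℕ) (hi : i ≤ K + k) (hCi : ∀ p ∈ C, K + (π p).val < i) :
    C.card ≤ freeCnt R π K i := by
  rcases Nat.lt_or_ge K i with h | h
  · have hi0 : i - K - 1 < k := by omega
    have h1 := chain_card R hR π ⟨i - K - 1, hi0⟩ C hC
      (fun p hp => by have := hCi p hp; rw [Fin.le_def]; show (π p).val ≤ i - K - 1; omega) hch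
    have h2 := hpre ⟨i - K - 1, hi0⟩
    have h3 := le_freeCnt R π K ⟨i - K - 1, hi0⟩
    have h4 : K + (i - K - 1) + 1 = i := by omega
    simp only [h4] at h3
    omega
  · have : C = ∅ := by
      rw [Finset.eq_empty_iff_forall_notMem]
      intro p hp
      have := hCi p hp
      omega
    simp [this]

end Points

theorem xSeq_prefix {n m : ℕ} (R : Finset (Fin n × Fin m)) (hR : IsRookPlacement R) (i : Fin n) :
    (∑ i' ∈ Finset.univ.filter (· ≤ i), xSeq R i') =
    (((R.filter (fun p => p.1 ≤ i)).image (pointLevel R)).card : ℤ) -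
      ((Finset.univ.filter (fun i' => i' ≤ i ∧ ∀ p ∈ R, p.1 ≠ i')).card : ℤ) := by
  classical
  have := prefix_sum R Prod.fst (pointLevel R) (fun p hp q hq h => by
    by_contra hne; exact (hR p hp q hq hne).1 h) i
  unfold xSeq
  convert this

theorem ySeq_prefix {n m : ℕ} (R : Finset (Fin n × Fin m)) (hR : IsRookPlacement R) (i : Fin m) :
    (∑ i' ∈ Finset.univ.filter (· ≤ i), ySeq R i') =
    (((R.filter (fun p => p.2 ≤ i)).image (pointLevel R)).card : ℤ) -
      ((Finset.univ.filter (fun i' => i' ≤ i ∧ ∀ p ∈ R, p.2 ≠ i')).card : ℤ) := by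
  classical
  have := prefix_sum R Prod.snd (pointLevel R) (fun p hp q hq h => by
    by_contra hne; exact (hR p hp q hq hne).2 h) i
  unfold ySeq
  convert this

theorem forward_dir (n m r : ℕ) (hr1 : r ≤ n) (hr2 : r ≤ m)
    (R : Finset (Fin n × Fin m)) (hR : IsRookPlacement R) (w : Equiv.Perm (Fin (n + m - r)))
    (hw : ∀ (i : Fin n) (j : Fin m),
      ((i, j) ∈ R → (colIdx n m r hr2 i, rowIdx n m r hr1 j) ∈ shadowSet w)) :
    (∀ i : Fin n, (∑ i' ∈ Finset.univ.filter (· ≤ i), xSeq R i') ≤ (m : ℤ) - r) ∧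
       (∀ j : Fin m, (∑ j' ∈ Finset.univ.filter (· ≤ j), ySeq R j') ≤ (n : ℤ) - r) := by
  classical
  have hlev : ∀ C ⊆ R, (∀ a ∈ C, ∀ b ∈ C, a.1 < b.1 → a.2 < b.2) → ∀ p ∈ C, ∀ q ∈ C,
      shadowLevel w (colIdx n m r hr2 p.1) = shadowLevel w (colIdx n m r hr2 q.1) → p = q := by
    intro C hC hch
    have aux : ∀ p ∈ C, ∀ q ∈ C, p.1 < q.1 →
        shadowLevel w (colIdx n m r hr2 p.1) ≠ shadowLevel w (colIdx n m r hr2 q.1) := by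
      intro p hp q hq hpq
      have h2 := hch p hp q hq hpq
      obtain ⟨i, i', a1, a2, a3, a4⟩ := hw p.1 p.2 (hC hp)
      obtain ⟨s, s', b1, b2, b3, b4⟩ := hw q.1 q.2 (hC hq)
      obtain ⟨a5, a6⟩ := Prod.mk.inj a4
      obtain ⟨b5, b6⟩ := Prod.mk.inj b4
      rw [a5, b5]
      refine corner_levels w a1 a2 b2 b3 ?_ ?_
      · rw [← a5, ← b5, Fin.lt_def]
        rw [Fin.lt_def] at hpq
        simp only [colIdx]; omega
      · rw [← a6, ← b6, Fin.lt_def]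
        rw [Fin.lt_def] at h2
        simp only [rowIdx]; omega
    intro p hp q hq he
    by_contra hne
    rcases lt_trichotomy p.1 q.1 with h | h | h
    · exact aux p hp q hq h he
    · exact (hR p (hC hp) q (hC hq) hne).1 h
    · exact aux q hq p hp h he.symm
  constructor
  · intro i
    rw [xSeq_prefix R hR]
    obtain ⟨C, hC, hCi, hch, hcard⟩ := exists_chain R Prod.fst (fun p q h _ => h) i
    have := forward_count (K := m - r) w (Equiv.refl _) C
      (fun p => shadowLevel w (colIdx n m r hr2 p.1)) (hlev C hC hch) i
      (fun p hp => ⟨_, rfl, by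
        have := hCi p hp
        rw [Fin.le_def] at this
        simp only [colIdx, Equiv.refl_apply]; omega⟩)
      (fun i' => ∀ p ∈ R, p.1 ≠ i')
      (by
        intro d i' hmin hd p hp hpi
        obtain ⟨s, s', a1, a2, a3, a4⟩ := hw p.1 p.2 hp
        obtain ⟨a5, a6⟩ := Prod.mk.inj a4
        have h1 : d = s' := by
          rw [← a5, hpi]; exact Fin.ext hd
        have h2 := hmin s (by rw [h1]; exact a2)
        rw [h1] at h2
        exact absurd h2 (not_le.mpr a1))
    have h' : C.card ≤ m - r +
        (Finset.univ.filter (fun i' => i' ≤ i ∧ ∀ p ∈ R, p.1 ≠ i')).card := by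
      convert this
    omega
  · intro j
    rw [ySeq_prefix R hR]
    obtain ⟨C, hC, hCi, hch, hcard⟩ := exists_chain R Prod.snd (fun p q _ h => h) j
    have := forward_count (K := n - r) w w C
      (fun p => shadowLevel w (colIdx n m r hr2 p.1)) (hlev C hC hch) j
      (fun p hp => by
        obtain ⟨s, s', a1, a2, a3, a4⟩ := hw p.1 p.2 (hC hp)
        obtain ⟨a5, a6⟩ := Prod.mk.inj a4
        refine ⟨s, by rw [a5]; exact a2, ?_⟩
        have := hCi p hp
        rw [Fin.le_def] at this
        rw [← a6]
        simp only [rowIdx]; omega)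
      (fun i' => ∀ p ∈ R, p.2 ≠ i')
      (by
        intro d i' hmin hd p hp hpi
        obtain ⟨s, s', a1, a2, a3, a4⟩ := hw p.1 p.2 hp
        obtain ⟨a5, a6⟩ := Prod.mk.inj a4
        have h1 : d = s := by
          apply w.injective
          rw [← a6, hpi]; exact Fin.ext hd
        have h2 := hmin s' (by rw [h1]; exact a2.symm)
        rw [h1] at h2
        exact absurd h2 (not_le.mpr (sl_anti w a1 a2)))
    have h' : C.card ≤ n - r +
        (Finset.univ.filter (fun i' => i' ≤ j ∧ ∀ p ∈ R, p.2 ≠ i')).card := by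
      convert this
    omega

theorem backward_data (n m r : ℕ) (hr1 : r ≤ n) (hr2 : r ≤ m)
    (R : Finset (Fin n × Fin m)) (hR : IsRookPlacement R)
    (hx : ∀ i : Fin n, (∑ i' ∈ Finset.univ.filter (· ≤ i), xSeq R i') ≤ (m : ℤ) - r)
    (hy : ∀ j : Fin m, (∑ j' ∈ Finset.univ.filter (· ≤ j), ySeq R j') ≤ (n : ℤ) - r) :
    GData (n + m - r) (fun a b => ∃ p ∈ R, a = m - r + p.1.val ∧ b = n - r + p.2.val)
      (fun i => (freeCnt R Prod.fst (m - r) i : ℤ)) (fun j => (freeCnt R Prod.snd (n - r) j : ℤ)) := by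
  classical
  have inj1 : ∀ p ∈ R, ∀ q ∈ R, p.1 = q.1 → p = q := fun p hp q hq h => by
    by_contra hne; exact (hR p hp q hq hne).1 h
  have inj2 : ∀ p ∈ R, ∀ q ∈ R, p.2 = q.2 → p = q := fun p hp q hq h => by
    by_contra hne; exact (hR p hp q hq hne).2 h
  have e1 : ∀ i, (∃ j, ∃ p ∈ R, i = m - r + p.1.val ∧ j = n - r + p.2.val) ↔
      ∃ p ∈ R, i = m - r + p.1.val := by
    intro i
    constructor
    · rintro ⟨j, p, hp, h, -⟩; exact ⟨p, hp, h⟩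
    · rintro ⟨p, hp, h⟩; exact ⟨_, p, hp, h, rfl⟩
  have e2 : ∀ j, (∃ i, ∃ p ∈ R, i = m - r + p.1.val ∧ j = n - r + p.2.val) ↔
      ∃ p ∈ R, j = n - r + p.2.val := by
    intro i
    constructor
    · rintro ⟨j, p, hp, -, h⟩; exact ⟨p, hp, h⟩
    · rintro ⟨p, hp, h⟩; exact ⟨_, p, hp, rfl, h⟩
  have pull : ∀ C : Finset (ℕ × ℕ),
      (∀ c ∈ C, ∃ p ∈ R, c.1 = m - r + p.1.val ∧ c.2 = n - r + p.2.val) →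
      (∀ p ∈ C, ∀ q ∈ C, p.1 < q.1 → p.2 < q.2) →
      ∃ C' ⊆ R, C.card ≤ C'.card ∧ (∀ p ∈ C', (m - r + p.1.val, n - r + p.2.val) ∈ C) ∧
        (∀ a ∈ C', ∀ b ∈ C', a.1 < b.1 → a.2 < b.2) := by
    intro C h1 h2
    refine ⟨R.filter (fun p => (m - r + p.1.val, n - r + p.2.val) ∈ C),
      Finset.filter_subset _ _, ?_, fun p hp => (Finset.mem_filter.mp hp).2, ?_⟩
    · refine le_trans (Finset.card_le_card ?_) (Finset.card_image_le
        (f := fun p : Fin n × Fin m => (m - r + p.1.val, n - r + p.2.val)))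
      intro c hc
      obtain ⟨p, hp, h3, h4⟩ := h1 c hc
      have h5 : (m - r + p.1.val, n - r + p.2.val) = c := Prod.ext h3.symm h4.symm
      refine Finset.mem_image.mpr ⟨p, Finset.mem_filter.mpr ⟨hp, ?_⟩, h5⟩
      rw [h5]; exact hc
    · intro a ha b hb hab
      have h3 := h2 _ (Finset.mem_filter.mp ha).2 _ (Finset.mem_filter.mp hb).2
        (by rw [Fin.lt_def] at hab; show _ + _ < _ + _; omega)
      rw [Fin.lt_def]
      simp only at h3
      omega
  constructor
  · rintro i j ⟨p, -, rfl, rfl⟩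
    have := p.1.isLt
    have := p.2.isLt
    omega
  · rintro i j j' ⟨p, hp, h1, h2⟩ ⟨q, hq, h3, h4⟩
    have := inj1 p hp q hq (Fin.ext (by omega))
    subst this; omega
  · rintro i j j' ⟨p, hp, h1, h2⟩ ⟨q, hq, h3, h4⟩
    have := inj2 p hp q hq (Fin.ext (by omega))
    subst this; omega
  · simp [freeCnt_zero]
  · simp [freeCnt_zero]
  · intro i hi h
    exact_mod_cast freeCnt_pos R Prod.fst (m - r) i ((e1 i).1 h)
  · intro i hi h
    exact_mod_cast freeCnt_neg R Prod.fst (m - r) i (fun h' => h ((e1 i).2 h'))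
  · intro i hi h
    exact_mod_cast freeCnt_pos R Prod.snd (n - r) i ((e2 i).1 h)
  · intro i hi h
    exact_mod_cast freeCnt_neg R Prod.snd (n - r) i (fun h' => h ((e2 i).2 h'))
  · have h1 := freeCnt_total R Prod.fst (m - r) inj1
    have h2 := freeCnt_total R Prod.snd (n - r) inj2
    have h3 : m - r + n = n + m - r := by omega
    have h4 : n - r + m = n + m - r := by omega
    rw [h3] at h1
    rw [h4] at h2
    show ((freeCnt R Prod.fst (m - r) (n + m - r) : ℕ) : ℤ) = freeCnt R Prod.snd (n - r) (n + m - r)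
    omega
  · intro C i hi h1 h2
    obtain ⟨C', hC', hc, hmem, hch⟩ := pull C (fun c hc => (h1 c hc).1) h2
    have := chain_free R hR Prod.fst (m - r) (fun i => by
      have := hx i
      rw [xSeq_prefix R hR] at this
      omega) C' hC' hch i (by omega) (fun p hp => (h1 _ (hmem p hp)).2)
    exact_mod_cast hc.trans this
  · intro C i hi h1 h2
    obtain ⟨C', hC', hc, hmem, hch⟩ := pull C (fun c hc => (h1 c hc).1) h2
    have := chain_free R hR Prod.snd (n - r) (fun i => by
      have := hy i
      rw [ySeq_prefix R hR] at this
      omega) C' hC' hch i (by omega) (fun p hp => (h1 _ (hmem p hp)).2)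
    exact_mod_cast hc.trans this

theorem backward_dir (n m r : ℕ) (hr1 : r ≤ n) (hr2 : r ≤ m)
    (R : Finset (Fin n × Fin m)) (hR : IsRookPlacement R)
    (hx : ∀ i : Fin n, (∑ i' ∈ Finset.univ.filter (· ≤ i), xSeq R i') ≤ (m : ℤ) - r)
    (hy : ∀ j : Fin m, (∑ j' ∈ Finset.univ.filter (· ≤ j), ySeq R j') ≤ (n : ℤ) - r) :
    ∃ R' : Finset (Fin n × Fin m), IsRookPlacement R' ∧ r ≤ R'.card ∧
      ∃ w : Equiv.Perm (Fin (n + m - r)), IsExtension hr1 hr2 R' w ∧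
        ∀ (i : Fin n) (j : Fin m),
          ((i, j) ∈ R ↔ (colIdx n m r hr2 i, rowIdx n m r hr1 j) ∈ shadowSet w) := by
  classical
  obtain ⟨w, hw⟩ := backward (backward_data n m r hr1 hr2 R hR hx hy)
  have colinj : ∀ a b : Fin n, colIdx n m r hr2 a = colIdx n m r hr2 b → a = b := by
    intro a b h
    have := congrArg Fin.val h
    simp only [colIdx] at this
    exact Fin.ext (by omega)
  have rowinj : ∀ a b : Fin m, rowIdx n m r hr1 a = rowIdx n m r hr1 b → a = b := by
    intro a b h
    have := congrArg Fin.val h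
    simp only [rowIdx] at this
    exact Fin.ext (by omega)
  let R' : Finset (Fin n × Fin m) := Finset.univ.filter
    (fun p => w (colIdx n m r hr2 p.1) = rowIdx n m r hr1 p.2)
  have hR' : ∀ p, p ∈ R' ↔ w (colIdx n m r hr2 p.1) = rowIdx n m r hr1 p.2 := by
    intro p; simp [R']
  refine ⟨R', ?_, ?_, w, ⟨?_, ?_, ?_⟩, ?_⟩
  · intro p hp q hq hne
    rw [hR'] at hp hq
    constructor
    · intro h
      rw [h, hq] at hp
      exact hne (Prod.ext h (rowinj _ _ hp.symm))
    · intro h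
      rw [h, ← hq] at hp
      exact hne (Prod.ext (colinj _ _ (w.injective hp)) h)
  · have hsub : (Finset.univ : Finset (Fin (n + m - r))) ⊆
        (Finset.univ.filter (fun c : Fin (n + m - r) => c.val < m - r) ∪
          Finset.univ.filter (fun c : Fin (n + m - r) => (w c).val < n - r)) ∪
          R'.image (fun p => colIdx n m r hr2 p.1) := by
      intro c _
      simp only [Finset.mem_union, Finset.mem_filter, Finset.mem_univ, true_and, Finset.mem_image]
      by_cases h1 : c.val < m - r
      · exact Or.inl (Or.inl h1)
      by_cases h2 : (w c).val < n - r
      · exact Or.inl (Or.inr h2)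
      right
      have hc := c.isLt
      have hwc := (w c).isLt
      have hc' : colIdx n m r hr2 ⟨c.val - (m - r), by omega⟩ = c := by
        apply Fin.ext; simp only [colIdx]; omega
      have hwc' : rowIdx n m r hr1 ⟨(w c).val - (n - r), by omega⟩ = w c := by
        apply Fin.ext; simp only [rowIdx]; omega
      refine ⟨(⟨c.val - (m - r), by omega⟩, ⟨(w c).val - (n - r), by omega⟩), ?_, hc'⟩
      rw [hR', hc', hwc']
    have h1 := Finset.card_le_card hsub
    have h2 := Finset.card_union_le
      (Finset.univ.filter (fun c : Fin (n + m - r) => c.val < m - r) ∪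
          Finset.univ.filter (fun c : Fin (n + m - r) => (w c).val < n - r))
      (R'.image (fun p => colIdx n m r hr2 p.1))
    have h3 := Finset.card_union_le
      (Finset.univ.filter (fun c : Fin (n + m - r) => c.val < m - r))
      (Finset.univ.filter (fun c : Fin (n + m - r) => (w c).val < n - r))
    have h4 := Finset.card_image_le (s := R') (f := fun p => colIdx n m r hr2 p.1)
    have h5 : (Finset.univ.filter (fun c : Fin (n + m - r) => c.val < m - r)).card ≤ m - r := by
      have := Finset.card_le_card_of_injOn
        (s := Finset.univ.filter (fun c : Fin (n + m - r) => c.val < m - r))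
        (t := Finset.range (m - r)) (fun c => c.val) (fun c hc => by simpa using hc)
        (fun a _ b _ h => Fin.ext h)
      simpa using this
    have h6 : (Finset.univ.filter (fun c : Fin (n + m - r) => (w c).val < n - r)).card ≤ n - r := by
      have := Finset.card_le_card_of_injOn
        (s := Finset.univ.filter (fun c : Fin (n + m - r) => (w c).val < n - r))
        (t := Finset.range (n - r)) (fun c => (w c).val) (fun c hc => by simpa using hc)
        (fun a _ b _ h => w.injective (Fin.ext h))
      simpa using this
    rw [Finset.card_univ, Fintype.card_fin] at h1
    omega
  · intro i j
    rw [hR']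
  · apply incr_cols
    intro a b ha hab
    obtain ⟨p, -, h1, -⟩ := (hw a b).1 hab
    omega
  · apply incr_rows
    intro a b ha hab
    obtain ⟨p, -, -, h1⟩ := (hw a b).1 hab
    omega
  · intro i j
    rw [hw]
    constructor
    · intro h
      exact ⟨(i, j), h, rfl, rfl⟩
    · rintro ⟨p, hp, h1, h2⟩
      simp only [colIdx, rowIdx] at h1 h2
      have : (i, j) = p := Prod.ext (Fin.ext (by show i.val = p.1.val; omega))
        (Fin.ext (by show j.val = p.2.val; omega))
      rw [this]; exact hp

/-- for `r ≤ min(n,m)`, a rook placement `R` on the `n × m` board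
is the extended shadow set `ES(R')` of some rook placement `R'` of size at
least `r` if and only if all prefix sums of `(x_i)` are at most `m − r` and all
prefix sums of `(y_j)` are at most `n − r`. -/
theorem extendedShadow_characterization (n m r : ℕ) (hr1 : r ≤ n) (hr2 : r ≤ m)
    (R : Finset (Fin n × Fin m)) (hR : IsRookPlacement R) :
    (∃ R' : Finset (Fin n × Fin m), IsRookPlacement R' ∧ r ≤ R'.card ∧
      ∃ w : Equiv.Perm (Fin (n + m - r)), IsExtension hr1 hr2 R' w ∧
        ∀ (i : Fin n) (j : Fin m),
          ((i, j) ∈ R ↔ (colIdx n m r hr2 i, rowIdx n m r hr1 j) ∈ shadowSet w))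
    ↔ ((∀ i : Fin n, (∑ i' ∈ Finset.univ.filter (· ≤ i), xSeq R i') ≤ (m : ℤ) - r) ∧
       (∀ j : Fin m, (∑ j' ∈ Finset.univ.filter (· ≤ j), ySeq R j') ≤ (n : ℤ) - r)) := by
  constructor
  · rintro ⟨R', -, -, w, -, hw⟩
    exact forward_dir n m r hr1 hr2 R hR w (fun i j h => (hw i j).1 h)
  · rintro ⟨hx, hy⟩
    exact backward_dir n m r hr1 hr2 R hR hx hy
end

section
/- As S_n × S_m-modules, the space of complex-valued functions on the set Z_{n,m,d} of rook placements of size d on the n×m board is isomorphic to the direct sum over partitions μ ⊢ d of (Ind_{S_d × S_{n−d}}^{S_n}(V^μ ⊗ triv)) ⊗ (Ind_{S_d × S_{m−d}}^{S_m}(V^μ ⊗ triv)); equivalently its Frobenius image is Σ_{μ⊢d} (s_μ · h_{n−d}) ⊗ (s_μ · h_{m−d}). -/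
open scoped BigOperators

/-- An integer partition, recorded by its (finitely supported, weakly
decreasing) sequence of parts `λ_1 = part 0, λ_2 = part 1, …`. -/
structure Ptn where
  part : ℕ →₀ ℕ
  antitone' : ∀ i, part (i + 1) ≤ part i

/-- The size `|λ|` of a partition: the sum of its parts. -/
def Ptn.size (l : Ptn) : ℕ := l.part.sum fun _ v => v

/-- `(row, col)` is a (bijective) filling of the Young diagram of `λ ⊢ n` by
the `n` letters: the map `k ↦ (row k, col k)` is a bijection from `Fin n` onto
the set of cells `{(i, j) : j < λ_{i+1}}` of the diagram of `λ`. -/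
def IsFilling {n : ℕ} (l : Ptn) (row col : Fin n → ℕ) : Prop :=
  Function.Injective (fun k => (row k, col k)) ∧
  ∀ i j : ℕ, (∃ k, row k = i ∧ col k = j) ↔ j < l.part i

/-- The row symmetrizer `a_T = Σ_{w preserving the rows of T} w` of a filling. -/
noncomputable def rowSymmetrizer {n : ℕ} (row : Fin n → ℕ) :
    MonoidAlgebra ℂ (Equiv.Perm (Fin n)) :=
  ∑ w ∈ Finset.univ.filter
      (fun w : Equiv.Perm (Fin n) => ∀ k, row (w k) = row k),
    MonoidAlgebra.of ℂ (Equiv.Perm (Fin n)) w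

/-- The (signed) column symmetrizer `b_T = Σ_{w preserving the columns of T}
sign(w)·w` of a filling. -/
noncomputable def colSymmetrizer {n : ℕ} (col : Fin n → ℕ) :
    MonoidAlgebra ℂ (Equiv.Perm (Fin n)) :=
  ∑ w ∈ Finset.univ.filter
      (fun w : Equiv.Perm (Fin n) => ∀ k, col (w k) = col k),
    ((Equiv.Perm.sign w : ℤ) : ℂ) • MonoidAlgebra.of ℂ (Equiv.Perm (Fin n)) w

/-- The Young symmetrizer `c_T = a_T · b_T`. -/
noncomputable def youngSymmetrizer {n : ℕ} (row col : Fin n → ℕ) :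
    MonoidAlgebra ℂ (Equiv.Perm (Fin n)) :=
  rowSymmetrizer row * colSymmetrizer col

/-- The irreducible `S_n`-module `V^λ`, realized inside the group algebra
`ℂ[S_n]` as the left ideal generated by the Young symmetrizer of a filling of
shape `λ`. -/
noncomputable def spechtModule {n : ℕ} (row col : Fin n → ℕ) :
    Submodule ℂ (MonoidAlgebra ℂ (Equiv.Perm (Fin n))) :=
  Submodule.span ℂ
    {y | ∃ x : MonoidAlgebra ℂ (Equiv.Perm (Fin n)),
      y = x * youngSymmetrizer row col}

open scoped TensorProduct DirectSum

set_option synthInstance.maxHeartbeats 1000000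
set_option maxHeartbeats 1000000

/-- `IsPieri μ k λ`: `λ` is obtained from `μ` by adding a horizontal strip of
size `k` (no such `λ` when `k < 0`); equivalently `s_λ` occurs in `s_μ · h_k`. -/
def IsPieri (m : Ptn) (k : ℤ) (l : Ptn) : Prop :=
  (l.size : ℤ) = m.size + k ∧ (∀ i, m.part i ≤ l.part i) ∧
    ∀ i, l.part (i + 1) ≤ m.part i

/-- The Specht left ideal is stable under left multiplication. -/
lemma mul_mem_specht {n : ℕ} (row col : Fin n → ℕ)
    (a : MonoidAlgebra ℂ (Equiv.Perm (Fin n)))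
    {v : MonoidAlgebra ℂ (Equiv.Perm (Fin n))} (hv : v ∈ spechtModule row col) :
    a * v ∈ spechtModule row col := by
  induction hv using Submodule.span_induction with
  | mem y hy =>
      obtain ⟨x, rfl⟩ := hy
      exact Submodule.subset_span ⟨a * x, (mul_assoc _ _ _).symm⟩
  | zero => rw [mul_zero]; exact (spechtModule row col).zero_mem
  | add y z _ _ hy hz => rw [mul_add]; exact (spechtModule row col).add_mem hy hz
  | smul c y _ hy => rw [mul_smul_comm]; exact (spechtModule row col).smul_mem c hy

/-- The action of `g ∈ S_n` on `V^λ` (left multiplication in `ℂ[S_n]`). -/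
noncomputable def spechtAct {n : ℕ} (row col : Fin n → ℕ)
    (g : Equiv.Perm (Fin n)) :
    spechtModule row col →ₗ[ℂ] spechtModule row col :=
  LinearMap.restrict
    (LinearMap.mulLeft ℂ (MonoidAlgebra.of ℂ (Equiv.Perm (Fin n)) g))
    (fun _ hv => mul_mem_specht row col _ hv)

/-- The action of `(g, h) ∈ S_n × S_m` on the set of rook placements of size
`d`, by permuting rows and columns. -/
def rookAct {n m d : ℕ} (g : Equiv.Perm (Fin n)) (h : Equiv.Perm (Fin m))
    (R : {R : Finset (Fin n × Fin m) // IsRookPlacement R ∧ R.card = d}) :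
    {R : Finset (Fin n × Fin m) // IsRookPlacement R ∧ R.card = d} :=
  ⟨R.1.image (Prod.map g h), by
    obtain ⟨hrook, hcard⟩ := R.2
    have hinj : Function.Injective (Prod.map ⇑g ⇑h : Fin n × Fin m → Fin n × Fin m) :=
      Function.Injective.prodMap g.injective h.injective
    constructor
    · intro p hp q hq hne
      simp only [Finset.mem_image] at hp hq
      obtain ⟨p', hp', rfl⟩ := hp
      obtain ⟨q', hq', rfl⟩ := hq
      have hne' : p' ≠ q' := by rintro rfl; exact hne rfl
      obtain ⟨h1, h2⟩ := hrook p' hp' q' hq' hne'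
      refine ⟨fun hc => h1 ?_, fun hc => h2 ?_⟩
      · simpa using g.injective (by simpa [Prod.map] using hc)
      · simpa using h.injective (by simpa [Prod.map] using hc)
    · rw [Finset.card_image_of_injective _ hinj]; exact hcard⟩

/-- The group algebra of the symmetric group. -/
abbrev GA (n : ℕ) := MonoidAlgebra ℂ (Equiv.Perm (Fin n))

/-- A group element in the group algebra. -/
noncomputable abbrev gof {n : ℕ} (g : Equiv.Perm (Fin n)) : GA n :=
  MonoidAlgebra.of ℂ (Equiv.Perm (Fin n)) g

lemma ptn_antitone (l : Ptn) : Antitone (fun i => l.part i) :=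
  antitone_nat_of_succ_le l.antitone'

lemma ptn_ext {l m : Ptn} (h : ∀ i, l.part i = m.part i) : l = m := by
  cases l; cases m; congr; ext i; exact h i

section comb
variable {n : ℕ}

lemma filling_lt {l : Ptn} {row col : Fin n → ℕ} (h : IsFilling l row col) (k : Fin n) :
    col k < l.part (row k) := (h.2 _ _).1 ⟨k, rfl, rfl⟩

lemma filling_inj {l : Ptn} {row col : Fin n → ℕ} (h : IsFilling l row col) {k k' : Fin n}
    (h1 : row k = row k') (h2 : col k = col k') : k = k' := h.1 (by simp [h1, h2])

lemma filling_card_row {l : Ptn} {row col : Fin n → ℕ} (h : IsFilling l row col) (i : ℕ) :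
    (Finset.univ.filter (fun k => row k = i)).card = l.part i := by
  classical
  rw [← Finset.card_range (l.part i)]
  apply Finset.card_bij (fun k _ => col k)
  · intro k hk
    simp only [Finset.mem_filter, Finset.mem_univ, true_and] at hk
    subst hk
    exact Finset.mem_range.2 (filling_lt h k)
  · intro k hk k' hk' e
    simp only [Finset.mem_filter, Finset.mem_univ, true_and] at hk hk'
    exact filling_inj h (hk.trans hk'.symm) e
  · intro j hj
    obtain ⟨k, hk, hk'⟩ := (h.2 i j).2 (Finset.mem_range.1 hj)
    exact ⟨k, by simp [hk], hk'⟩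

lemma filling_col_le {l : Ptn} {row' col' row : Fin n → ℕ} (h' : IsFilling l row' col')
    (hno : ∀ k k', row k = row k' → col' k = col' k' → k = k') (r c : ℕ) :
    (Finset.univ.filter (fun k => row k < r ∧ col' k = c)).card ≤
      (Finset.univ.filter (fun k => row' k < r ∧ col' k = c)).card := by
  classical
  by_cases hall : ∀ k, col' k = c → row' k < r
  · apply Finset.card_le_card
    intro k
    simp only [Finset.mem_filter, Finset.mem_univ, true_and]
    exact fun hk => ⟨hall k hk.2, hk.2⟩
  · push Not at hall
    obtain ⟨k0, hk0, hk0'⟩ := hall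
    calc _ ≤ (Finset.range r).card := by
          apply Finset.card_le_card_of_injOn row
          · intro k hk
            simp only [Finset.coe_filter, Finset.mem_univ, true_and, Set.mem_ofPred_eq] at hk
            simpa using hk.1
          · intro k hk k' hk' e
            simp only [Finset.coe_filter, Finset.mem_univ, true_and, Set.mem_ofPred_eq] at hk hk'
            exact hno k k' e (hk.2.trans hk'.2.symm)
      _ ≤ _ := by
          apply Finset.card_le_card_of_surjOn row'
          intro i hi
          have hi' : i < r := by simpa using hi
          have : c < l.part i := by
            have h1 := filling_lt h' k0
            have h2 : l.part (row' k0) ≤ l.part i := ptn_antitone l (by omega)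
            omega
          obtain ⟨k, hk, hk'⟩ := (h'.2 i c).2 this
          exact ⟨k, by simp [hk, hk', hi'], hk⟩

lemma card_split (P : Fin n → Prop) [DecidablePred P] (f : Fin n → ℕ) :
    (Finset.univ.filter (fun k => P k)).card =
      ∑ c ∈ Finset.univ.image f, (Finset.univ.filter (fun k => P k ∧ f k = c)).card := by
  classical
  rw [Finset.card_eq_sum_card_fiberwise (f := f) (t := Finset.univ.image f)]
  · simp [Finset.filter_filter]
  · intro k _
    simp

lemma filling_dom {l : Ptn} {row' col' row : Fin n → ℕ} (h' : IsFilling l row' col')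
    (hno : ∀ k k', row k = row k' → col' k = col' k' → k = k') (r : ℕ) :
    (Finset.univ.filter (fun k => row k < r)).card ≤
      (Finset.univ.filter (fun k => row' k < r)).card := by
  rw [card_split _ col', card_split (fun k => row' k < r) col']
  exact Finset.sum_le_sum fun c _ => filling_col_le h' hno r c

lemma filling_mem_of_eq {l : Ptn} {row' col' row : Fin n → ℕ} (h' : IsFilling l row' col')
    (hno : ∀ k k', row k = row k' → col' k = col' k' → k = k')
    (heq : ∀ r, (Finset.univ.filter (fun k => row k < r)).card =
      (Finset.univ.filter (fun k => row' k < r)).card) (k : Fin n) :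
    col' k < l.part (row k) := by
  by_contra hcon
  push Not at hcon
  have h1 := heq (row k)
  rw [card_split _ col', card_split (fun k' => row' k' < row k) col'] at h1
  rw [Finset.sum_eq_sum_iff_of_le (fun c _ => filling_col_le h' hno (row k) c)] at h1
  have h2 := h1 (col' k) (by simp)
  have h3 : (Finset.univ.filter (fun k' => row' k' < row k ∧ col' k' = col' k)) =
      (Finset.univ.filter (fun k' => col' k' = col' k)) := by
    ext k'
    simp only [Finset.mem_filter, Finset.mem_univ, true_and, and_iff_right_iff_imp]
    intro e
    by_contra hge
    have h4 := filling_lt h' k'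
    have h5 : l.part (row' k') ≤ l.part (row k) := ptn_antitone l (by omega)
    omega
  rw [h3] at h2
  have h6 := Finset.eq_of_subset_of_card_le (s := Finset.univ.filter (fun k' => row k' < row k ∧ col' k' = col' k))
    (t := Finset.univ.filter (fun k' => col' k' = col' k))
    (by intro x; simp) h2.ge
  have h7 : k ∈ Finset.univ.filter (fun k' => col' k' = col' k) := by simp
  rw [← h6] at h7
  simp at h7

lemma filling_shape_eq {l l' : Ptn} {row col row' col' : Fin n → ℕ} (h : IsFilling l row col)
    (h' : IsFilling l' row' col')
    (heq : ∀ r, (Finset.univ.filter (fun k => row k < r)).card =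
      (Finset.univ.filter (fun k => row' k < r)).card) : l = l' := by
  apply ptn_ext
  intro i
  rw [← filling_card_row h, ← filling_card_row h']
  have key : ∀ f : Fin n → ℕ, (Finset.univ.filter (fun k => f k < i + 1)).card =
      (Finset.univ.filter (fun k => f k < i)).card + (Finset.univ.filter (fun k => f k = i)).card := by
    intro f
    rw [← Finset.card_union_of_disjoint]
    · congr 1
      ext k
      simp only [Finset.mem_filter, Finset.mem_univ, true_and, Finset.mem_union]
      omega
    · rw [Finset.disjoint_filter]
      intro k _ h1 h2
      omega
  have := heq (i + 1)
  have h2 := heq i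
  rw [key, key] at this
  omega

lemma filling_comp {l : Ptn} {row col : Fin n → ℕ} (h : IsFilling l row col)
    (g : Equiv.Perm (Fin n)) : IsFilling l (row ∘ g) (col ∘ g) := by
  refine ⟨fun k k' e => g.injective (h.1 e), fun i j => ?_⟩
  rw [← h.2 i j]
  constructor
  · rintro ⟨k, hk⟩
    exact ⟨g k, hk⟩
  · rintro ⟨k, hk⟩
    exact ⟨g.symm k, by simpa using hk⟩

/-- If no two letters share a row of `T` and a column of `gT`, then `g` factors. -/
lemma filling_factor {l : Ptn} {row col : Fin n → ℕ} (h : IsFilling l row col)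
    (g : Equiv.Perm (Fin n))
    (hno : ∀ k k', row k = row k' → col (g⁻¹ k) = col (g⁻¹ k') → k = k') :
    ∃ p q : Equiv.Perm (Fin n), (∀ k, row (p k) = row k) ∧ (∀ k, col (q k) = col k) ∧
      g = p * q := by
  classical
  have h' := filling_comp h g⁻¹
  have heq : ∀ r, (Finset.univ.filter (fun k => row k < r)).card =
      (Finset.univ.filter (fun k => row (g⁻¹ k) < r)).card := by
    intro r
    apply Finset.card_bij (fun k _ => g k)
    · intro k hk; simpa using hk
    · intro k _ k' _ e; exact g.injective e
    · intro k hk; exact ⟨g⁻¹ k, by simpa using hk, by simp⟩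
  have hmem := filling_mem_of_eq h' hno heq
  have hex : ∀ k, ∃ k', row k' = row k ∧ col k' = col (g⁻¹ k) := fun k => (h.2 _ _).2 (hmem k)
  choose u hu1 hu2 using hex
  have hinj : Function.Injective u := by
    intro k k' e
    apply hno k k'
    · rw [← hu1 k, e, hu1]
    · rw [← hu2 k, e, hu2]
  let U : Equiv.Perm (Fin n) := Equiv.ofBijective u (Finite.injective_iff_bijective.1 hinj)
  have hU : ∀ k, U k = u k := fun k => rfl
  refine ⟨U⁻¹, U * g, ?_, ?_, by group⟩
  · intro k
    rw [← hu1 (U⁻¹ k), ← hU]; simp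
  · intro k
    simp [hU, hu2]
end comb

section alg
variable {n : ℕ}

lemma ga_induction {P : GA n → Prop} (x : GA n) (hof : ∀ g, P (gof g))
    (hadd : ∀ x y, P x → P y → P (x + y)) (hsmul : ∀ (r : ℂ) x, P x → P (r • x)) : P x :=
  MonoidAlgebra.induction_on x hof (fun x y => hadd x y) (fun r x => hsmul r x)

lemma rowS_mul_of (row : Fin n → ℕ) {p : Equiv.Perm (Fin n)} (hp : ∀ k, row (p k) = row k) :
    rowSymmetrizer row * gof p = rowSymmetrizer row := by
  classical
  unfold rowSymmetrizer gof
  rw [Finset.sum_mul]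
  simp_rw [← map_mul]
  apply Finset.sum_bij (fun w _ => w * p)
  · intro w hw
    simp only [Finset.mem_filter, Finset.mem_univ, true_and] at hw ⊢
    intro k
    simp [hw, hp]
  · intro w _ w' _ e; exact mul_right_cancel e
  · intro w hw
    simp only [Finset.mem_filter, Finset.mem_univ, true_and] at hw
    refine ⟨w * p⁻¹, ?_, by simp⟩
    simp only [Finset.mem_filter, Finset.mem_univ, true_and]
    intro k
    have := hp (p⁻¹ k)
    simp [hw] at this ⊢
    exact this.symm
  · intro w _; rfl

lemma of_mul_rowS (row : Fin n → ℕ) {p : Equiv.Perm (Fin n)} (hp : ∀ k, row (p k) = row k) :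
    gof p * rowSymmetrizer row = rowSymmetrizer row := by
  classical
  unfold rowSymmetrizer gof
  rw [Finset.mul_sum]
  simp_rw [← map_mul]
  apply Finset.sum_bij (fun w _ => p * w)
  · intro w hw
    simp only [Finset.mem_filter, Finset.mem_univ, true_and] at hw ⊢
    intro k
    simp [hw, hp]
  · intro w _ w' _ e; exact mul_left_cancel e
  · intro w hw
    simp only [Finset.mem_filter, Finset.mem_univ, true_and] at hw
    refine ⟨p⁻¹ * w, ?_, by simp⟩
    simp only [Finset.mem_filter, Finset.mem_univ, true_and]
    intro k
    have := hp (p⁻¹ (w k))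
    simp [hw] at this ⊢
    exact this.symm
  · intro w _; rfl

/-- The sign as a complex number. -/
noncomputable def csgn (q : Equiv.Perm (Fin n)) : ℂ := ((Equiv.Perm.sign q : ℤ) : ℂ)

lemma csgn_mul (p q : Equiv.Perm (Fin n)) : csgn (p * q) = csgn p * csgn q := by
  simp [csgn]

lemma csgn_sq (p : Equiv.Perm (Fin n)) : csgn p * csgn p = 1 := by
  rw [← csgn_mul]
  simp [csgn]

lemma csgn_inv (p : Equiv.Perm (Fin n)) : csgn p⁻¹ = csgn p := by
  simp [csgn]

lemma colS_mul_of (col : Fin n → ℕ) {p : Equiv.Perm (Fin n)} (hp : ∀ k, col (p k) = col k) :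
    colSymmetrizer col * gof p = csgn p • colSymmetrizer col := by
  classical
  unfold colSymmetrizer gof
  rw [Finset.sum_mul, Finset.smul_sum]
  simp_rw [smul_mul_assoc, ← map_mul]
  apply Finset.sum_bij (fun w _ => w * p)
  · intro w hw
    simp only [Finset.mem_filter, Finset.mem_univ, true_and] at hw ⊢
    intro k
    simp [hw, hp]
  · intro w _ w' _ e; exact mul_right_cancel e
  · intro w hw
    simp only [Finset.mem_filter, Finset.mem_univ, true_and] at hw
    refine ⟨w * p⁻¹, ?_, by simp⟩
    simp only [Finset.mem_filter, Finset.mem_univ, true_and]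
    intro k
    have := hp (p⁻¹ k)
    simp [hw] at this ⊢
    exact this.symm
  · intro w _
    change csgn w • _ = csgn p • csgn (w * p) • _
    rw [smul_smul, csgn_mul, mul_comm (csgn w), ← mul_assoc, csgn_sq, one_mul]

lemma of_mul_colS (col : Fin n → ℕ) {p : Equiv.Perm (Fin n)} (hp : ∀ k, col (p k) = col k) :
    gof p * colSymmetrizer col = csgn p • colSymmetrizer col := by
  classical
  unfold colSymmetrizer gof
  rw [Finset.mul_sum, Finset.smul_sum]
  simp_rw [mul_smul_comm, ← map_mul]
  apply Finset.sum_bij (fun w _ => p * w)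
  · intro w hw
    simp only [Finset.mem_filter, Finset.mem_univ, true_and] at hw ⊢
    intro k
    simp [hw, hp]
  · intro w _ w' _ e; exact mul_left_cancel e
  · intro w hw
    simp only [Finset.mem_filter, Finset.mem_univ, true_and] at hw
    refine ⟨p⁻¹ * w, ?_, by simp⟩
    simp only [Finset.mem_filter, Finset.mem_univ, true_and]
    intro k
    have := hp (p⁻¹ (w k))
    simp [hw] at this ⊢
    exact this.symm
  · intro w _
    change csgn w • _ = csgn p • csgn (p * w) • _
    rw [smul_smul, csgn_mul, ← mul_assoc, csgn_sq, one_mul]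

lemma csgn_swap {k k' : Fin n} (h : k ≠ k') : csgn (Equiv.swap k k') = -1 := by
  simp [csgn, Equiv.Perm.sign_swap h]

lemma swap_pres {f : Fin n → ℕ} {k k' : Fin n} (h : f k = f k') (j : Fin n) :
    f (Equiv.swap k k' j) = f j := by
  rcases eq_or_ne j k with rfl | h1
  · simp [h]
  rcases eq_or_ne j k' with rfl | h2
  · simp [h]
  rw [Equiv.swap_apply_of_ne_of_ne h1 h2]

lemma swap_conj (g : Equiv.Perm (Fin n)) (k k' : Fin n) :
    Equiv.swap k k' * g = g * Equiv.swap (g⁻¹ k) (g⁻¹ k') := by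
  rw [Equiv.mul_swap_eq_swap_mul]; simp

lemma self_eq_neg_ga {x : GA n} (h : x = - x) : x = 0 := by
  have h2 : (2 : ℂ) • x = 0 := by
    rw [two_smul]; nth_rewrite 2 [h]; simp
  exact (smul_eq_zero.1 h2).resolve_left (by norm_num)

lemma row_g_col_zero (row col : Fin n → ℕ) (g : Equiv.Perm (Fin n)) {k k' : Fin n}
    (hne : k ≠ k') (hr : row k = row k') (hc : col (g⁻¹ k) = col (g⁻¹ k')) :
    rowSymmetrizer row * gof g * colSymmetrizer col = 0 := by
  apply self_eq_neg_ga
  have hne' : g⁻¹ k ≠ g⁻¹ k' := fun e => hne (g⁻¹.injective e)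
  nth_rewrite 1 [← rowS_mul_of row (swap_pres hr)]
  rw [mul_assoc (rowSymmetrizer row), gof, gof, ← map_mul, swap_conj, map_mul,
    ← mul_assoc, mul_assoc, of_mul_colS col (swap_pres hc), csgn_swap hne']
  simp

lemma col_g_row_zero (row col : Fin n → ℕ) (g : Equiv.Perm (Fin n)) {k k' : Fin n}
    (hne : k ≠ k') (hc : col k = col k') (hr : row (g⁻¹ k) = row (g⁻¹ k')) :
    colSymmetrizer col * gof g * rowSymmetrizer row = 0 := by
  apply self_eq_neg_ga
  have h1 : colSymmetrizer col = - (colSymmetrizer col * gof (Equiv.swap k k')) := by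
    rw [colS_mul_of col (swap_pres hc), csgn_swap hne]; simp
  nth_rewrite 1 [h1]
  rw [neg_mul, neg_mul, mul_assoc (colSymmetrizer col), gof, gof, ← map_mul, swap_conj, map_mul,
    ← mul_assoc, mul_assoc, of_mul_rowS row (swap_pres hr)]

lemma row_x_col_dom {l' : Ptn} {row row' col' : Fin n → ℕ}
    (h' : IsFilling l' row' col') (hx : ∃ x, rowSymmetrizer row * x * colSymmetrizer col' ≠ 0)
    (r : ℕ) : (Finset.univ.filter (fun k => row k < r)).card ≤
      (Finset.univ.filter (fun k => row' k < r)).card := by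
  have : ∃ g, rowSymmetrizer row * gof g * colSymmetrizer col' ≠ 0 := by
    by_contra hcon
    push Not at hcon
    obtain ⟨x, hx0⟩ := hx
    apply hx0
    clear hx0
    induction x using ga_induction with
    | hof g => exact hcon g
    | hadd x y hx hy => rw [mul_add, add_mul, hx, hy, add_zero]
    | hsmul r x hx => rw [mul_smul_comm, smul_mul_assoc, hx, smul_zero]
  obtain ⟨g, hg⟩ := this
  have hno : ∀ k k', row k = row k' → col' (g⁻¹ k) = col' (g⁻¹ k') → k = k' := by
    intro k k' h1 h2
    by_contra hne
    exact hg (row_g_col_zero row col' g hne h1 h2)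
  have := filling_dom (filling_comp h' g⁻¹) hno r
  refine this.trans (le_of_eq ?_)
  apply Finset.card_bij (fun k _ => g⁻¹ k)
  · intro k hk; simpa using hk
  · intro k _ k' _ e; exact g⁻¹.injective e
  · intro k hk; exact ⟨g k, by simpa using hk, by simp⟩

lemma col_x_row_dom {l : Ptn} {row col row' : Fin n → ℕ}
    (h : IsFilling l row col) (hx : ∃ x, colSymmetrizer col * x * rowSymmetrizer row' ≠ 0)
    (r : ℕ) : (Finset.univ.filter (fun k => row' k < r)).card ≤
      (Finset.univ.filter (fun k => row k < r)).card := by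
  have : ∃ g, colSymmetrizer col * gof g * rowSymmetrizer row' ≠ 0 := by
    by_contra hcon
    push Not at hcon
    obtain ⟨x, hx0⟩ := hx
    apply hx0
    clear hx0
    induction x using ga_induction with
    | hof g => exact hcon g
    | hadd x y hx hy => rw [mul_add, add_mul, hx, hy, add_zero]
    | hsmul r x hx => rw [mul_smul_comm, smul_mul_assoc, hx, smul_zero]
  obtain ⟨g, hg⟩ := this
  have hno : ∀ k k', row' k = row' k' → (col ∘ g) k = (col ∘ g) k' → k = k' := by
    intro k k' h1 h2
    by_contra hne
    exact hg (col_g_row_zero row' col g (k := g k) (k' := g k') (fun e => hne (g.injective e)) h2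
      (by simpa using h1))
  have := filling_dom (filling_comp h g) hno r
  refine this.trans (le_of_eq ?_)
  apply Finset.card_bij (fun k _ => g k)
  · intro k hk; simpa using hk
  · intro k _ k' _ e; exact g.injective e
  · intro k hk; exact ⟨g⁻¹ k, by simpa using hk, by simp⟩

/-- Young symmetrizers of different shapes annihilate each other. -/
lemma young_mul_young_zero {l l' : Ptn} {row col row' col' : Fin n → ℕ} (h : IsFilling l row col)
    (h' : IsFilling l' row' col') (hne : l ≠ l') (x : GA n) :
    youngSymmetrizer row col * x * youngSymmetrizer row' col' = 0 := by
  by_contra hcon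
  apply hne
  unfold youngSymmetrizer at hcon
  apply filling_shape_eq h h'
  intro r
  apply le_antisymm
  · apply row_x_col_dom h'
    refine ⟨colSymmetrizer col * x * rowSymmetrizer row', ?_⟩
    simpa only [mul_assoc] using hcon
  · apply col_x_row_dom h
    refine ⟨x, fun e => hcon ?_⟩
    calc _ = rowSymmetrizer row * (colSymmetrizer col * x * rowSymmetrizer row') *
          colSymmetrizer col' := by simp only [mul_assoc]
      _ = 0 := by rw [e]; simp

lemma row_x_col {l : Ptn} {row col : Fin n → ℕ} (h : IsFilling l row col) (x : GA n) :
    ∃ t : ℂ, rowSymmetrizer row * x * colSymmetrizer col =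
      t • (rowSymmetrizer row * colSymmetrizer col) := by
  induction x using ga_induction with
  | hof g =>
    by_cases hno : ∀ k k', row k = row k' → col (g⁻¹ k) = col (g⁻¹ k') → k = k'
    · obtain ⟨p, q, hp, hq, rfl⟩ := filling_factor h g hno
      refine ⟨csgn q, ?_⟩
      rw [gof, map_mul, ← mul_assoc, rowS_mul_of row hp, mul_assoc, of_mul_colS col hq,
        mul_smul_comm]
    · push Not at hno
      obtain ⟨k, k', h1, h2, h3⟩ := hno
      exact ⟨0, by rw [row_g_col_zero row col g h3 h1 h2, zero_smul]⟩
  | hadd x y hx hy =>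
    obtain ⟨s, hs⟩ := hx
    obtain ⟨t, ht⟩ := hy
    exact ⟨s + t, by rw [mul_add, add_mul, hs, ht, add_smul]⟩
  | hsmul r x hx =>
    obtain ⟨s, hs⟩ := hx
    exact ⟨r * s, by rw [mul_smul_comm, smul_mul_assoc, hs, smul_smul]⟩

lemma col_x_row {l : Ptn} {row col : Fin n → ℕ} (h : IsFilling l row col) (x : GA n) :
    ∃ t : ℂ, colSymmetrizer col * x * rowSymmetrizer row =
      t • (colSymmetrizer col * rowSymmetrizer row) := by
  induction x using ga_induction with
  | hof g =>
    by_cases hno : ∀ k k', row k = row k' → col (g⁻¹⁻¹ k) = col (g⁻¹⁻¹ k') → k = k'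
    · obtain ⟨p, q, hp, hq, he⟩ := filling_factor h g⁻¹ hno
      have hg : g = q⁻¹ * p⁻¹ := by rw [← inv_inv g, he]; group
      have hp' : ∀ k, row (p⁻¹ k) = row k := fun k => by
        have := hp (p⁻¹ k); simp at this; exact this.symm
      have hq' : ∀ k, col (q⁻¹ k) = col k := fun k => by
        have := hq (q⁻¹ k); simp at this; exact this.symm
      refine ⟨csgn q⁻¹, ?_⟩
      rw [hg, gof, map_mul, ← mul_assoc, colS_mul_of col hq', mul_assoc, of_mul_rowS row hp',
        smul_mul_assoc]
    · push Not at hno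
      obtain ⟨k, k', h1, h2, h3⟩ := hno
      rw [inv_inv] at h2
      exact ⟨0, by rw [col_g_row_zero row col g (k := g k) (k' := g k')
        (fun e => h3 (g.injective e)) h2 (by simpa using h1), zero_smul]⟩
  | hadd x y hx hy =>
    obtain ⟨s, hs⟩ := hx
    obtain ⟨t, ht⟩ := hy
    exact ⟨s + t, by rw [mul_add, add_mul, hs, ht, add_smul]⟩
  | hsmul r x hx =>
    obtain ⟨s, hs⟩ := hx
    exact ⟨r * s, by rw [mul_smul_comm, smul_mul_assoc, hs, smul_smul]⟩

lemma young_x_young {l : Ptn} {row col : Fin n → ℕ} (h : IsFilling l row col) (x : GA n) :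
    ∃ t : ℂ, youngSymmetrizer row col * x * youngSymmetrizer row col =
      t • youngSymmetrizer row col := by
  obtain ⟨t, ht⟩ := row_x_col h (colSymmetrizer col * x * rowSymmetrizer row)
  refine ⟨t, ?_⟩
  unfold youngSymmetrizer
  rw [← ht]
  simp only [mul_assoc]

lemma young_coeff_one {l : Ptn} {row col : Fin n → ℕ} (h : IsFilling l row col) :
    (youngSymmetrizer row col).coeff 1 = 1 := by
  classical
  unfold youngSymmetrizer rowSymmetrizer colSymmetrizer
  rw [Finset.sum_mul_sum, MonoidAlgebra.coeff_sum, Finsupp.finsetSum_apply]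
  rw [Finset.sum_eq_single 1]
  · rw [MonoidAlgebra.coeff_sum, Finsupp.finsetSum_apply, Finset.sum_eq_single 1]
    · simp [MonoidAlgebra.of_apply]
    · intro q _ hq
      simp [MonoidAlgebra.of_apply, MonoidAlgebra.smul_single, hq]
    · intro hq; exact absurd (by simp) hq
  · intro p hp hp1
    rw [MonoidAlgebra.coeff_sum, Finsupp.finsetSum_apply]
    apply Finset.sum_eq_zero
    intro q hq
    simp only [Finset.mem_filter, Finset.mem_univ, true_and] at hp hq
    have hpq : p * q ≠ 1 := by
      intro e
      apply hp1
      have hq' : q = p⁻¹ := (inv_eq_of_mul_eq_one_right e).symm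
      ext k
      have : p k = k := by
        apply filling_inj h (hp k)
        have := hq (p k)
        rw [hq'] at this
        simpa using this.symm
      simp [this]
    simp [MonoidAlgebra.of_apply, MonoidAlgebra.smul_single, MonoidAlgebra.single_mul_single, hpq]
  · intro hq; exact absurd (by simp) hq

lemma young_ne_zero {l : Ptn} {row col : Fin n → ℕ} (h : IsFilling l row col) :
    youngSymmetrizer row col ≠ 0 := by
  intro e
  have := young_coeff_one h
  rw [e] at this
  simp at this

lemma ga_semiprime (v : GA n) (hv : ∀ x, v * x * v = 0) : v = 0 := by
  obtain ⟨e, he, hI⟩ := IsSemisimpleRing.ideal_eq_span_idempotent (Ideal.span {v})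
  have h1 : e ∈ Ideal.span {v} := by rw [hI]; exact Ideal.mem_span_singleton_self e
  obtain ⟨a, ha⟩ := Ideal.mem_span_singleton'.1 h1
  have h2 : e = 0 := by
    rw [← he.eq, ← ha]
    calc a * v * (a * v) = a * (v * a * v) := by simp only [mul_assoc]
      _ = 0 := by rw [hv, mul_zero]
  have h3 : v ∈ Ideal.span {e} := by rw [← hI]; exact Ideal.mem_span_singleton_self v
  rw [h2] at h3
  simpa using h3

lemma young_sq_ne_zero {l : Ptn} {row col : Fin n → ℕ} (h : IsFilling l row col) :
    youngSymmetrizer row col * youngSymmetrizer row col ≠ 0 := by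
  intro e
  apply young_ne_zero h
  apply ga_semiprime
  intro x
  obtain ⟨t, ht⟩ := col_x_row h x
  unfold youngSymmetrizer at e ⊢
  calc _ = rowSymmetrizer row * (colSymmetrizer col * x * rowSymmetrizer row) *
        colSymmetrizer col := by simp only [mul_assoc]
    _ = t • (rowSymmetrizer row * colSymmetrizer col * (rowSymmetrizer row * colSymmetrizer col)) := by
        rw [ht]; simp only [mul_assoc, mul_smul_comm, smul_mul_assoc]
    _ = 0 := by rw [e, smul_zero]

/-- The coordinate functional: on `c A c = ℂ c` it reads the scalar. -/
noncomputable def tau : GA n →ₗ[ℂ] ℂ where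
  toFun x := x.coeff 1
  map_add' x y := by simp
  map_smul' r x := by simp

lemma young_x_young_tau {l : Ptn} {row col : Fin n → ℕ} (h : IsFilling l row col) (x : GA n) :
    youngSymmetrizer row col * x * youngSymmetrizer row col =
      tau (youngSymmetrizer row col * x * youngSymmetrizer row col) • youngSymmetrizer row col := by
  obtain ⟨t, ht⟩ := young_x_young h x
  rw [ht, map_smul]
  have : tau (youngSymmetrizer row col) = 1 := young_coeff_one h
  rw [this, smul_eq_mul, mul_one]

lemma mem_specht {row col : Fin n → ℕ} {v : GA n} :
    v ∈ spechtModule row col ↔ ∃ x, v = x * youngSymmetrizer row col := by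
  constructor
  · intro hv
    induction hv using Submodule.span_induction with
    | mem y hy => exact hy
    | zero => exact ⟨0, by simp⟩
    | add y z _ _ hy hz =>
      obtain ⟨a, rfl⟩ := hy
      obtain ⟨b, rfl⟩ := hz
      exact ⟨a + b, by rw [add_mul]⟩
    | smul c y _ hy =>
      obtain ⟨a, rfl⟩ := hy
      exact ⟨c • a, by rw [smul_mul_assoc]⟩
  · intro h; exact Submodule.subset_span h

lemma young_mul_specht {l : Ptn} {row col : Fin n → ℕ} (h : IsFilling l row col) {v : GA n}
    (hv : v ∈ spechtModule row col) (x : GA n) :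
    youngSymmetrizer row col * x * v =
      tau (youngSymmetrizer row col * x * v) • youngSymmetrizer row col := by
  obtain ⟨y, rfl⟩ := mem_specht.1 hv
  have := young_x_young_tau h (x * y)
  simpa only [mul_assoc] using this

lemma young_mul_specht_zero {l l' : Ptn} {row col row' col' : Fin n → ℕ} (h : IsFilling l row col)
    (h' : IsFilling l' row' col') (hne : l ≠ l') {v : GA n}
    (hv : v ∈ spechtModule row' col') (x : GA n) :
    youngSymmetrizer row col * x * v = 0 := by
  obtain ⟨y, rfl⟩ := mem_specht.1 hv
  have := young_mul_young_zero h h' hne (x * y)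
  simpa only [mul_assoc] using this

lemma specht_sep {row col : Fin n → ℕ} {v : GA n}
    (hv : v ∈ spechtModule row col)
    (h0 : ∀ g, youngSymmetrizer row col * gof g * v = 0) : v = 0 := by
  have h1 : ∀ x, youngSymmetrizer row col * x * v = 0 := by
    intro x
    induction x using ga_induction with
    | hof g => exact h0 g
    | hadd x y hx hy => rw [mul_add, add_mul, hx, hy, add_zero]
    | hsmul r x hx => rw [mul_smul_comm, smul_mul_assoc, hx, smul_zero]
  obtain ⟨y, rfl⟩ := mem_specht.1 hv
  apply ga_semiprime
  intro x
  have := h1 x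
  calc _ = y * (youngSymmetrizer row col * x * (y * youngSymmetrizer row col)) := by
        simp only [mul_assoc]
    _ = 0 := by rw [this, mul_zero]

instance : FiniteDimensional ℂ (GA n) :=
  FiniteDimensional.of_injective
    ({ toFun := fun x => (x.coeff : Equiv.Perm (Fin n) → ℂ)
       map_add' := fun x y => by ext; simp
       map_smul' := fun r x => by ext; simp } : GA n →ₗ[ℂ] (Equiv.Perm (Fin n) → ℂ))
    (by
      intro x y e
      ext g
      exact congrFun e g)

/-- The right ideal has dimension at most that of the left ideal. -/
lemma finrank_right_le {row col : Fin n → ℕ} {l : Ptn} (h : IsFilling l row col) :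
    Module.finrank ℂ (LinearMap.range (LinearMap.mulLeft ℂ (youngSymmetrizer row col))) ≤
      Module.finrank ℂ (spechtModule row col) := by
  let c := youngSymmetrizer row col
  let B : LinearMap.range (LinearMap.mulLeft ℂ c) →ₗ[ℂ] Module.Dual ℂ (spechtModule row col) :=
    { toFun := fun y => (tau.comp (LinearMap.mulLeft ℂ y.1)).comp (spechtModule row col).subtype
      map_add' := fun x y => by ext; simp [add_mul]
      map_smul' := fun r x => by ext; simp }
  have hB : Function.Injective B := by
    rw [injective_iff_map_eq_zero]
    rintro ⟨y, hy⟩ h0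
    obtain ⟨x, rfl⟩ := hy
    have h1 : ∀ z, tau (c * x * (z * c)) = 0 := fun z => by
      have := LinearMap.congr_fun h0 ⟨z * c, mem_specht.2 ⟨z, rfl⟩⟩
      simpa [B, mul_assoc] using this
    have h2 : ∀ z, c * x * z * c = 0 := fun z => by
      have h3 := young_x_young_tau h (x * z)
      have h4 := h1 z
      simp only [← mul_assoc] at h3 h4
      change c * x * z * c = tau (c * x * z * c) • c at h3
      rw [h3, h4, zero_smul]
    have : c * x = 0 := by
      apply ga_semiprime
      intro z
      rw [← mul_assoc, h2, zero_mul]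
    ext1
    simpa using this
  have := LinearMap.finrank_le_finrank_of_injective hB
  rwa [Subspace.dual_finrank_eq] at this
end alg

/-- Functions on the set of words `Fin d → Fin n`. -/
abbrev IS (d n : ℕ) := (Fin d → Fin n) → ℂ

section words
variable {d n : ℕ}

/-- The left action of the group algebra of `S_n` on words. -/
noncomputable def Lft : GA n →ₐ[ℂ] Module.End ℂ (IS d n) :=
  MonoidAlgebra.lift ℂ (Module.End ℂ (IS d n)) (Equiv.Perm (Fin n))
    { toFun := fun g => LinearMap.funLeft ℂ ℂ (fun i : Fin d → Fin n => ⇑g⁻¹ ∘ i)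
      map_one' := by ext; simp [LinearMap.funLeft]
      map_mul' := fun g h => by
        refine LinearMap.ext fun F => funext fun i => ?_
        simp [LinearMap.funLeft, Function.comp_assoc] }

/-- The position action of the group algebra of `S_d` on words. -/
noncomputable def Rgt : GA d →ₐ[ℂ] Module.End ℂ (IS d n) :=
  MonoidAlgebra.lift ℂ (Module.End ℂ (IS d n)) (Equiv.Perm (Fin d))
    { toFun := fun s => LinearMap.funLeft ℂ ℂ (fun i : Fin d → Fin n => i ∘ ⇑s)
      map_one' := by ext; simp [LinearMap.funLeft]
      map_mul' := fun g h => by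
        refine LinearMap.ext fun F => funext fun i => ?_
        simp [LinearMap.funLeft, Function.comp_assoc] }

lemma Lft_of (g : Equiv.Perm (Fin n)) (F : IS d n) (i : Fin d → Fin n) :
    Lft (gof g) F i = F (⇑g⁻¹ ∘ i) := by
  unfold Lft; rw [gof, MonoidAlgebra.lift_of]; rfl

lemma Rgt_of (s : Equiv.Perm (Fin d)) (F : IS d n) (i : Fin d → Fin n) :
    Rgt (gof s) F i = F (i ∘ s) := by
  unfold Rgt; rw [gof, MonoidAlgebra.lift_of]; rfl

lemma Lft_Rgt_comm (x : GA n) (y : GA d) (F : IS d n) :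
    Lft x (Rgt y F) = Rgt y (Lft x F) := by
  induction x using ga_induction with
  | hof g =>
    induction y using ga_induction with
    | hof s => ext i; rw [Lft_of, Rgt_of, Rgt_of, Lft_of]; rfl
    | hadd x y hx hy => simp only [map_add, LinearMap.add_apply, hx, hy]
    | hsmul r x hx => simp only [map_smul, LinearMap.smul_apply, hx]
  | hadd x y hx hy => simp only [map_add, LinearMap.add_apply, hx, hy]
  | hsmul r x hx => simp only [map_smul, LinearMap.smul_apply, hx]

/-- Supported on injective words. -/
def InjSupp (F : IS d n) : Prop := ∀ i, F i ≠ 0 → Function.Injective i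

lemma injSupp_add {F G : IS d n} (hF : InjSupp F) (hG : InjSupp G) : InjSupp (F + G) := by
  intro i hi
  by_contra h
  apply hi
  have h1 : F i = 0 := by by_contra h'; exact h (hF i h')
  have h2 : G i = 0 := by by_contra h'; exact h (hG i h')
  simp [h1, h2]

lemma injSupp_smul {F : IS d n} (r : ℂ) (hF : InjSupp F) : InjSupp (r • F) := by
  intro i hi
  apply hF
  intro h; apply hi; simp [h]

lemma injSupp_Lft {F : IS d n} (hF : InjSupp F) (x : GA n) : InjSupp (Lft x F) := by
  induction x using ga_induction with
  | hof g =>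
    intro i hi
    rw [Lft_of] at hi
    exact Function.Injective.of_comp (hF _ hi)
  | hadd x y hx hy => rw [map_add, LinearMap.add_apply]; exact injSupp_add hx hy
  | hsmul r x hx => rw [map_smul, LinearMap.smul_apply]; exact injSupp_smul r hx

lemma injSupp_Rgt {F : IS d n} (hF : InjSupp F) (x : GA d) : InjSupp (Rgt x F) := by
  induction x using ga_induction with
  | hof g =>
    intro i hi
    rw [Rgt_of] at hi
    have := (hF _ hi).comp g⁻¹.injective
    rw [Function.comp_assoc] at this
    simpa using this
  | hadd x y hx hy => rw [map_add, LinearMap.add_apply]; exact injSupp_add hx hy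
  | hsmul r x hx => rw [map_smul, LinearMap.smul_apply]; exact injSupp_smul r hx

open scoped Classical in
/-- The delta function of a word. -/
noncomputable def dlt (i : Fin d → Fin n) : IS d n := fun j => if j = i then 1 else 0

lemma injSupp_dlt {i : Fin d → Fin n} (hi : Function.Injective i) : InjSupp (dlt i) := by
  intro j hj
  unfold dlt at hj
  split_ifs at hj with h
  · rw [h]; exact hi
  · exact absurd rfl hj

lemma Lft_dlt (g : Equiv.Perm (Fin n)) (i : Fin d → Fin n) :
    Lft (gof g) (dlt i) = dlt (⇑g ∘ i) := by
  ext j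
  rw [Lft_of]
  unfold dlt
  congr 1
  rw [eq_iff_iff]
  constructor
  · rintro rfl; ext; simp
  · rintro rfl; ext; simp

lemma Rgt_dlt (g : Equiv.Perm (Fin d)) (i : Fin d → Fin n) :
    Rgt (gof g) (dlt i) = dlt (i ∘ ⇑g⁻¹) := by
  ext j
  rw [Rgt_of]
  unfold dlt
  congr 1
  rw [eq_iff_iff]
  constructor
  · rintro rfl; ext; simp
  · rintro rfl; ext; simp

lemma exists_perm_of_inj {i j : Fin d → Fin n} (hi : Function.Injective i)
    (hj : Function.Injective j) : ∃ g : Equiv.Perm (Fin n), ⇑g ∘ i = j := by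
  classical
  let e : Set.range i ≃ Set.range j := (Equiv.ofInjective i hi).symm.trans (Equiv.ofInjective j hj)
  refine ⟨e.extendSubtype, ?_⟩
  ext k
  have := e.extendSubtype_apply_of_mem (i k) ⟨k, rfl⟩
  simp only [Function.comp_apply]
  rw [this]
  have h2 : (Equiv.ofInjective i hi).symm ⟨i k, ⟨k, rfl⟩⟩ = k := Equiv.ofInjective_symm_apply hi k
  simp only [e, Equiv.trans_apply, h2, Equiv.ofInjective_apply]

lemma Rgt_dlt_eq_Lft {i j : Fin d → Fin n} (hi : Function.Injective i)
    (hj : Function.Injective j) (y : GA d) : ∃ x : GA n, Rgt y (dlt i) = Lft x (dlt j) := by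
  induction y using ga_induction with
  | hof s =>
    obtain ⟨g, hg⟩ := exists_perm_of_inj hj (hi.comp s⁻¹.injective)
    refine ⟨gof g, ?_⟩
    rw [Rgt_dlt, Lft_dlt, hg]
  | hadd x y hx hy =>
    obtain ⟨a, ha⟩ := hx
    obtain ⟨b, hb⟩ := hy
    exact ⟨a + b, by simp only [map_add, LinearMap.add_apply, ha, hb]⟩
  | hsmul r x hx =>
    obtain ⟨a, ha⟩ := hx
    exact ⟨r • a, by simp only [map_smul, LinearMap.smul_apply, ha]⟩

lemma inv_pres {f : Fin d → ℕ} {p : Equiv.Perm (Fin d)} (hp : ∀ k, f (p k) = f k) (k : Fin d) :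
    f (p⁻¹ k) = f k := by
  have := hp (p⁻¹ k); simp at this; exact this.symm

lemma anti_row {Q : IS d n →ₗ[ℂ] GA d}
    (hQ : ∀ s F, Q (Rgt (gof s) F) = Q F * gof s⁻¹) (row : Fin d → ℕ) (F : IS d n) :
    Q (Rgt (rowSymmetrizer row) F) = Q F * rowSymmetrizer row := by
  classical
  unfold rowSymmetrizer
  rw [map_sum, LinearMap.sum_apply, map_sum, Finset.mul_sum]
  simp_rw [hQ]
  apply Finset.sum_bij (fun w _ => w⁻¹)
  · intro w hw
    simp only [Finset.mem_filter, Finset.mem_univ, true_and] at hw ⊢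
    exact inv_pres hw
  · intro w _ w' _ e; exact inv_injective e
  · intro w hw
    simp only [Finset.mem_filter, Finset.mem_univ, true_and] at hw
    exact ⟨w⁻¹, by simpa using inv_pres hw, by simp⟩
  · intro w _; rfl

lemma anti_col {Q : IS d n →ₗ[ℂ] GA d}
    (hQ : ∀ s F, Q (Rgt (gof s) F) = Q F * gof s⁻¹) (col : Fin d → ℕ) (F : IS d n) :
    Q (Rgt (colSymmetrizer col) F) = Q F * colSymmetrizer col := by
  classical
  unfold colSymmetrizer
  rw [map_sum, LinearMap.sum_apply, map_sum, Finset.mul_sum]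
  simp_rw [map_smul, LinearMap.smul_apply, map_smul, hQ, mul_smul_comm]
  apply Finset.sum_bij (fun w _ => w⁻¹)
  · intro w hw
    simp only [Finset.mem_filter, Finset.mem_univ, true_and] at hw ⊢
    exact inv_pres hw
  · intro w _ w' _ e; exact inv_injective e
  · intro w hw
    simp only [Finset.mem_filter, Finset.mem_univ, true_and] at hw
    exact ⟨w⁻¹, by simpa using inv_pres hw, by simp⟩
  · intro w _
    rw [Equiv.Perm.sign_inv]

/-- Row-content projection. -/
noncomputable def Qp (row : Fin n → ℕ) (row' : Fin d → ℕ) : IS d n →ₗ[ℂ] GA d where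
  toFun F := ∑ u : Equiv.Perm (Fin d),
    (∑ i ∈ Finset.univ.filter (fun i : Fin d → Fin n => row ∘ i = row' ∘ u), F i) • gof u
  map_add' F G := by
    simp only [Pi.add_apply, Finset.sum_add_distrib, add_smul]
  map_smul' r F := by
    simp only [Pi.smul_apply, smul_eq_mul, ← Finset.mul_sum, mul_smul, Finset.smul_sum,
      RingHom.id_apply]

lemma Qp_apply (row : Fin n → ℕ) (row' : Fin d → ℕ) (F : IS d n) :
    Qp row row' F = ∑ u : Equiv.Perm (Fin d),
    (∑ i ∈ Finset.univ.filter (fun i : Fin d → Fin n => row ∘ i = row' ∘ u), F i) • gof u := rfl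

lemma Qp_Rgt (row : Fin n → ℕ) (row' : Fin d → ℕ) (s : Equiv.Perm (Fin d)) (F : IS d n) :
    Qp row row' (Rgt (gof s) F) = Qp row row' F * gof s⁻¹ := by
  classical
  rw [Qp_apply, Qp_apply, Finset.sum_mul]
  simp_rw [Rgt_of]
  apply Finset.sum_bij (fun u _ => u * s)
  · intro u _; simp
  · intro u _ u' _ e; exact mul_right_cancel e
  · intro u _; exact ⟨u * s⁻¹, by simp, by simp⟩
  · intro u _
    rw [smul_mul_assoc, gof, gof, gof, ← map_mul]
    simp only [mul_inv_cancel_right]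
    congr 1
    apply Finset.sum_bij (fun i _ => i ∘ s)
    · intro i hi
      simp only [Finset.mem_filter, Finset.mem_univ, true_and] at hi ⊢
      rw [← Function.comp_assoc, hi]; rfl
    · intro i _ i' _ e
      exact s.surjective.injective_comp_right e
    · intro i hi
      simp only [Finset.mem_filter, Finset.mem_univ, true_and] at hi
      refine ⟨i ∘ ⇑s⁻¹, ?_, by ext; simp⟩
      simp only [Finset.mem_filter, Finset.mem_univ, true_and]
      rw [← Function.comp_assoc, hi]
      ext; simp
    · intro i _; rfl

lemma Qp_Lft_of (row : Fin n → ℕ) (row' : Fin d → ℕ) {p : Equiv.Perm (Fin n)}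
    (hp : ∀ k, row (p k) = row k) (F : IS d n) :
    Qp row row' (Lft (gof p) F) = Qp row row' F := by
  classical
  rw [Qp_apply, Qp_apply]
  apply Finset.sum_congr rfl
  intro u _
  congr 1
  simp_rw [Lft_of]
  apply Finset.sum_bij (fun i _ => ⇑p⁻¹ ∘ i)
  · intro i hi
    simp only [Finset.mem_filter, Finset.mem_univ, true_and] at hi ⊢
    rw [← hi]; ext k; exact inv_pres hp (i k)
  · intro i _ i' _ e
    exact p⁻¹.injective.comp_left e
  · intro i hi
    simp only [Finset.mem_filter, Finset.mem_univ, true_and] at hi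
    refine ⟨⇑p ∘ i, ?_, by ext; simp⟩
    simp only [Finset.mem_filter, Finset.mem_univ, true_and]
    rw [← hi]; ext k; simp [hp]
  · intro i _; rfl

lemma Qp_Lft_row (row : Fin n → ℕ) (row' : Fin d → ℕ) :
    ∃ t : ℂ, t ≠ 0 ∧ ∀ F, Qp row row' (Lft (rowSymmetrizer row) F) = t • Qp row row' F := by
  classical
  refine ⟨((Finset.univ.filter
      (fun w : Equiv.Perm (Fin n) => ∀ k, row (w k) = row k)).card : ℂ), ?_, ?_⟩
  · rw [Nat.cast_ne_zero]
    apply Finset.card_ne_zero_of_mem (a := 1)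
    simp
  · intro F
    unfold rowSymmetrizer
    rw [map_sum, LinearMap.sum_apply, map_sum, Finset.sum_congr rfl
      (g := fun _ => Qp row row' F)]
    · simp [Nat.cast_smul_eq_nsmul]
    · intro w hw
      simp only [Finset.mem_filter, Finset.mem_univ, true_and] at hw
      exact Qp_Lft_of row row' hw F
end words

section strip
variable {d n : ℕ}

/-- Sum of the permutations `u` with `row' ∘ u = f`. -/
noncomputable def Ru (row' : Fin d → ℕ) (f : Fin d → ℕ) : GA d :=
  ∑ u ∈ Finset.univ.filter (fun u : Equiv.Perm (Fin d) => f = row' ∘ u), gof u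

lemma Qp_dlt (row : Fin n → ℕ) (row' : Fin d → ℕ) (j : Fin d → Fin n) :
    Qp row row' (dlt j) = Ru row' (row ∘ j) := by
  classical
  rw [Qp_apply, Ru, Finset.sum_filter]
  apply Finset.sum_congr rfl
  intro u _
  by_cases h : row ∘ j = row' ∘ u
  · rw [if_pos h, Finset.sum_eq_single j]
    · simp [dlt]
    · intro b _ hb; simp [dlt, hb]
    · intro hh; exact absurd (by simpa using h) hh
  · rw [if_neg h, Finset.sum_eq_zero, zero_smul]
    intro i hi
    simp only [Finset.mem_filter, Finset.mem_univ, true_and] at hi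
    simp only [dlt]
    rw [if_neg]
    rintro rfl; exact h hi

lemma rowS_gof_Ru (row' : Fin d → ℕ) (q : Equiv.Perm (Fin d)) :
    rowSymmetrizer row' * gof q = Ru row' (row' ∘ q) := by
  classical
  unfold rowSymmetrizer Ru
  rw [Finset.sum_mul]
  apply Finset.sum_bij (fun p _ => p * q)
  · intro p hp
    simp only [Finset.mem_filter, Finset.mem_univ, true_and] at hp ⊢
    ext k; simp [hp]
  · intro a _ b _ e; exact mul_right_cancel e
  · intro u hu
    simp only [Finset.mem_filter, Finset.mem_univ, true_and] at hu
    refine ⟨u * q⁻¹, ?_, by simp⟩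
    simp only [Finset.mem_filter, Finset.mem_univ, true_and]
    intro k
    have := congrFun hu (q⁻¹ k)
    rw [Function.comp_apply, show q (q⁻¹ k) = k from q.apply_symm_apply k] at this
    exact this.symm
  · intro a _; exact (map_mul _ _ _).symm

lemma Ru_ne_zero {row' f : Fin d → ℕ} (h : Ru row' f ≠ 0) : ∃ u : Equiv.Perm (Fin d), f = row' ∘ u := by
  classical
  by_contra hcon
  push Not at hcon
  apply h
  unfold Ru
  rw [Finset.filter_false_of_mem, Finset.sum_empty]
  intro u _; exact hcon u

lemma strip_emb {l m : Ptn} {row col : Fin n → ℕ} {row' col' : Fin d → ℕ}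
    (h : IsFilling l row col) (h' : IsFilling m row' col') (hle : ∀ i, m.part i ≤ l.part i) :
    ∃ i : Fin d → Fin n, Function.Injective i ∧ (∀ k, row (i k) = row' k) ∧ ∀ k, col (i k) = col' k := by
  have : ∀ k, ∃ j, row j = row' k ∧ col j = col' k := fun k =>
    (h.2 _ _).2 (lt_of_lt_of_le (filling_lt h' k) (hle _))
  choose i hi using this
  refine ⟨i, ?_, fun k => (hi k).1, fun k => (hi k).2⟩
  intro a b e
  apply filling_inj h'
  · rw [← (hi a).1, ← (hi b).1, e]
  · rw [← (hi a).2, ← (hi b).2, e]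

lemma strip_fix {l m : Ptn} {row col : Fin n → ℕ} {row' col' : Fin d → ℕ}
    (h : IsFilling l row col) (h' : IsFilling m row' col')
    (hs : ∀ i, l.part (i + 1) ≤ m.part i)
    {i : Fin d → Fin n} (hi : Function.Injective i) (hr : ∀ k, row (i k) = row' k)
    (hc : ∀ k, col (i k) = col' k) (q : Equiv.Perm (Fin n)) (hq : ∀ k, col (q k) = col k)
    (u : Equiv.Perm (Fin d)) (hu : row ∘ q ∘ i = row' ∘ u) (k : Fin n) (hk : k ∉ Set.range i) :
    q k = k := by
  classical
  have hle : ∀ k, k ∉ Set.range i → row (q k) ≤ row k := by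
    intro k hk
    by_contra hcon
    push Not at hcon
    apply hk
    have h1 : col k < l.part (row (q k)) := by rw [← hq k]; exact filling_lt h _
    have h2 : l.part (row (q k)) ≤ l.part (row k + 1) := ptn_antitone l hcon
    obtain ⟨k', e1, e2⟩ := (h'.2 (row k) (col k)).2 (lt_of_lt_of_le h1 (h2.trans (hs _)))
    refine ⟨k', filling_inj h ?_ ?_⟩
    · rw [hr, e1]
    · rw [hc, e2]
  have hsum : ∑ k, row (q k) = ∑ k, row k := Equiv.sum_comp q row
  have hsum1 : ∑ k ∈ Finset.univ.image i, row (q k) = ∑ k ∈ Finset.univ.image i, row k := by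
    rw [Finset.sum_image hi.injOn, Finset.sum_image hi.injOn]
    calc ∑ k, row (q (i k)) = ∑ k, row' (u k) :=
          Finset.sum_congr rfl (fun k _ => congrFun hu k)
      _ = ∑ k, row' k := Equiv.sum_comp u row'
      _ = _ := Finset.sum_congr rfl (fun k _ => (hr k).symm)
  rw [← Finset.sum_add_sum_compl (Finset.univ.image i) (fun k => row (q k)),
    ← Finset.sum_add_sum_compl (Finset.univ.image i) row, hsum1] at hsum
  have hsum2 := Nat.add_left_cancel hsum
  have := (Finset.sum_eq_sum_iff_of_le (s := (Finset.univ.image i)ᶜ)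
    (f := fun k => row (q k)) (g := row) (fun k hk => hle k (by simpa using hk))).1 hsum2 k
    (by simpa using hk)
  exact filling_inj h this (hq k)

lemma restrict_perm {i : Fin d → Fin n} (hi : Function.Injective i) (q : Equiv.Perm (Fin n))
    (hq : ∀ k, k ∉ Set.range i → q k = k) :
    ∃ q' : Equiv.Perm (Fin d), q'.viaFintypeEmbedding ⟨i, hi⟩ = q := by
  classical
  have : ∀ k, ∃ k', i k' = q (i k) := by
    intro k
    by_contra hcon
    have h1 := hq (q (i k)) hcon
    exact hcon ⟨k, (q.injective h1).symm⟩
  choose f hf using this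
  have finj : Function.Injective f := by
    intro a b e
    apply hi; apply q.injective; rw [← hf, ← hf, e]
  refine ⟨Equiv.ofBijective f (Finite.injective_iff_bijective.1 finj), ?_⟩
  ext k
  by_cases hk : k ∈ Set.range i
  · obtain ⟨k, rfl⟩ := hk
    have := Equiv.Perm.viaFintypeEmbedding_apply_image
      (Equiv.ofBijective f (Finite.injective_iff_bijective.1 finj)) ⟨i, hi⟩ k
    rw [Function.Embedding.coeFn_mk] at this
    rw [this, ← hf]; rfl
  · rw [Equiv.Perm.viaFintypeEmbedding_apply_notMem_range _ _ (by simpa using hk), hq k hk]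

lemma Qp_col {l m : Ptn} {row col : Fin n → ℕ} {row' col' : Fin d → ℕ}
    (h : IsFilling l row col) (h' : IsFilling m row' col')
    (hs : ∀ i, l.part (i + 1) ≤ m.part i)
    {i : Fin d → Fin n} (hi : Function.Injective i) (hr : ∀ k, row (i k) = row' k)
    (hc : ∀ k, col (i k) = col' k) :
    Qp row row' (Lft (colSymmetrizer col) (dlt i)) = youngSymmetrizer row' col' := by
  classical
  unfold youngSymmetrizer colSymmetrizer
  rw [map_sum, LinearMap.sum_apply, map_sum, Finset.mul_sum]
  symm
  have him : ∀ (q' : Equiv.Perm (Fin d)) (k : Fin d),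
      q'.viaFintypeEmbedding ⟨i, hi⟩ (i k) = i (q' k) := fun q' k => 
    Equiv.Perm.viaFintypeEmbedding_apply_image q' ⟨i, hi⟩ k
  apply Finset.sum_of_injOn (fun q' => q'.viaFintypeEmbedding ⟨i, hi⟩)
  · intro a _ b _ e
    ext k
    have := congrArg (fun q : Equiv.Perm (Fin n) => q (i k)) e
    simp only [him] at this
    rw [hi this]
  · intro q' hq'
    simp only [Finset.coe_filter, Finset.mem_univ, true_and, Set.mem_ofPred_eq] at hq' ⊢
    intro k
    by_cases hk : k ∈ Set.range i
    · obtain ⟨k, rfl⟩ := hk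
      rw [him, hc, hc, hq']
    · rw [Equiv.Perm.viaFintypeEmbedding_apply_notMem_range _ _ (by simpa using hk)]
  · intro q hq hn
    simp only [Finset.mem_filter, Finset.mem_univ, true_and] at hq
    rw [map_smul, LinearMap.smul_apply, map_smul, Lft_dlt, Qp_dlt]
    by_contra hcon
    have h1 : Ru row' (row ∘ ⇑q ∘ i) ≠ 0 := fun e => hcon (by rw [e, smul_zero])
    obtain ⟨u, hu⟩ := Ru_ne_zero h1
    obtain ⟨q', rfl⟩ := restrict_perm hi q (strip_fix h h' hs hi hr hc q hq u hu)
    apply hn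
    refine ⟨q', ?_, rfl⟩
    simp only [Finset.coe_filter, Finset.mem_univ, true_and, Set.mem_ofPred_eq]
    intro k
    rw [← hc, ← hc, ← him, hq]
  · intro q' _
    rw [map_smul, LinearMap.smul_apply, map_smul, Lft_dlt, Qp_dlt, mul_smul_comm, rowS_gof_Ru,
      Equiv.Perm.viaFintypeEmbedding_sign]
    congr 2
    ext k
    simp only [Function.comp_apply, him, hr]

/-- Nonvanishing for strips. -/
lemma strip_nonvanish {l m : Ptn} {row col : Fin n → ℕ} {row' col' : Fin d → ℕ}
    (h : IsFilling l row col) (h' : IsFilling m row' col') (hle : ∀ i, m.part i ≤ l.part i)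
    (hs : ∀ i, l.part (i + 1) ≤ m.part i) :
    ∃ i : Fin d → Fin n, Function.Injective i ∧
      Lft (youngSymmetrizer row col) (Rgt (colSymmetrizer col' * rowSymmetrizer row') (dlt i)) ≠ 0 ∧
      Lft (youngSymmetrizer row col)
        (Rgt (youngSymmetrizer row' col') (Rgt (rowSymmetrizer row') (dlt i))) ≠ 0 := by
  obtain ⟨i, hi, hr, hc⟩ := strip_emb h h' hle
  obtain ⟨t, ht, hQ⟩ := Qp_Lft_row row row'
  have key := Qp_col h h' hs hi hr hc
  have hA := anti_row (Qp_Rgt row row') row'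
  have hB := anti_col (Qp_Rgt row row') col'
  have e1 : Qp row row' (Lft (youngSymmetrizer row col)
      (Rgt (colSymmetrizer col' * rowSymmetrizer row') (dlt i))) =
      t • (youngSymmetrizer row' col' * youngSymmetrizer row' col') := by
    rw [Lft_Rgt_comm, map_mul, Module.End.mul_apply, hB, hA]
    unfold youngSymmetrizer at key ⊢
    rw [map_mul, Module.End.mul_apply, hQ, key]
    simp only [smul_mul_assoc, mul_assoc]
  have e2 : Qp row row' (Lft (youngSymmetrizer row col)
      (Rgt (youngSymmetrizer row' col') (Rgt (rowSymmetrizer row') (dlt i)))) * colSymmetrizer col' =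
      t • (youngSymmetrizer row' col' * youngSymmetrizer row' col' * youngSymmetrizer row' col') := by
    rw [Lft_Rgt_comm, Lft_Rgt_comm]
    unfold youngSymmetrizer at key ⊢
    rw [map_mul Rgt, Module.End.mul_apply, hA, hB, hA, map_mul, Module.End.mul_apply, hQ, key]
    simp only [smul_mul_assoc, mul_assoc]
  have c2 := young_sq_ne_zero h'
  refine ⟨i, hi, ?_, ?_⟩
  · intro e
    rw [e, map_zero] at e1
    exact (smul_ne_zero ht c2) e1.symm
  · intro e
    rw [e, map_zero, zero_mul] at e2
    refine (smul_ne_zero ht ?_) e2.symm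
    obtain ⟨r, hr⟩ := young_x_young h' 1
    rw [mul_one] at hr
    rw [hr] at c2 ⊢
    rw [smul_mul_assoc, hr]
    have hr0 : r ≠ 0 := fun e => c2 (by rw [e, zero_smul])
    exact smul_ne_zero hr0 c2

end strip

section dims

/-- Partitions of `n`. -/
abbrev PT (n : ℕ) := {l : Ptn // l.size = n}

lemma ptn_size_eq (l : Ptn) {N : ℕ} (h : ∀ i, N ≤ i → l.part i = 0) :
    l.size = ∑ i ∈ Finset.range N, l.part i := by
  unfold Ptn.size
  apply Finsupp.sum_of_support_subset
  · intro i hi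
    rw [Finsupp.mem_support_iff] at hi
    rw [Finset.mem_range]
    by_contra hcon
    exact hi (h i (by omega))
  · intro _ _; rfl

lemma ptn_zero (l : Ptn) {i : ℕ} (h : l.size ≤ i) : l.part i = 0 := by
  by_contra hcon
  have h1 : Finset.range (i + 1) ⊆ l.part.support := by
    intro j hj
    rw [Finset.mem_range] at hj
    rw [Finsupp.mem_support_iff]
    have : l.part i ≤ l.part j := ptn_antitone l (by omega)
    omega
  have h2 := Finset.card_le_card h1
  rw [Finset.card_range] at h2
  have h3 : l.part.support.card ≤ l.size := by
    unfold Ptn.size Finsupp.sum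
    rw [Finset.card_eq_sum_ones]
    apply Finset.sum_le_sum
    intro j hj
    rw [Finsupp.mem_support_iff] at hj
    exact Nat.one_le_iff_ne_zero.2 hj
  omega

lemma ptn_part_le (l : Ptn) (i : ℕ) : l.part i ≤ l.size := by
  by_cases h : l.size ≤ i
  · rw [ptn_zero l h]; omega
  · rw [ptn_size_eq l (N := l.size) (fun i hi => ptn_zero l hi)]
    push Not at h
    exact Finset.single_le_sum (f := fun i => l.part i) (fun _ _ => Nat.zero_le _) (Finset.mem_range.2 h)

instance PT_finite (n : ℕ) : Finite (PT n) := by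
  apply Finite.of_injective (β := Fin n → Fin (n + 1))
    (fun l i => ⟨l.1.part i, by have := ptn_part_le l.1 i; have := l.2; omega⟩)
  intro l l' e
  apply Subtype.ext
  apply ptn_ext
  intro i
  by_cases h : i < n
  · have := congrFun e ⟨i, h⟩
    simpa using this
  · rw [ptn_zero l.1 (by have := l.2; omega), ptn_zero l'.1 (by have := l'.2; omega)]

noncomputable instance PT_fintype (n : ℕ) : Fintype (PT n) := Fintype.ofFinite _

lemma exists_filling {n : ℕ} (l : PT n) : ∃ row col : Fin n → ℕ, IsFilling l.1 row col := by
  classical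
  let S : Finset (Σ _ : ℕ, ℕ) := (Finset.range n).sigma (fun i => Finset.range (l.1.part i))
  have hS : S.card = n := by
    rw [Finset.card_sigma]
    simp only [Finset.card_range]
    rw [← ptn_size_eq l.1 (fun i hi => ptn_zero l.1 (by have := l.2; omega)), l.2]
  let e := S.equivFinOfCardEq hS
  refine ⟨fun k => (e.symm k).1.1, fun k => (e.symm k).1.2, ?_, ?_⟩
  · intro a b h
    simp only [Prod.mk.injEq] at h
    apply e.symm.injective
    apply Subtype.ext
    exact Sigma.ext h.1 (heq_of_eq h.2)
  · intro i j
    constructor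
    · rintro ⟨k, rfl, rfl⟩
      have := (e.symm k).2
      simp only [S, Finset.mem_sigma, Finset.mem_range] at this
      exact this.2
    · intro hj
      have hi : i < n := by
        by_contra hcon
        rw [ptn_zero l.1 (by have := l.2; omega)] at hj
        omega
      refine ⟨e ⟨⟨i, j⟩, by simp [S, hi, hj]⟩, ?_, ?_⟩
      · simp only [Equiv.symm_apply_apply]
      · simp only [Equiv.symm_apply_apply]

/-- A chosen filling. -/
noncomputable def frow {n : ℕ} (l : PT n) : Fin n → ℕ := (exists_filling l).choose
/-- A chosen filling. -/
noncomputable def fcol {n : ℕ} (l : PT n) : Fin n → ℕ := (exists_filling l).choose_spec.choose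
lemma ffill {n : ℕ} (l : PT n) : IsFilling l.1 (frow l) (fcol l) :=
  (exists_filling l).choose_spec.choose_spec

/-- The horizontal strip condition. -/
def Strip (m l : Ptn) : Prop := (∀ i, m.part i ≤ l.part i) ∧ ∀ i, l.part (i + 1) ≤ m.part i

lemma dim_lower {d n : ℕ} (hdn : d ≤ n) {l : Ptn} {row col : Fin n → ℕ} (h : IsFilling l row col)
    [Fintype {m : PT d // Strip m.1 l}] :
    ∑ m : {m : PT d // Strip m.1 l}, Module.finrank ℂ (spechtModule (frow m.1) (fcol m.1)) ≤
      Module.finrank ℂ (spechtModule row col) := by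
  classical
  let σ := {m : PT d // Strip m.1 l}
  have hnv := fun m : σ => strip_nonvanish h (ffill m.1) m.2.1 m.2.2
  choose i hi _ hnv using hnv
  let c := youngSymmetrizer row col
  let X : σ → IS d n := fun m => Rgt (rowSymmetrizer (frow m.1)) (dlt (i m))
  let L : (∀ m : σ, spechtModule (frow m.1) (fcol m.1)) →ₗ[ℂ] IS d n :=
    ∑ m : σ, (Lft c).comp ((((LinearMap.applyₗ (X m)).comp Rgt.toLinearMap).comp
      (spechtModule (frow m.1) (fcol m.1)).subtype).comp (LinearMap.proj m))
  have hL : ∀ v, L v = ∑ m : σ, Lft c (Rgt (v m).1 (X m)) := by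
    intro v
    simp only [L, LinearMap.sum_apply]
    rfl
  have hinj : Function.Injective L := by
    rw [← LinearMap.ker_eq_bot, LinearMap.ker_eq_bot']
    intro v hv
    rw [hL] at hv
    funext m0
    apply Subtype.ext
    apply specht_sep (v m0).2
    intro z
    have h1 := congrArg (Rgt (youngSymmetrizer (frow m0.1) (fcol m0.1) * gof z)) hv
    rw [map_sum, map_zero, Finset.sum_eq_single m0] at h1
    · rw [← Lft_Rgt_comm, ← Module.End.mul_apply (Rgt _), ← map_mul,
        young_mul_specht (ffill m0.1) (v m0).2, map_smul, LinearMap.smul_apply, map_smul] at h1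
      rcases smul_eq_zero.1 h1 with h1 | h1
      · rw [young_mul_specht (ffill m0.1) (v m0).2, h1, zero_smul]
      · exact absurd h1 (hnv m0)
    · intro m _ hm
      rw [← Lft_Rgt_comm, ← Module.End.mul_apply (Rgt _), ← map_mul,
        young_mul_specht_zero (ffill m0.1) (ffill m.1) (fun e => hm (Subtype.ext (Subtype.ext e.symm)))
          (v m).2, map_zero, LinearMap.zero_apply, map_zero]
    · intro hh; exact absurd (Finset.mem_univ _) hh
  let T : GA n →ₗ[ℂ] IS d n := (LinearMap.applyₗ (dlt (Fin.castLE hdn))).comp Lft.toLinearMap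
  have hrange : LinearMap.range L ≤ (LinearMap.range (LinearMap.mulLeft ℂ c)).map T := by
    rintro _ ⟨v, rfl⟩
    rw [hL]
    apply Submodule.sum_mem
    intro m _
    obtain ⟨x, hx⟩ := Rgt_dlt_eq_Lft (hi m) (Fin.castLE_injective hdn)
      ((v m).1 * rowSymmetrizer (frow m.1))
    refine ⟨c * x, ⟨x, rfl⟩, ?_⟩
    show Lft (c * x) _ = _
    rw [map_mul, Module.End.mul_apply, ← hx, map_mul]
    rfl
  calc _ = Module.finrank ℂ (∀ m : σ, spechtModule (frow m.1) (fcol m.1)) := by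
        rw [Module.finrank_pi_fintype]
    _ = Module.finrank ℂ (LinearMap.range L) := (LinearMap.finrank_range_of_inj hinj).symm
    _ ≤ Module.finrank ℂ ((LinearMap.range (LinearMap.mulLeft ℂ c)).map T) :=
        Submodule.finrank_mono hrange
    _ ≤ _ := Submodule.finrank_map_le _ _
    _ ≤ _ := finrank_right_le h

open scoped Classical in
/-- The number of standard tableaux, recursively. -/
noncomputable def fl : ℕ → Ptn → ℕ
  | 0, _ => 1
  | n + 1, l => ∑ v : PT n, if Strip v.1 l then fl n v.1 else 0

lemma fl_le_dim : ∀ {n : ℕ} {l : Ptn} {row col : Fin n → ℕ} (_ : IsFilling l row col),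
    fl n l ≤ Module.finrank ℂ (spechtModule row col)
  | 0, l, row, col, h => by
    rw [fl]
    have : youngSymmetrizer row col ∈ spechtModule row col := mem_specht.2 ⟨1, (one_mul _).symm⟩
    have hnt : Nontrivial (spechtModule row col) :=
      ⟨⟨⟨_, this⟩, 0, fun e => young_ne_zero h (congrArg Subtype.val e)⟩⟩
    exact Module.finrank_pos
  | n + 1, l, row, col, h => by
    classical
    rw [fl]
    refine le_trans ?_ (dim_lower (Nat.le_succ n) h)
    rw [← Finset.sum_filter, Finset.sum_subtype (p := fun m : PT n => Strip m.1 l)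
      (Finset.univ.filter (fun m : PT n => Strip m.1 l)) (by simp)]
    exact Finset.sum_le_sum (fun m _ => fl_le_dim (ffill m.1))

end dims

section pieri

/-- `l` is obtained from `v` by adding a box in row `i`. -/
def Box (v l : Ptn) (i : ℕ) : Prop := ∀ j, l.part j = v.part j + if j = i then 1 else 0

lemma box_size {v l : Ptn} {i : ℕ} (h : Box v l i) : l.size = v.size + 1 := by
  have : l.part = v.part + Finsupp.single i 1 := by
    ext j
    rw [h j, Finsupp.add_apply, Finsupp.single_apply]
    simp [eq_comm]
  unfold Ptn.size
  rw [this, Finsupp.sum_add_index' (fun _ => rfl) (fun _ _ _ => rfl), Finsupp.sum_single_index rfl]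

lemma ptn_eq_of_le {v l : Ptn} (h : ∀ j, v.part j ≤ l.part j) (hs : l.size ≤ v.size) : v = l := by
  apply ptn_ext
  intro j
  have e1 := ptn_size_eq l (N := l.size + v.size + j + 1) (fun i hi => ptn_zero l (by omega))
  have e2 := ptn_size_eq v (N := l.size + v.size + j + 1) (fun i hi => ptn_zero v (by omega))
  have hle : ∀ i ∈ Finset.range (l.size + v.size + j + 1), v.part i ≤ l.part i := fun i _ => h i
  have h3 := Finset.sum_le_sum hle
  exact (Finset.sum_eq_sum_iff_of_le hle).1 (by omega) j (Finset.mem_range.2 (by omega))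

lemma strip_size_le {v l : Ptn} (h : Strip v l) : v.size ≤ l.size := by
  by_contra hcon
  have := ptn_eq_of_le h.1 (by omega)
  rw [this] at hcon
  exact hcon le_rfl

lemma strip_box {v l : Ptn} (h : Strip v l) (hs : l.size = v.size + 1) : ∃ i, Box v l i := by
  have : ∃ i, v.part i < l.part i := by
    by_contra hcon
    push Not at hcon
    have := ptn_eq_of_le hcon (by have := strip_size_le h; omega)
    rw [this] at hs
    omega
  obtain ⟨i, hi⟩ := this
  refine ⟨i, ?_⟩
  intro j
  set N := l.size + v.size + j + i + 1 with hN
  have e1 := ptn_size_eq l (N := N) (fun i hi => ptn_zero l (by omega))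
  have e2 := ptn_size_eq v (N := N) (fun i hi => ptn_zero v (by omega))
  have hle : ∀ j ∈ Finset.range N, v.part j + (if j = i then 1 else 0) ≤ l.part j := by
    intro j _
    have := h.1 j
    split_ifs with hj
    · subst hj; omega
    · omega
  have e3 : ∑ j ∈ Finset.range N, (v.part j + (if j = i then 1 else 0)) = v.size + 1 := by
    rw [Finset.sum_add_distrib, ← e2, Finset.sum_ite_eq', if_pos (Finset.mem_range.2 (by omega))]
  exact ((Finset.sum_eq_sum_iff_of_le hle).1 (by omega) j (Finset.mem_range.2 (by omega))).symm

lemma box_strip {v l : Ptn} {i : ℕ} (h : Box v l i) : Strip v l := by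
  refine ⟨fun j => by rw [h j]; omega, fun j => ?_⟩
  have h1 := h j
  have h2 := h (j + 1)
  have h3 := l.antitone' j
  have h4 := v.antitone' j
  split_ifs at h1 h2 <;> omega

/-- Rows where a box can be added to `v`. -/
def rowsA (m v : Ptn) : Set ℕ :=
  {i | (∀ j, m.part j ≤ v.part j + if j = i then 1 else 0) ∧
    ∀ j, v.part (j + 1) + (if j + 1 = i then 1 else 0) ≤ m.part j}

/-- Rows where a box can be removed from `m`. -/
def rowsB (m v : Ptn) : Set ℕ :=
  {i | (∀ j, m.part j ≤ v.part j + if j = i then 1 else 0) ∧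
    ∀ j, v.part (j + 1) + (if j = i then 1 else 0) ≤ m.part j}

lemma rowsB_finite (m v : Ptn) : (rowsB m v).Finite := by
  apply (Set.finite_Iio m.size).subset
  intro i hi
  have := hi.2 i
  rw [if_pos rfl] at this
  rw [Set.mem_Iio]
  by_contra hcon
  rw [ptn_zero m (by omega)] at this
  omega

open scoped Classical in
lemma rows_card (m v : Ptn) :
    (rowsA m v).ncard = (rowsB m v).ncard + if Strip m v then 1 else 0 := by
  split_ifs with hs
  · have : rowsA m v = insert 0 (Nat.succ '' rowsB m v) := by
      ext i
      simp only [Set.mem_insert_iff, Set.mem_image]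
      constructor
      · intro hi
        rcases i with _ | i
        · exact Or.inl rfl
        · right
          refine ⟨i, ⟨fun j => (hs.1 j).trans (by omega), fun j => ?_⟩, rfl⟩
          have := hi.2 j
          simpa using this
      · rintro (rfl | ⟨i, hi, rfl⟩)
        · refine ⟨fun j => (hs.1 j).trans (by omega), fun j => ?_⟩
          have := hs.2 j
          simpa using this
        · refine ⟨fun j => (hs.1 j).trans (by omega), fun j => ?_⟩
          have := hi.2 j
          simpa using this
    rw [this, Set.ncard_insert_of_notMem (by simp) ((rowsB_finite m v).image _),
      Set.ncard_image_of_injective _ Nat.succ_injective]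
  · rw [add_zero]
    congr 1
    ext i
    constructor
    · rintro ⟨h1, h2⟩
      have h3 : m.part i = v.part i + 1 := by
        by_contra hcon
        apply hs
        refine ⟨fun j => ?_, fun j => le_trans (by omega) (h2 j)⟩
        have := h1 j
        split_ifs at this with hj
        · subst hj; omega
        · omega
      refine ⟨h1, fun j => ?_⟩
      split_ifs with hj
      · subst hj
        have := v.antitone' j
        omega
      · have := h2 j
        omega
    · rintro ⟨h1, h2⟩
      have h3 : m.part i = v.part i + 1 := by
        by_contra hcon
        apply hs
        refine ⟨fun j => ?_, fun j => le_trans (by omega) (h2 j)⟩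
        have := h1 j
        split_ifs at this with hj
        · subst hj; omega
        · omega
      refine ⟨h1, fun j => ?_⟩
      split_ifs with hj
      · subst hj
        have := m.antitone' j
        omega
      · have := h2 j
        omega

lemma ncard_up {n : ℕ} (m : Ptn) (v : PT n) :
    {l : PT (n + 1) | Strip m l.1 ∧ Strip v.1 l.1}.ncard = (rowsA m v.1).ncard := by
  symm
  let mk : ∀ i ∈ rowsA m v.1, Ptn := fun i hi => ⟨v.1.part + Finsupp.single i 1, fun j => by
    have h1 := hi.1 j
    have h2 := hi.2 j
    simp only [Finsupp.add_apply, Finsupp.single_apply, eq_comm (a := i)]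
    have h3 := v.1.antitone' j
    split_ifs at h1 h2 ⊢ <;> omega⟩
  have hmk : ∀ i (hi : i ∈ rowsA m v.1), Box v.1 (mk i hi) i := by
    intro i hi j
    simp only [mk, Finsupp.add_apply, Finsupp.single_apply, eq_comm (a := i)]
  refine Set.ncard_congr (fun i hi => (⟨mk i hi, by rw [box_size (hmk i hi), v.2]⟩ : PT (n + 1))) ?_ ?_ ?_
  · intro i hi
    refine ⟨⟨fun j => ?_, fun j => ?_⟩, box_strip (hmk i hi)⟩
    · have := hi.1 j
      rwa [← hmk i hi j] at this
    · have := hi.2 j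
      rwa [← hmk i hi (j + 1)] at this
  · intro i i' hi hi' e
    have e' : mk i hi = mk i' hi' := congrArg Subtype.val e
    have h1 := hmk i hi i
    have h2 := hmk i' hi' i
    rw [e'] at h1
    by_contra hne
    rw [if_pos rfl] at h1
    rw [if_neg hne] at h2
    omega
  · rintro l ⟨h1, h2⟩
    obtain ⟨i, hi⟩ := strip_box h2 (by rw [l.2, v.2])
    have hiA : i ∈ rowsA m v.1 := by
      refine ⟨fun j => ?_, fun j => ?_⟩
      · rw [← hi j]; exact h1.1 j
      · rw [← hi (j + 1)]; exact h1.2 j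
    refine ⟨i, hiA, ?_⟩
    apply Subtype.ext
    apply ptn_ext
    intro j
    rw [hi j, hmk i hiA j]

lemma ncard_down {d : ℕ} (m : PT (d + 1)) (v : Ptn) :
    {k : PT d | Strip k.1 m.1 ∧ Strip k.1 v}.ncard = (rowsB m.1 v).ncard := by
  symm
  let mk : ∀ i ∈ rowsB m.1 v, Ptn := fun i hi => ⟨m.1.part - Finsupp.single i 1, fun j => by
    have h1 := hi.1 (j + 1)
    have h2 := hi.2 j
    simp only [Finsupp.tsub_apply, Finsupp.single_apply, eq_comm (a := i)]
    have h3 := m.1.antitone' j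
    split_ifs at h1 h2 ⊢ <;> omega⟩
  have hmk : ∀ i (hi : i ∈ rowsB m.1 v), Box (mk i hi) m.1 i := by
    intro i hi j
    simp only [mk, Finsupp.tsub_apply, Finsupp.single_apply, eq_comm (a := i)]
    have := hi.2 j
    split_ifs at this ⊢ <;> omega
  refine Set.ncard_congr (fun i hi => (⟨mk i hi, by
    have := box_size (hmk i hi); rw [m.2] at this; omega⟩ : PT d)) ?_ ?_ ?_
  · intro i hi
    refine ⟨box_strip (hmk i hi), fun j => ?_, fun j => ?_⟩
    · have := hi.1 j
      rw [hmk i hi j] at this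
      show (mk i hi).part j ≤ _
      omega
    · have := hi.2 j
      rw [hmk i hi j] at this
      show _ ≤ (mk i hi).part j
      omega
  · intro i i' hi hi' e
    have e' : mk i hi = mk i' hi' := congrArg Subtype.val e
    have h1 := hmk i hi i
    have h2 := hmk i' hi' i
    rw [e'] at h1
    by_contra hne
    rw [if_pos rfl] at h1
    rw [if_neg hne] at h2
    omega
  · rintro k ⟨h1, h2⟩
    obtain ⟨i, hi⟩ := strip_box h1 (by rw [k.2, m.2])
    have hiB : i ∈ rowsB m.1 v := by
      refine ⟨fun j => ?_, fun j => ?_⟩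
      · rw [hi j]
        have := h2.1 j
        omega
      · rw [hi j]
        have := h2.2 j
        omega
    refine ⟨i, hiB, ?_⟩
    apply Subtype.ext
    apply ptn_ext
    intro j
    have e1 := hi j
    have e2 := hmk i hiB j
    show (mk i hiB).part j = _
    omega

lemma rowsB_zero (m : PT 0) (v : Ptn) : rowsB m.1 v = ∅ := by
  ext i
  simp only [Set.mem_empty_iff_false, iff_false]
  intro hi
  have := hi.2 i
  rw [if_pos rfl, ptn_zero m.1 (by rw [m.2]; omega)] at this
  omega

lemma PT0_eq (l l' : PT 0) : l = l' := by
  apply Subtype.ext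
  apply ptn_ext
  intro j
  rw [ptn_zero l.1 (by rw [l.2]; omega), ptn_zero l'.1 (by rw [l'.2]; omega)]

/-- The empty partition. -/
def PT0 : PT 0 := ⟨⟨0, fun _ => le_rfl⟩, by simp [Ptn.size]⟩

open scoped Classical in
lemma sum_ite_ncard {α : Type*} [Fintype α] (P Q : α → Prop) (c : ℕ) :
    ∑ a, (if P a then (if Q a then c else 0) else 0) = {a | P a ∧ Q a}.ncard * c := by
  have : {a | P a ∧ Q a} = ((Finset.univ.filter (fun a => P a ∧ Q a) : Finset α) : Set α) := by
    ext a; simp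
  rw [this, Set.ncard_coe_finset, ← smul_eq_mul, ← Finset.sum_const, Finset.sum_filter]
  apply Finset.sum_congr rfl
  intro a _
  by_cases h1 : P a <;> by_cases h2 : Q a <;> simp [h1, h2]

open scoped Classical in
lemma pieri_sum : ∀ (n d : ℕ) (m : PT d),
    ∑ l : PT n, (if Strip m.1 l.1 then fl n l.1 else 0) = n.choose d * fl d m.1
  | 0, d, m => by
    rcases d with _ | d
    · rw [Finset.sum_eq_single PT0]
      · rw [PT0_eq m PT0, if_pos ⟨fun _ => le_rfl, fun i => PT0.1.antitone' i⟩]; simp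
      · intro l _ hl; exact absurd (PT0_eq _ _) hl
      · intro h; exact absurd (Finset.mem_univ _) h
    · rw [Nat.choose_zero_succ, zero_mul]
      apply Finset.sum_eq_zero
      intro l _
      rw [if_neg]
      intro h
      have := strip_size_le h
      rw [m.2, l.2] at this
      omega
  | n + 1, d, m => by
    have h1 : ∑ l : PT (n + 1), (if Strip m.1 l.1 then fl (n + 1) l.1 else 0) =
        ∑ v : PT n, (rowsA m.1 v.1).ncard * fl n v.1 := by
      calc _ = ∑ l : PT (n + 1), ∑ v : PT n,
            (if Strip m.1 l.1 then (if Strip v.1 l.1 then fl n v.1 else 0) else 0) := by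
            apply Finset.sum_congr rfl
            intro l _
            rw [fl]
            split_ifs
            · rfl
            · simp
        _ = _ := by
            rw [Finset.sum_comm]
            apply Finset.sum_congr rfl
            intro v _
            rw [sum_ite_ncard, ncard_up]
    have h2 : ∑ v : PT n, (rowsA m.1 v.1).ncard * fl n v.1 =
        (∑ v : PT n, (rowsB m.1 v.1).ncard * fl n v.1) + n.choose d * fl d m.1 := by
      rw [← pieri_sum n d m, ← Finset.sum_add_distrib]
      apply Finset.sum_congr rfl
      intro v _
      rw [rows_card, add_mul]
      simp
    rw [h1, h2]
    rcases d with _ | d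
    · simp [rowsB_zero]
    · have h3 : ∑ v : PT n, (rowsB m.1 v.1).ncard * fl n v.1 = n.choose d * fl (d + 1) m.1 := by
        calc _ = ∑ v : PT n, ∑ k : PT d,
              (if Strip k.1 m.1 then (if Strip k.1 v.1 then fl n v.1 else 0) else 0) := by
              apply Finset.sum_congr rfl
              intro v _
              rw [sum_ite_ncard, ncard_down]
          _ = ∑ k : PT d, if Strip k.1 m.1 then n.choose d * fl d k.1 else 0 := by
              rw [Finset.sum_comm]
              apply Finset.sum_congr rfl
              intro k _
              split_ifs
              · exact pieri_sum n d k
              · simp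
          _ = _ := by
              rw [fl, Finset.mul_sum]
              apply Finset.sum_congr rfl
              intro k _
              simp
      rw [h3, Nat.choose_succ_succ, add_mul]

lemma fl_sq : ∀ d : ℕ, ∑ m : PT d, fl d m.1 * fl d m.1 = d.factorial
  | 0 => by
    rw [Finset.sum_eq_single PT0]
    · simp [fl]
    · intro l _ hl; exact absurd (PT0_eq _ _) hl
    · intro h; exact absurd (Finset.mem_univ _) h
  | d + 1 => by
    classical
    calc _ = ∑ l : PT (d + 1), ∑ v : PT d, (if Strip v.1 l.1 then fl (d + 1) l.1 else 0) * fl d v.1 := by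
          apply Finset.sum_congr rfl
          intro l _
          have : fl (d + 1) l.1 = ∑ v : PT d, if Strip v.1 l.1 then fl d v.1 else 0 := by rw [fl]
          nth_rewrite 2 [this]
          rw [Finset.mul_sum]
          apply Finset.sum_congr rfl
          intro v _
          split_ifs <;> simp
      _ = ∑ v : PT d, ((d + 1).choose d * fl d v.1) * fl d v.1 := by
          rw [Finset.sum_comm]
          apply Finset.sum_congr rfl
          intro v _
          rw [← Finset.sum_mul, pieri_sum]
      _ = _ := by
          rw [Nat.factorial_succ, ← fl_sq d, Finset.mul_sum, Nat.choose_succ_self_right]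
          apply Finset.sum_congr rfl
          intro v _
          ring

end pieri

section pairing
variable {d n m : ℕ}

/-- The rook placements of size `d`. -/
abbrev RZ (n m d : ℕ) := {R : Finset (Fin n × Fin m) // IsRookPlacement R ∧ R.card = d}

/-- The pairing of two functions on words into functions on rook placements. -/
noncomputable def PairL : IS d n →ₗ[ℂ] IS d m →ₗ[ℂ] (RZ n m d → ℂ) :=
  LinearMap.mk₂ ℂ
    (fun F H R => ∑ w ∈ Finset.univ.filter (fun w : Fin d → Fin n × Fin m => Finset.univ.image w = R.1),
      F (Prod.fst ∘ w) * H (Prod.snd ∘ w))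
    (by
      intro F F' H; funext R
      simp only [Pi.add_apply, add_mul, Finset.sum_add_distrib])
    (by
      intro r F H; funext R
      simp only [Pi.smul_apply, smul_eq_mul, Finset.mul_sum, mul_assoc])
    (by
      intro F H H'; funext R
      simp only [Pi.add_apply, mul_add, Finset.sum_add_distrib])
    (by
      intro r F H; funext R
      simp only [Pi.smul_apply, smul_eq_mul, Finset.mul_sum]
      apply Finset.sum_congr rfl
      intro w _; ring)

lemma PairL_apply (F : IS d n) (H : IS d m) (R : RZ n m d) :
    PairL F H R = ∑ w ∈ Finset.univ.filter (fun w : Fin d → Fin n × Fin m => Finset.univ.image w = R.1),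
      F (Prod.fst ∘ w) * H (Prod.snd ∘ w) := rfl

lemma PairL_equiv (g : Equiv.Perm (Fin n)) (h : Equiv.Perm (Fin m)) (F : IS d n) (H : IS d m)
    (R : RZ n m d) :
    PairL (Lft (gof g) F) (Lft (gof h) H) R = PairL F H (rookAct g⁻¹ h⁻¹ R) := by
  rw [PairL_apply, PairL_apply]
  simp_rw [Lft_of]
  have hinj : Function.Injective (Prod.map ⇑g⁻¹ ⇑h⁻¹) := g⁻¹.injective.prodMap h⁻¹.injective
  apply Finset.sum_bij (fun w _ => Prod.map ⇑g⁻¹ ⇑h⁻¹ ∘ w)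
  · intro w hw
    simp only [Finset.mem_filter, Finset.mem_univ, true_and] at hw ⊢
    rw [← Finset.image_image, hw]
    rfl
  · intro a _ b _ e
    exact hinj.comp_left e
  · intro w hw
    simp only [Finset.mem_filter, Finset.mem_univ, true_and] at hw
    have hc : Prod.map ⇑g⁻¹ ⇑h⁻¹ ∘ (Prod.map ⇑g ⇑h ∘ w) = w := by
      funext k
      exact Prod.ext (g.symm_apply_apply _) (h.symm_apply_apply _)
    refine ⟨Prod.map ⇑g ⇑h ∘ w, ?_, hc⟩
    simp only [Finset.mem_filter, Finset.mem_univ, true_and]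
    apply Finset.image_injective hinj
    rw [Finset.image_image, hc, hw]
    rfl
  · intro w _; rfl

lemma exists_comp_perm {α : Type*} [DecidableEq α] {w w' : Fin d → α}
    (hw' : Function.Injective w') (h : Finset.univ.image w = Finset.univ.image w') :
    ∃ s : Equiv.Perm (Fin d), w' = w ∘ s := by
  have : ∀ k, ∃ k', w k' = w' k := by
    intro k
    have : w' k ∈ Finset.univ.image w := by rw [h]; simp
    simpa using this
  choose f hf using this
  have finj : Function.Injective f := fun a b e => hw' (by rw [← hf, ← hf, e])
  exact ⟨Equiv.ofBijective f (Finite.injective_iff_bijective.1 finj), funext fun k => (hf k).symm⟩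

/-- The placement attached to two injective words. -/
def mkR {i : Fin d → Fin n} {j : Fin d → Fin m} (hi : Function.Injective i)
    (hj : Function.Injective j) : RZ n m d :=
  ⟨Finset.univ.image (fun k => (i k, j k)), by
    constructor
    · intro p hp q hq hne
      simp only [Finset.mem_image, Finset.mem_univ, true_and] at hp hq
      obtain ⟨k, rfl⟩ := hp
      obtain ⟨k', rfl⟩ := hq
      have : k ≠ k' := by rintro rfl; exact hne rfl
      exact ⟨hi.ne this, hj.ne this⟩
    · rw [Finset.card_image_of_injective]
      · simp
      · intro a b e
        exact hi (congrArg Prod.fst e)⟩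

lemma PairL_mkR {i : Fin d → Fin n} {j : Fin d → Fin m} (hi : Function.Injective i)
    (hj : Function.Injective j) (F : IS d n) (H : IS d m) :
    PairL F H (mkR hi hj) = ∑ s : Equiv.Perm (Fin d), F (i ∘ s) * H (j ∘ s) := by
  rw [PairL_apply]
  symm
  have hw0 : Function.Injective (fun k => (i k, j k)) := fun a b e => hi (congrArg Prod.fst e)
  apply Finset.sum_bij (fun (s : Equiv.Perm (Fin d)) _ => (fun k => (i k, j k)) ∘ ⇑s)
  · intro s _
    rw [Finset.mem_filter]
    refine ⟨Finset.mem_univ _, ?_⟩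
    show Finset.image _ _ = Finset.univ.image (fun k => (i k, j k))
    rw [← Finset.image_image, Finset.image_univ_equiv]
  · intro a _ b _ e
    ext k
    rw [hw0 (congrFun e k)]
  · intro w hw
    simp only [Finset.mem_filter, Finset.mem_univ, true_and] at hw
    have hcard : (Finset.univ.image w).card = (Finset.univ : Finset (Fin d)).card := by
      rw [hw, (mkR hi hj).2.2]; simp
    have hwinj : Function.Injective w := by
      have := Finset.card_image_iff.1 hcard
      simpa using this
    obtain ⟨s, hs⟩ := exists_comp_perm hwinj hw.symm
    exact ⟨s, Finset.mem_univ _, hs.symm⟩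
  · intro s _; rfl

/-- Restriction along `i`, first version. -/
noncomputable def resF (i : Fin d → Fin n) : IS d n →ₗ[ℂ] GA d where
  toFun F := ∑ s : Equiv.Perm (Fin d), F (i ∘ ⇑s⁻¹) • gof s
  map_add' F G := by simp only [Pi.add_apply, add_smul, Finset.sum_add_distrib]
  map_smul' r F := by simp only [Pi.smul_apply, smul_eq_mul, mul_smul, Finset.smul_sum, RingHom.id_apply]

/-- Restriction along `i`, second version. -/
noncomputable def resH (i : Fin d → Fin n) : IS d n →ₗ[ℂ] GA d where
  toFun F := ∑ s : Equiv.Perm (Fin d), F (i ∘ ⇑s) • gof s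
  map_add' F G := by simp only [Pi.add_apply, add_smul, Finset.sum_add_distrib]
  map_smul' r F := by simp only [Pi.smul_apply, smul_eq_mul, mul_smul, Finset.smul_sum, RingHom.id_apply]

lemma resF_apply (i : Fin d → Fin n) (F : IS d n) :
    resF i F = ∑ s : Equiv.Perm (Fin d), F (i ∘ ⇑s⁻¹) • gof s := rfl
lemma resH_apply (i : Fin d → Fin n) (F : IS d n) :
    resH i F = ∑ s : Equiv.Perm (Fin d), F (i ∘ ⇑s) • gof s := rfl

lemma coeff_sum_gof (c : Equiv.Perm (Fin d) → ℂ) (r : Equiv.Perm (Fin d)) :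
    (∑ s, c s • gof s : GA d).coeff r = c r := by
  classical
  rw [MonoidAlgebra.coeff_sum, Finsupp.finsetSum_apply, Finset.sum_eq_single r]
  · simp [gof]
  · intro b _ hb; simp [gof, hb]
  · intro h; exact absurd (Finset.mem_univ _) h

lemma resF_ne {i : Fin d → Fin n} {F : IS d n} (h : F i ≠ 0) : resF i F ≠ 0 := by
  intro e
  have := congrArg (fun x : GA d => x.coeff 1) e
  rw [resF_apply] at this
  simp only [coeff_sum_gof] at this
  exact h this

lemma resH_ne {i : Fin d → Fin n} {F : IS d n} (h : F i ≠ 0) : resH i F ≠ 0 := by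
  intro e
  have := congrArg (fun x : GA d => x.coeff 1) e
  rw [resH_apply] at this
  simp only [coeff_sum_gof] at this
  exact h this

lemma resF_Rgt (i : Fin d → Fin n) (x : GA d) (F : IS d n) :
    resF i (Rgt x F) = x * resF i F := by
  induction x using ga_induction with
  | hof z =>
    rw [resF_apply, resF_apply, Finset.mul_sum]
    symm
    apply Finset.sum_bij (fun s _ => z * s)
    · intro _ _; exact Finset.mem_univ _
    · intro a _ b _ e; exact mul_left_cancel e
    · intro s _; exact ⟨z⁻¹ * s, Finset.mem_univ _, by simp⟩
    · intro s _
      rw [mul_smul_comm, ← map_mul, Rgt_of]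
      congr 2
      funext k
      show i (s⁻¹ k) = i ((z * s)⁻¹ (z k))
      rw [mul_inv_rev, Equiv.Perm.mul_apply, show z⁻¹ (z k) = k from z.symm_apply_apply k]
  | hadd x y hx hy => rw [map_add, LinearMap.add_apply, map_add, hx, hy, add_mul]
  | hsmul r x hx => rw [map_smul, LinearMap.smul_apply, map_smul, hx, smul_mul_assoc]

lemma resH_Rgt (i : Fin d → Fin n) (z : Equiv.Perm (Fin d)) (F : IS d n) :
    resH i (Rgt (gof z) F) = resH i F * gof z⁻¹ := by
  rw [resH_apply, resH_apply, Finset.sum_mul]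
  apply Finset.sum_bij (fun s _ => s * z)
  · intro _ _; exact Finset.mem_univ _
  · intro a _ b _ e; exact mul_right_cancel e
  · intro s _; exact ⟨s * z⁻¹, Finset.mem_univ _, by simp⟩
  · intro s _
    rw [smul_mul_assoc, ← map_mul, Rgt_of, mul_inv_cancel_right]
    rfl

lemma resH_mul_resF (i : Fin d → Fin n) (j : Fin d → Fin m) (F : IS d n) (H : IS d m) :
    resH j H * resF i F =
      ∑ r : Equiv.Perm (Fin d), (∑ s : Equiv.Perm (Fin d), F (i ∘ s) * H ((j ∘ r) ∘ s)) • gof r := by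
  rw [resH_apply, resF_apply, Finset.sum_mul_sum, Finset.sum_comm]
  simp_rw [Finset.sum_smul]
  conv_rhs => rw [Finset.sum_comm]
  rw [← Equiv.sum_comp (Equiv.inv (Equiv.Perm (Fin d)))]
  apply Finset.sum_congr rfl
  intro s _
  rw [← Equiv.sum_comp (Equiv.mulRight s)]
  apply Finset.sum_congr rfl
  intro r _
  simp only [Equiv.inv_apply, Equiv.coe_mulRight, inv_inv]
  rw [smul_mul_smul_comm, ← map_mul, mul_inv_cancel_right, mul_comm]
  rfl

lemma pair_indep {σ : Type*} [Fintype σ] (e : σ → PT d) (he : Function.Injective e)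
    (F X : σ → IS d n) (H X' : σ → IS d m)
    (hF : ∀ a, F a ≠ 0) (hH : ∀ a, H a ≠ 0)
    (hFi : ∀ a, InjSupp (F a)) (hHi : ∀ a, InjSupp (H a))
    (hFX : ∀ a, F a = Rgt (youngSymmetrizer (frow (e a)) (fcol (e a))) (X a))
    (hHX : ∀ a, H a = Rgt (colSymmetrizer (fcol (e a)) * rowSymmetrizer (frow (e a))) (X' a))
    (t : σ → ℂ) (ht : ∑ a, t a • PairL (F a) (H a) = 0) (a0 : σ) : t a0 = 0 := by
  classical
  obtain ⟨i, hi⟩ := Function.ne_iff.1 (hF a0)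
  obtain ⟨j, hj⟩ := Function.ne_iff.1 (hH a0)
  have hii := hFi a0 i hi
  have hjj := hHi a0 j hj
  have h1 : ∑ a, t a • (resH j (H a) * resF i (F a)) = 0 := by
    simp_rw [resH_mul_resF, Finset.smul_sum]
    rw [Finset.sum_comm]
    apply Finset.sum_eq_zero
    intro r _
    have h2 := congrFun ht (mkR hii (hjj.comp r.injective))
    rw [Finset.sum_apply] at h2
    simp only [Pi.smul_apply, PairL_mkR, smul_eq_mul, Pi.zero_apply] at h2
    simp_rw [smul_smul]
    rw [← Finset.sum_smul]
    rw [h2, zero_smul]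
  have hH' : ∀ a, resH j (H a) ∈ spechtModule (frow (e a)) (fcol (e a)) := by
    intro a
    rw [hHX, map_mul, Module.End.mul_apply, anti_col (resH_Rgt j), anti_row (resH_Rgt j), mul_assoc]
    exact mem_specht.2 ⟨_, rfl⟩
  obtain ⟨g, hg⟩ : ∃ g, youngSymmetrizer (frow (e a0)) (fcol (e a0)) * gof g * resH j (H a0) ≠ 0 := by
    by_contra hcon
    push Not at hcon
    exact resH_ne hj (specht_sep (hH' a0) hcon)
  have h3 := congrArg (fun x => youngSymmetrizer (frow (e a0)) (fcol (e a0)) * gof g * x) h1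
  simp only [Finset.mul_sum, mul_zero] at h3
  rw [Finset.sum_eq_single a0] at h3
  · rw [mul_smul_comm, ← mul_assoc, young_mul_specht (ffill _) (hH' a0), smul_mul_assoc, hFX,
      resF_Rgt, ← mul_assoc] at h3
    obtain ⟨q, hq⟩ := young_x_young (ffill (e a0)) 1
    rw [mul_one] at hq
    have hq0 : q ≠ 0 := fun e' => young_sq_ne_zero (ffill (e a0)) (by rw [hq, e', zero_smul])
    rw [hq, smul_mul_assoc, ← resF_Rgt, ← hFX] at h3
    rw [young_mul_specht (ffill _) (hH' a0)] at hg
    have hg' := (smul_ne_zero_iff.1 hg).1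
    exact (smul_eq_zero.1 h3).resolve_right
      (smul_ne_zero hg' (smul_ne_zero hq0 (resF_ne hi)))
  · intro a _ ha
    rw [mul_smul_comm, ← mul_assoc, young_mul_specht_zero (ffill _) (ffill _)
      (fun e' => ha (he (Subtype.ext e')).symm) (hH' a), zero_mul, smul_zero]
  · intro h; exact absurd (Finset.mem_univ _) h

end pairing

section counting
variable {d n m : ℕ}

lemma isPieri_iff (mu : PT d) (l : PT n) : IsPieri mu.1 ((n : ℤ) - d) l.1 ↔ Strip mu.1 l.1 := by
  unfold IsPieri Strip
  rw [mu.2, l.2]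
  constructor
  · exact fun h => h.2
  · exact fun h => ⟨by ring, h⟩

/-- The multiplicity set. -/
abbrev MS (d : ℕ) (lr : PT n × PT m) := {mu : Ptn // mu.size = d ∧
  IsPieri mu ((n : ℤ) - d) lr.1.1 ∧ IsPieri mu ((m : ℤ) - d) lr.2.1}

/-- Forgetful map to partitions of `d`. -/
def msPT {lr : PT n × PT m} (a : MS d lr) : PT d := ⟨a.1, a.2.1⟩

lemma msPT_inj {lr : PT n × PT m} : Function.Injective (msPT : MS d lr → PT d) := by
  intro a b e
  exact Subtype.ext (congrArg (fun x : PT d => x.1) e)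

instance {lr : PT n × PT m} : Finite (MS d lr) := Finite.of_injective _ msPT_inj

open scoped Classical in
lemma card_MS (lr : PT n × PT m) : Nat.card (MS d lr) =
    ∑ mu : PT d, (if Strip mu.1 lr.1.1 then 1 else 0) * (if Strip mu.1 lr.2.1 then 1 else 0) := by
  have e : MS d lr ≃ {mu : PT d // Strip mu.1 lr.1.1 ∧ Strip mu.1 lr.2.1} :=
    { toFun := fun a => ⟨msPT a, (isPieri_iff (msPT a) lr.1).1 a.2.2.1,
        (isPieri_iff (msPT a) lr.2).1 a.2.2.2⟩
      invFun := fun a => ⟨a.1.1, a.1.2, (isPieri_iff a.1 lr.1).2 a.2.1, (isPieri_iff a.1 lr.2).2 a.2.2⟩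
      left_inv := fun a => rfl
      right_inv := fun a => rfl }
  rw [Nat.card_congr e, Nat.card_eq_fintype_card, Fintype.card_subtype, Finset.card_filter]
  apply Finset.sum_congr rfl
  intro mu _
  by_cases h1 : Strip mu.1 lr.1.1 <;> by_cases h2 : Strip mu.1 lr.2.1 <;> simp [h1, h2]

lemma dim_sum : ∑ lr : PT n × PT m, Nat.card (MS d lr) * (fl n lr.1.1 * fl m lr.2.1) =
    n.choose d * m.choose d * d.factorial := by
  classical
  simp_rw [card_MS, Finset.sum_mul]
  rw [Finset.sum_comm]
  calc _ = ∑ mu : PT d, (∑ l : PT n, if Strip mu.1 l.1 then fl n l.1 else 0) *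
        (∑ r : PT m, if Strip mu.1 r.1 then fl m r.1 else 0) := by
        apply Finset.sum_congr rfl
        intro mu _
        rw [Finset.sum_mul_sum, Fintype.sum_prod_type]
        apply Finset.sum_congr rfl
        intro l _
        apply Finset.sum_congr rfl
        intro r _
        by_cases h1 : Strip mu.1 l.1 <;> by_cases h2 : Strip mu.1 r.1 <;> simp [h1, h2]
    _ = _ := by
        simp_rw [pieri_sum]
        rw [← fl_sq d, Finset.mul_sum]
        apply Finset.sum_congr rfl
        intro mu _
        ring

/-- Choice of a parametrization. -/
noncomputable def rzPar (R : RZ n m d) : Fin d → Fin n × Fin m :=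
  fun k => ((R.1.equivFinOfCardEq R.2.2).symm k).1

lemma rzPar_inj (R : RZ n m d) : Function.Injective (rzPar R) :=
  fun _ _ e => (R.1.equivFinOfCardEq R.2.2).symm.injective (Subtype.ext e)

lemma rzPar_range (R : RZ n m d) : Set.range (rzPar R) = R.1 := by
  ext p
  constructor
  · rintro ⟨k, rfl⟩
    exact ((R.1.equivFinOfCardEq R.2.2).symm k).2
  · intro hp
    exact ⟨R.1.equivFinOfCardEq R.2.2 ⟨p, hp⟩, by simp [rzPar]⟩

lemma rzPar_mem (R : RZ n m d) (k : Fin d) : rzPar R k ∈ R.1 :=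
  ((R.1.equivFinOfCardEq R.2.2).symm k).2

lemma rzPar_fst (R : RZ n m d) : Function.Injective (fun k => (rzPar R k).1) := by
  intro a b e
  by_contra hne
  exact (R.2.1 _ (rzPar_mem R a) _ (rzPar_mem R b) ((rzPar_inj R).ne hne)).1 e

lemma rzPar_snd (R : RZ n m d) : Function.Injective (fun k => (rzPar R k).2) := by
  intro a b e
  by_contra hne
  exact (R.2.1 _ (rzPar_mem R a) _ (rzPar_mem R b) ((rzPar_inj R).ne hne)).2 e

lemma card_RZ_le [Fintype (RZ n m d)] : Fintype.card (RZ n m d) ≤ n.choose d * m.choose d * d.factorial := by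
  classical
  let φ : RZ n m d × Equiv.Perm (Fin d) → (Fin d ↪ Fin n) × (Fin d ↪ Fin m) := fun p =>
    (⟨fun k => (rzPar p.1 (p.2 k)).1, (rzPar_fst p.1).comp p.2.injective⟩,
      ⟨fun k => (rzPar p.1 (p.2 k)).2, (rzPar_snd p.1).comp p.2.injective⟩)
  have hφ : Function.Injective φ := by
    rintro ⟨R, s⟩ ⟨R', s'⟩ e
    have e1 : ∀ k, rzPar R (s k) = rzPar R' (s' k) := by
      intro k
      apply Prod.ext
      · exact DFunLike.congr_fun (congrArg Prod.fst e) k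
      · exact DFunLike.congr_fun (congrArg Prod.snd e) k
    have e2 : R = R' := by
      apply Subtype.ext
      apply Finset.coe_injective
      rw [← rzPar_range, ← rzPar_range, ← s.surjective.range_comp (rzPar R), ← s'.surjective.range_comp (rzPar R')]
      congr 1
      funext k
      exact e1 k
    subst e2
    have e3 : s = s' := by
      ext k
      rw [rzPar_inj R (e1 k)]
    rw [e3]
  have h := Fintype.card_le_of_injective φ hφ
  rw [Fintype.card_prod, Fintype.card_prod, Fintype.card_embedding_eq, Fintype.card_embedding_eq,
    Fintype.card_perm] at h
  simp only [Fintype.card_fin] at h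
  rw [Nat.descFactorial_eq_factorial_mul_choose, Nat.descFactorial_eq_factorial_mul_choose] at h
  have hpos := Nat.factorial_pos d
  refine Nat.le_of_mul_le_mul_right (h.trans (le_of_eq ?_)) hpos
  ring

end counting

section mainmap
variable {d n m : ℕ}

lemma tensor_sep {V W G H : Type*} [AddCommGroup V] [Module ℂ V] [AddCommGroup W] [Module ℂ W]
    [Finite G] [Finite H] (a : G → V →ₗ[ℂ] ℂ) (b : H → W →ₗ[ℂ] ℂ)
    (ha : ∀ v, (∀ g, a g v = 0) → v = 0) (hb : ∀ v, (∀ g, b g v = 0) → v = 0)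
    (t : V ⊗[ℂ] W)
    (ht : ∀ g h, TensorProduct.lift ((LinearMap.mul ℂ ℂ).compl₁₂ (a g) (b h)) t = 0) : t = 0 := by
  classical
  let α : V →ₗ[ℂ] (G → ℂ) := LinearMap.pi a
  let β : W →ₗ[ℂ] (H → ℂ) := LinearMap.pi b
  have hα : Function.Injective α := by
    rw [← LinearMap.ker_eq_bot, LinearMap.ker_eq_bot']
    exact fun v hv => ha v (fun g => congrFun hv g)
  have hβ : Function.Injective β := by
    rw [← LinearMap.ker_eq_bot, LinearMap.ker_eq_bot']
    exact fun v hv => hb v (fun g => congrFun hv g)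
  have hinj := TensorProduct.map_injective_of_flat_flat α β hα hβ
  apply hinj
  rw [map_zero]
  apply ((Pi.basisFun ℂ G).tensorProduct (Pi.basisFun ℂ H)).ext_elem
  rintro ⟨g, h⟩
  rw [map_zero, Finsupp.zero_apply, ← ht g h]
  clear ht
  induction t using TensorProduct.induction_on with
  | zero => simp
  | tmul x y =>
    rw [TensorProduct.map_tmul, Module.Basis.tensorProduct_repr_tmul_apply]
    simp [α, β, mul_comm]
  | add x y hx hy => 
    rw [map_add, map_add, Finsupp.add_apply, hx, hy, map_add]

/-- `x ↦ Lft x Y`. -/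
noncomputable def TL (Y : IS d n) : GA n →ₗ[ℂ] IS d n := (LinearMap.applyₗ Y).comp Lft.toLinearMap

lemma TL_apply (Y : IS d n) (x : GA n) : TL Y x = Lft x Y := rfl

/-- The map to functions on rook placements attached to a pair of vectors. -/
noncomputable def Phi (Y : IS d n) (Y' : IS d m) : GA n ⊗[ℂ] GA m →ₗ[ℂ] (RZ n m d → ℂ) :=
  TensorProduct.lift (PairL.compl₁₂ (TL Y) (TL Y'))

lemma Phi_tmul (Y : IS d n) (Y' : IS d m) (x : GA n) (y : GA m) :
    Phi Y Y' (x ⊗ₜ y) = PairL (Lft x Y) (Lft y Y') := rfl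

lemma Phi_equiv (Y : IS d n) (Y' : IS d m) (g : Equiv.Perm (Fin n)) (h : Equiv.Perm (Fin m))
    (t : GA n ⊗[ℂ] GA m) (R : RZ n m d) :
    Phi Y Y' ((gof g ⊗ₜ gof h) * t) R = Phi Y Y' t (rookAct g⁻¹ h⁻¹ R) := by
  induction t using TensorProduct.induction_on with
  | zero => simp
  | tmul x y =>
    rw [Algebra.TensorProduct.tmul_mul_tmul, Phi_tmul, Phi_tmul, map_mul, map_mul,
      Module.End.mul_apply, Module.End.mul_apply, PairL_equiv]
  | add x y hx hy => rw [mul_add, map_add, map_add, Pi.add_apply, Pi.add_apply, hx, hy]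

/-- The inclusion of a product of Specht modules. -/
noncomputable def incl (row col : Fin n → ℕ) (row' col' : Fin m → ℕ) :
    (spechtModule row col) ⊗[ℂ] (spechtModule row' col') →ₗ[ℂ] GA n ⊗[ℂ] GA m :=
  TensorProduct.map (spechtModule row col).subtype (spechtModule row' col').subtype

/-- A functional on the Specht module. -/
noncomputable def spf (row col : Fin n → ℕ) (g : Equiv.Perm (Fin n)) : spechtModule row col →ₗ[ℂ] ℂ :=
  (tau.comp (LinearMap.mulLeft ℂ (youngSymmetrizer row col * gof g))).comp
    (spechtModule row col).subtype

lemma spf_sep {l : Ptn} {row col : Fin n → ℕ} (h : IsFilling l row col) (v : spechtModule row col)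
    (hv : ∀ g, spf row col g v = 0) : v = 0 := by
  apply Subtype.ext
  apply specht_sep v.2
  intro g
  rw [young_mul_specht h v.2]
  have := hv g
  change tau (youngSymmetrizer row col * gof g * v.1) = 0 at this
  rw [this, zero_smul]

lemma incl_mul_same {l l' : Ptn} {row col : Fin n → ℕ} {row' col' : Fin m → ℕ}
    (h : IsFilling l row col) (h' : IsFilling l' row' col') (g : Equiv.Perm (Fin n))
    (g' : Equiv.Perm (Fin m)) (t : (spechtModule row col) ⊗[ℂ] (spechtModule row' col')) :
    ((youngSymmetrizer row col * gof g) ⊗ₜ[ℂ] (youngSymmetrizer row' col' * gof g')) *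
        incl row col row' col' t =
      TensorProduct.lift ((LinearMap.mul ℂ ℂ).compl₁₂ (spf row col g) (spf row' col' g')) t •
        (youngSymmetrizer row col ⊗ₜ[ℂ] youngSymmetrizer row' col') := by
  induction t using TensorProduct.induction_on with
  | zero => simp
  | tmul x y =>
    rw [incl, TensorProduct.map_tmul, Algebra.TensorProduct.tmul_mul_tmul]
    simp only [Submodule.subtype_apply]
    rw [young_mul_specht h x.2, young_mul_specht h' y.2, TensorProduct.smul_tmul_smul]
    rfl
  | add x y hx hy => rw [map_add, mul_add, hx, hy, map_add, add_smul]

lemma incl_mul_ne {l l' l0 l0' : Ptn} {row col row0 col0 : Fin n → ℕ}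
    {row' col' row0' col0' : Fin m → ℕ}
    (h : IsFilling l row col) (h' : IsFilling l' row' col') (h0 : IsFilling l0 row0 col0)
    (h0' : IsFilling l0' row0' col0') (hne : l0 ≠ l ∨ l0' ≠ l') (g : Equiv.Perm (Fin n))
    (g' : Equiv.Perm (Fin m)) (t : (spechtModule row col) ⊗[ℂ] (spechtModule row' col')) :
    ((youngSymmetrizer row0 col0 * gof g) ⊗ₜ[ℂ] (youngSymmetrizer row0' col0' * gof g')) *
        incl row col row' col' t = 0 := by
  induction t using TensorProduct.induction_on with
  | zero => simp
  | tmul x y =>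
    rw [incl, TensorProduct.map_tmul, Algebra.TensorProduct.tmul_mul_tmul]
    simp only [Submodule.subtype_apply]
    rcases hne with hne | hne
    · rw [young_mul_specht_zero h0 h hne x.2, TensorProduct.zero_tmul]
    · rw [young_mul_specht_zero h0' h' hne y.2, TensorProduct.tmul_zero]
  | add x y hx hy => rw [map_add, mul_add, hx, hy, add_zero]

lemma incl_act (row col : Fin n → ℕ) (row' col' : Fin m → ℕ) (g : Equiv.Perm (Fin n))
    (g' : Equiv.Perm (Fin m)) (t : (spechtModule row col) ⊗[ℂ] (spechtModule row' col')) :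
    incl row col row' col' (TensorProduct.map (spechtAct row col g) (spechtAct row' col' g') t) =
      (gof g ⊗ₜ gof g') * incl row col row' col' t := by
  induction t using TensorProduct.induction_on with
  | zero => simp
  | tmul x y =>
    rw [TensorProduct.map_tmul, incl, TensorProduct.map_tmul, TensorProduct.map_tmul,
      Algebra.TensorProduct.tmul_mul_tmul]
    rfl
  | add x y hx hy => rw [map_add, map_add, map_add, mul_add, hx, hy]

end mainmap

section final
variable {d n m : ℕ}

lemma main_inj
    (rowfn colfn : PT n → Fin n → ℕ)
    (hfn : ∀ l : PT n, IsFilling l.1 (rowfn l) (colfn l))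
    (rowfm colfm : PT m → Fin m → ℕ)
    (hfm : ∀ l : PT m, IsFilling l.1 (rowfm l) (colfm l))
    (κ : PT n × PT m → Type) [∀ lr, Fintype (κ lr)] (e : ∀ lr, κ lr → PT d)
    (he : ∀ lr, Function.Injective (e lr))
    (X : ∀ lr, κ lr → IS d n) (X' : ∀ lr, κ lr → IS d m)
    (hX : ∀ lr k, InjSupp (X lr k)) (hX' : ∀ lr k, InjSupp (X' lr k))
    (Y : ∀ lr, κ lr → IS d n) (Y' : ∀ lr, κ lr → IS d m)
    (hY : ∀ lr k, Y lr k = Rgt (youngSymmetrizer (frow (e lr k)) (fcol (e lr k))) (X lr k))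
    (hY' : ∀ lr k, Y' lr k =
      Rgt (colSymmetrizer (fcol (e lr k)) * rowSymmetrizer (frow (e lr k))) (X' lr k))
    (hne : ∀ lr k, Lft (youngSymmetrizer (rowfn lr.1) (colfn lr.1)) (Y lr k) ≠ 0)
    (hne' : ∀ lr k, Lft (youngSymmetrizer (rowfm lr.2) (colfm lr.2)) (Y' lr k) ≠ 0)
    (v : ∀ lr : PT n × PT m, κ lr → ((spechtModule (rowfn lr.1) (colfn lr.1)) ⊗[ℂ]
              (spechtModule (rowfm lr.2) (colfm lr.2))))
    (hv : ∑ lr, ∑ k, Phi (Y lr k) (Y' lr k)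
      (incl (rowfn lr.1) (colfn lr.1) (rowfm lr.2) (colfm lr.2) (v lr k)) = 0) : v = 0 := by
  classical
  have h1 : ∀ (x : GA n) (y : GA m), ∑ lr, ∑ k, Phi (Y lr k) (Y' lr k) ((x ⊗ₜ y) *
      (incl (rowfn lr.1) (colfn lr.1) (rowfm lr.2) (colfm lr.2) (v lr k))) = 0 := by
    intro x y
    induction x using ga_induction with
    | hof g =>
      induction y using ga_induction with
      | hof h =>
        funext R
        have := congrFun hv (rookAct g⁻¹ h⁻¹ R)
        simp only [Finset.sum_apply, Pi.zero_apply] at this ⊢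
        simp_rw [Phi_equiv]
        exact this
      | hadd x y hx hy =>
        simp_rw [TensorProduct.tmul_add, add_mul, map_add, Finset.sum_add_distrib]
        rw [hx, hy, add_zero]
      | hsmul r x hx =>
        simp_rw [TensorProduct.tmul_smul, smul_mul_assoc, map_smul, ← Finset.smul_sum]
        rw [hx, smul_zero]
    | hadd x y hx hy =>
      simp_rw [TensorProduct.add_tmul, add_mul, map_add, Finset.sum_add_distrib]
      rw [hx, hy, add_zero]
    | hsmul r x hx =>
      simp_rw [← TensorProduct.smul_tmul', smul_mul_assoc, map_smul, ← Finset.smul_sum]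
      rw [hx, smul_zero]
  funext lr0 k0
  apply tensor_sep (spf (rowfn lr0.1) (colfn lr0.1)) (spf (rowfm lr0.2) (colfm lr0.2))
    (spf_sep (hfn lr0.1)) (spf_sep (hfm lr0.2))
  intro g h
  have h2 := h1 (youngSymmetrizer (rowfn lr0.1) (colfn lr0.1) * gof g)
    (youngSymmetrizer (rowfm lr0.2) (colfm lr0.2) * gof h)
  rw [Finset.sum_eq_single lr0] at h2
  · simp_rw [incl_mul_same (hfn lr0.1) (hfm lr0.2), map_smul, Phi_tmul] at h2
    refine pair_indep (e lr0) (he lr0)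
      (fun k => Lft (youngSymmetrizer (rowfn lr0.1) (colfn lr0.1)) (Y lr0 k))
      (fun k => Lft (youngSymmetrizer (rowfn lr0.1) (colfn lr0.1)) (X lr0 k))
      (fun k => Lft (youngSymmetrizer (rowfm lr0.2) (colfm lr0.2)) (Y' lr0 k))
      (fun k => Lft (youngSymmetrizer (rowfm lr0.2) (colfm lr0.2)) (X' lr0 k))
      (hne lr0) (hne' lr0) ?_ ?_ ?_ ?_ _ h2 k0
    · intro k
      rw [hY]
      exact injSupp_Lft (injSupp_Rgt (hX _ _) _) _
    · intro k
      rw [hY']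
      exact injSupp_Lft (injSupp_Rgt (hX' _ _) _) _
    · intro k
      rw [hY, Lft_Rgt_comm]
    · intro k
      rw [hY', Lft_Rgt_comm]
  · intro lr _ hlr
    apply Finset.sum_eq_zero
    intro k _
    rw [incl_mul_ne (hfn lr.1) (hfm lr.2) (hfn lr0.1) (hfm lr0.2), map_zero]
    by_contra hcon
    push Not at hcon
    exact hlr (Prod.ext (Subtype.ext hcon.1.symm) (Subtype.ext hcon.2.symm))
  · intro hh; exact absurd (Finset.mem_univ _) hh

/-- Index type for the multiplicities. -/
abbrev KK (d : ℕ) (lr : PT n × PT m) : Type := Fin (Nat.card (MS d lr))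

/-- The summands. -/
abbrev MV (d : ℕ) (rowfn colfn : PT n → Fin n → ℕ) (rowfm colfm : PT m → Fin m → ℕ)
    (lr : PT n × PT m) : Type :=
  KK d lr → ((spechtModule (rowfn lr.1) (colfn lr.1)) ⊗[ℂ]
    (spechtModule (rowfm lr.2) (colfm lr.2)))

theorem inj_of_ker {A B : Type*} [AddCommMonoid A] [Module ℂ A] [AddCommMonoid B] [Module ℂ B]
    (P : A →ₗ[ℂ] B) (hk : ∀ v, P v = 0 → v = 0) : Function.Injective P := by
  letI : AddCommGroup A := Module.addCommMonoidToAddCommGroup ℂ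
  letI : AddCommGroup B := Module.addCommMonoidToAddCommGroup ℂ
  exact (injective_iff_map_eq_zero P).2 hk

theorem surj_of_inj {A B : Type*} [AddCommMonoid A] [Module ℂ A] [AddCommMonoid B] [Module ℂ B]
    [Module.Finite ℂ A] [Module.Finite ℂ B]
    (P : A →ₗ[ℂ] B) (hk : Function.Injective P)
    (hd : Module.finrank ℂ B ≤ Module.finrank ℂ A) : Function.Surjective P := by
  letI : AddCommGroup A := Module.addCommMonoidToAddCommGroup ℂ
  letI : AddCommGroup B := Module.addCommMonoidToAddCommGroup ℂ
  have h1 := LinearMap.finrank_le_finrank_of_injective hk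
  exact (LinearMap.injective_iff_surjective_of_finrank_eq_finrank (le_antisymm h1 hd)).1 hk

end final

open scoped Classical in
/-- as `S_n × S_m`-modules,
`ℂ[Z_{n,m,d}] ≅ ⊕_{μ⊢d} Ind_{S_d×S_{n−d}}^{S_n}(V^μ ⊗ triv) ⊗ Ind_{S_d×S_{m−d}}^{S_m}(V^μ ⊗ triv)`;
equivalently (as formalized here, via the Frobenius image
`Σ_{μ⊢d} (s_μ·h_{n−d}) ⊗ (s_μ·h_{m−d})` and Pieri's rule), the function space on
the size-`d` rook placements decomposes as `⊕_{λ⊢n, ρ⊢m} (V^λ ⊗ V^ρ)^{⊕ c(λ,ρ)}`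
where `c(λ,ρ) = #{μ ⊢ d : λ/μ and ρ/μ are horizontal strips of sizes n−d, m−d}`. -/
theorem rook_function_space_decomposition (n m d : ℕ) (hd : d ≤ min n m)
    (rowfn colfn : {l : Ptn // l.size = n} → Fin n → ℕ)
    (hfn : ∀ l : {l : Ptn // l.size = n}, IsFilling l.1 (rowfn l) (colfn l))
    (rowfm colfm : {l : Ptn // l.size = m} → Fin m → ℕ)
    (hfm : ∀ l : {l : Ptn // l.size = m}, IsFilling l.1 (rowfm l) (colfm l)) :
    ∃ e : ({R : Finset (Fin n × Fin m) // IsRookPlacement R ∧ R.card = d} → ℂ) ≃ₗ[ℂ]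
        ⨁ lr : {l : Ptn // l.size = n} × {l : Ptn // l.size = m},
          (Fin (Nat.card {mu : Ptn // mu.size = d ∧
              IsPieri mu ((n : ℤ) - d) lr.1.1 ∧ IsPieri mu ((m : ℤ) - d) lr.2.1}) →
            ((spechtModule (rowfn lr.1) (colfn lr.1)) ⊗[ℂ]
              (spechtModule (rowfm lr.2) (colfm lr.2)))),
      ∀ (g : Equiv.Perm (Fin n)) (h : Equiv.Perm (Fin m))
        (f : {R : Finset (Fin n × Fin m) // IsRookPlacement R ∧ R.card = d} → ℂ),
        e (fun R => f (rookAct g⁻¹ h⁻¹ R)) =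
        DFinsupp.mapRange
          (fun lr v => (TensorProduct.map
              (spechtAct (rowfn lr.1) (colfn lr.1) g)
              (spechtAct (rowfm lr.2) (colfm lr.2) h)) ∘ v)
          (fun lr => by ext i; simp) (e f) := by
  let ε : ∀ lr : PT n × PT m, KK d lr ≃ MS d lr := fun lr => (Finite.equivFin (MS d lr)).symm
  let E : ∀ lr, KK d lr → PT d := fun lr k => msPT (ε lr k)
  have hs1 : ∀ lr k, Strip (E lr k).1 lr.1.1 := fun lr k =>
    (isPieri_iff (E lr k) lr.1).1 (ε lr k).2.2.1
  have hs2 : ∀ lr k, Strip (E lr k).1 lr.2.1 := fun lr k =>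
    (isPieri_iff (E lr k) lr.2).1 (ε lr k).2.2.2
  have hn1 := fun lr k => strip_nonvanish (hfn lr.1) (ffill (E lr k)) (hs1 lr k).1 (hs1 lr k).2
  have hn2 := fun lr k => strip_nonvanish (hfm lr.2) (ffill (E lr k)) (hs2 lr k).1 (hs2 lr k).2
  choose i hi _ hin using hn1
  choose j hj hjn _ using hn2
  let X : ∀ lr, KK d lr → IS d n := fun lr k => Rgt (rowSymmetrizer (frow (E lr k))) (dlt (i lr k))
  let X' : ∀ lr, KK d lr → IS d m := fun lr k => dlt (j lr k)
  let Y : ∀ lr, KK d lr → IS d n := fun lr k =>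
    Rgt (youngSymmetrizer (frow (E lr k)) (fcol (E lr k))) (X lr k)
  let Y' : ∀ lr, KK d lr → IS d m := fun lr k =>
    Rgt (colSymmetrizer (fcol (E lr k)) * rowSymmetrizer (frow (E lr k))) (X' lr k)
  let P : (∀ lr, MV d rowfn colfn rowfm colfm lr) →ₗ[ℂ] (RZ n m d → ℂ) :=
    ∑ lr, ∑ k : KK d lr, (((Phi (Y lr k) (Y' lr k)).comp
      (incl (rowfn lr.1) (colfn lr.1) (rowfm lr.2) (colfm lr.2))).comp
        (LinearMap.proj k)).comp (LinearMap.proj lr)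
  have hP : ∀ v, P v = ∑ lr, ∑ k : KK d lr, Phi (Y lr k) (Y' lr k)
      (incl (rowfn lr.1) (colfn lr.1) (rowfm lr.2) (colfm lr.2) (v lr k)) := by
    intro v
    simp only [P, LinearMap.sum_apply]
    rfl
  have hinj : Function.Injective P := by
    apply inj_of_ker
    intro v hv
    rw [hP] at hv
    exact main_inj rowfn colfn hfn rowfm colfm hfm (KK d) E
      (fun lr => msPT_inj.comp (ε lr).injective) X X'
      (fun lr k => injSupp_Rgt (injSupp_dlt (hi lr k)) _) (fun lr k => injSupp_dlt (hj lr k))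
      Y Y' (fun _ _ => rfl) (fun _ _ => rfl) hin hjn v hv
  have hdim : Module.finrank ℂ (RZ n m d → ℂ) ≤ Module.finrank ℂ (∀ lr, MV d rowfn colfn rowfm colfm lr) := by
    rw [Module.finrank_fintype_fun_eq_card]
    refine card_RZ_le.trans ?_
    rw [← dim_sum, Module.finrank_pi_fintype]
    apply Finset.sum_le_sum
    intro lr _
    show _ ≤ Module.finrank ℂ (KK d lr → ((spechtModule (rowfn lr.1) (colfn lr.1)) ⊗[ℂ]
      (spechtModule (rowfm lr.2) (colfm lr.2))))
    rw [Module.finrank_pi_fintype, Finset.sum_const, Finset.card_univ, smul_eq_mul,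
      Fintype.card_fin, Module.finrank_tensorProduct]
    exact Nat.mul_le_mul_left _ (Nat.mul_le_mul (fl_le_dim (hfn lr.1)) (fl_le_dim (hfm lr.2)))
  let e0 : (∀ lr, MV d rowfn colfn rowfm colfm lr) ≃ₗ[ℂ] (RZ n m d → ℂ) :=
    LinearEquiv.ofBijective P ⟨hinj, surj_of_inj P hinj hdim⟩
  have he0 : ∀ v, e0 v = P v := fun v => rfl
  let e1 : (⨁ lr, MV d rowfn colfn rowfm colfm lr) ≃ₗ[ℂ] (∀ lr, MV d rowfn colfn rowfm colfm lr) := DirectSum.linearEquivFunOnFintype ℂ _ (MV d rowfn colfn rowfm colfm)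
  have he1 : ∀ (v : ⨁ lr, MV d rowfn colfn rowfm colfm lr) (lr), e1 v lr = v lr := fun v lr => rfl
  refine ⟨(e1.trans e0).symm, ?_⟩
  intro g h f
  rw [LinearEquiv.symm_apply_eq]
  obtain ⟨w, rfl⟩ := (e1.trans e0).surjective f
  rw [LinearEquiv.symm_apply_apply, LinearEquiv.trans_apply, LinearEquiv.trans_apply, he0, he0,
    hP, hP]
  funext R
  simp only [Finset.sum_apply]
  apply Finset.sum_congr rfl
  intro lr _
  apply Finset.sum_congr rfl
  intro k _
  rw [he1, he1, ← Phi_equiv, ← incl_act]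
  rfl
end
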